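/- Fix σ > 0 and constants α, β_w⁺ ∈ (0,1) with β_w⁺ < α for which there exist α_w⁺ ∈ (0, α) and t ≥ 0 satisfying (2/√π)·∫₀ᵗ e^{−s²} ds = 2·(1 − α_w⁺)/(1 − β_w⁺) − 1 and (1 − β_w⁺)·√(1/(2π))·e^{−t²} = α_w⁺·√2·t. For each n let m = ⌈α·n⌉, k = ⌈β_w⁺·n⌉; let A be a random m×n matrix with i.i.d. N(0,1) entries, v ∈ ℝᵐ independent with i.i.d. N(0,σ²) entries; for a k-sparse nonnegative x̃ set y = A·x̃ + v and define the signed LASSO value ζ_obj⁺ = inf { ‖y − A·x‖₂ : ‖x‖₁ ≤ ‖x̃‖₁, x_i ≥ 0 for all i }. Then for every ε₁ ∈ (0,1) there exist ε₂, ε₃ > 0 and N such that for all n ≥ N: (i) there exists a k-sparse nonnegative x̃ such that, with probability at least 1 − e^{−ε₂·n}, some minimizer x̂ of ζ_obj⁺ satisfies (1 − ε₁)·σ·√(α_w⁺/(α − α_w⁺)) ≤ ‖x̂ − x̃‖₂ ≤ (1 + ε₁)·σ·√(α_w⁺/(α − α_w⁺)); and (ii) for every k-sparse nonnegative x̃,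 with probability at least 1 − e^{−ε₃·n}, every minimizer x̂ of ζ_obj⁺ satisfies ‖x̂ − x̃‖₂ ≤ (1 + ε₁)·σ·√(α_w⁺/(α − α_w⁺)). -/

import Mathlib

open MeasureTheory ProbabilityTheory

noncomputable def e2norm {d : ℕ} (x : Fin d → ℝ) : ℝ := Real.sqrt (∑ i, x i ^ 2)

noncomputable def l1norm {d : ℕ} (x : Fin d → ℝ) : ℝ := ∑ i, |x i|

def kSparseNonneg (n k : ℕ) (x : Fin n → ℝ) : Prop :=
  (∀ i : Fin n, (i : ℕ) < n - k → x i = 0) ∧ ∀ i, 0 ≤ x i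

noncomputable def mDim (α : ℝ) (n : ℕ) : ℕ := ⌈α * (n : ℝ)⌉₊

noncomputable def kDim (β : ℝ) (n : ℕ) : ℕ := ⌈β * (n : ℝ)⌉₊

noncomputable def muAv (m n : ℕ) (σ : ℝ) :
    Measure ((Fin m → Fin n → ℝ) × (Fin m → ℝ)) :=
  (Measure.pi fun _ : Fin m => Measure.pi fun _ : Fin n => gaussianReal 0 1).prod
    (Measure.pi fun _ : Fin m => gaussianReal 0 (σ ^ 2).toNNReal)

/-- ‖y − A·x‖₂ with y = A·x̃ + v, for the sample ω = (A, v). -/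
noncomputable def lassoVal (m n : ℕ) (xt : Fin n → ℝ)
    (ω : (Fin m → Fin n → ℝ) × (Fin m → ℝ)) (x : Fin n → ℝ) : ℝ :=
  e2norm (fun i => ((∑ j, ω.1 i j * xt j) + ω.2 i) - ∑ j, ω.1 i j * x j)

/-- ζ_obj⁺(A, v): the optimal value of the signed LASSO (3.1). -/
noncomputable def zetaObjP (m n : ℕ) (xt : Fin n → ℝ)
    (ω : (Fin m → Fin n → ℝ) × (Fin m → ℝ)) : ℝ :=
  sInf {r : ℝ | ∃ x : Fin n → ℝ, l1norm x ≤ l1norm xt ∧ (∀ i, 0 ≤ x i) ∧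
    r = lassoVal m n xt ω x}

noncomputable abbrev stdG (κ : Type) [Fintype κ] : Measure (κ → ℝ) :=
  Measure.pi fun _ : κ => gaussianReal 0 1

lemma integrable_exp_abs (c : ℝ) : Integrable (fun x : ℝ => Real.exp (c * |x|)) (gaussianReal 0 1) := by
  have h1 := (integrable_exp_mul_gaussianReal (μ := 0) (v := 1) c).add
    (integrable_exp_mul_gaussianReal (μ := 0) (v := 1) (-c))
  refine h1.mono' (by fun_prop) (Filter.Eventually.of_forall fun x => ?_)
  simp only [Real.norm_eq_abs, Real.abs_exp, Pi.add_apply]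
  rcases abs_cases x with ⟨h, _⟩ | ⟨h, _⟩ <;> rw [h]
  · have := Real.exp_pos (-c * x); linarith
  · have := Real.exp_pos (c * x)
    have e : c * -x = -c * x := by ring
    rw [e]; linarith

lemma integrable_exp_sum_abs {κ : Type} [Fintype κ] (c : ℝ) :
    Integrable (fun ξ : κ → ℝ => Real.exp (c * ∑ k, |ξ k|)) (stdG κ) := by
  have := Integrable.fintype_prod (ι := κ) (μ := fun _ => gaussianReal 0 1)
    (f := fun _ x => Real.exp (c * |x|)) (fun _ => integrable_exp_abs c)
  refine this.congr (Filter.Eventually.of_forall fun ξ => ?_)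
  simp only [← Real.exp_sum, Finset.mul_sum]

lemma integrable_of_exp_bound {κ : Type} [Fintype κ] {f : (κ → ℝ) → ℝ} {C c : ℝ}
    (hf : Measurable f) (hb : ∀ ξ, |f ξ| ≤ C * Real.exp (c * ∑ k, |ξ k|)) :
    Integrable f (stdG κ) :=
  ((integrable_exp_sum_abs c).const_mul C).mono' hf.aestronglyMeasurable
    (Filter.Eventually.of_forall hb)

lemma integrable_of_exp_bound1 {f : ℝ → ℝ} {C c : ℝ}
    (hf : Measurable f) (hb : ∀ x, |f x| ≤ C * Real.exp (c * |x|)) :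
    Integrable f (gaussianReal 0 1) :=
  ((integrable_exp_abs c).const_mul C).mono' hf.aestronglyMeasurable
    (Filter.Eventually.of_forall hb)

lemma integrable_pdf_mul {f : ℝ → ℝ} (h : Integrable f (gaussianReal 0 1)) :
    Integrable (fun x => gaussianPDFReal 0 1 x * f x) := by
  rw [gaussianReal_of_var_ne_zero _ (by simp : (1:NNReal) ≠ 0)] at h
  rw [integrable_withDensity_iff_integrable_smul' (measurable_gaussianPDF _ _)
    (Filter.Eventually.of_forall fun _ => gaussianPDF_lt_top)] at h
  simpa [toReal_gaussianPDF] using h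

lemma hasDerivAt_pdf (x : ℝ) : HasDerivAt (gaussianPDFReal 0 1) (-x * gaussianPDFReal 0 1 x) x := by
  have h : HasDerivAt (fun x : ℝ => -(x ^ 2) / 2) (-x) x := by
    have := ((hasDerivAt_pow 2 x).neg).div_const 2
    refine this.congr_deriv ?_
    simp; ring
  have := (h.exp).const_mul ((Real.sqrt (2 * Real.pi))⁻¹)
  have e : gaussianPDFReal 0 1 = fun y : ℝ => (Real.sqrt (2 * Real.pi))⁻¹ * Real.exp (-(y^2)/2) := by
    ext y; simp [gaussianPDFReal]
  rw [e]
  refine this.congr_deriv ?_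
  ring

lemma abs_le_exp_abs (x : ℝ) : |x| ≤ Real.exp |x| := by
  have := Real.add_one_le_exp |x|; linarith

lemma stein1 {f f' : ℝ → ℝ} {C c : ℝ} (hd : ∀ x, HasDerivAt f (f' x) x) (hm : Measurable f')
    (hb : ∀ x, |f x| ≤ C * Real.exp (c * |x|)) (hb' : ∀ x, |f' x| ≤ C * Real.exp (c * |x|)) :
    ∫ x, x * f x ∂(gaussianReal 0 1) = ∫ x, f' x ∂(gaussianReal 0 1) := by
  have hf : Measurable f :=
    (continuous_iff_continuousAt.2 fun x => (hd x).continuousAt).measurable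
  have i1 : Integrable (fun x => x * f x) (gaussianReal 0 1) := by
    refine integrable_of_exp_bound1 (C := C) (c := c + 1) (by fun_prop) fun x => ?_
    rw [abs_mul]
    have e : C * Real.exp ((c+1) * |x|) = Real.exp |x| * (C * Real.exp (c * |x|)) := by
      rw [add_mul, Real.exp_add]; ring_nf
    rw [e]
    exact mul_le_mul (abs_le_exp_abs x) (hb x) (abs_nonneg _) (Real.exp_pos _).le
  have i2 := integrable_of_exp_bound1 hm hb'
  have i3 := integrable_of_exp_bound1 hf hb
  rw [integral_gaussianReal_eq_integral_smul (by simp), integral_gaussianReal_eq_integral_smul (by simp)]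
  have key := integral_mul_deriv_eq_deriv_mul_of_integrable (u := f) (u' := f')
    (v := gaussianPDFReal 0 1) (v' := fun x => -x * gaussianPDFReal 0 1 x)
    (fun x _ => hd x) (fun x _ => hasDerivAt_pdf x)
    (by refine (integrable_pdf_mul i1).neg.congr (Filter.Eventually.of_forall fun x => ?_)
        simp; ring)
    (by refine (integrable_pdf_mul i2).congr (Filter.Eventually.of_forall fun x => ?_)
        simp; ring)
    (by refine (integrable_pdf_mul i3).congr (Filter.Eventually.of_forall fun x => ?_)
        simp; ring)
  have e1 : ∫ x, gaussianPDFReal 0 1 x • (x * f x) = - ∫ x, f x * (-x * gaussianPDFReal 0 1 x) := by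
    rw [← integral_neg]; congr 1; ext x; simp; ring
  rw [e1, key, neg_neg]
  congr 1; ext x; simp; ring

lemma map_update_stdG {κ : Type} [Fintype κ] [DecidableEq κ] (k : κ) :
    MeasurePreserving (fun p : (κ → ℝ) × ℝ => Function.update p.1 k p.2)
      ((stdG κ).prod (gaussianReal 0 1)) (stdG κ) := by
  have hm : Measurable (fun p : (κ → ℝ) × ℝ => Function.update p.1 k p.2) := by
    refine measurable_pi_iff.2 fun j => ?_
    by_cases h : j = k
    · subst h; simpa using measurable_snd
    · simp only [Function.update_of_ne h]; fun_prop
  refine ⟨hm, (Measure.pi_eq fun s hs => ?_).symm⟩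
  rw [Measure.map_apply hm (MeasurableSet.univ_pi hs)]
  have : (fun p : (κ → ℝ) × ℝ => Function.update p.1 k p.2) ⁻¹' (Set.univ.pi s) =
      (Set.univ.pi (Function.update s k Set.univ)) ×ˢ (s k) := by
    ext p
    simp only [Set.mem_preimage, Set.mem_pi, Set.mem_univ, true_implies, Set.mem_prod]
    constructor
    · intro h
      refine ⟨fun j => ?_, by simpa using h k⟩
      by_cases hj : j = k
      · subst hj; simp
      · simpa [Function.update_of_ne hj] using h j
    · rintro ⟨h1, h2⟩ j
      by_cases hj : j = k
      · subst hj; simpa using h2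
      · simpa [Function.update_of_ne hj] using h1 j
  rw [this, Measure.prod_prod, Measure.pi_pi]
  rw [← Finset.prod_erase_mul _ _ (Finset.mem_univ k), ← Finset.prod_erase_mul (a := k) _ _ (Finset.mem_univ k)]
  simp only [Function.update_self, measure_univ, mul_one]
  congr 1
  refine Finset.prod_congr rfl fun j hj => ?_
  rw [Function.update_of_ne (Finset.ne_of_mem_erase hj)]

lemma stein_pi {κ : Type} [Fintype κ] [DecidableEq κ] (k : κ) {f f' : (κ → ℝ) → ℝ} {C c : ℝ}
    (hf : Measurable f) (hf' : Measurable f') (hc : 0 ≤ c) (hC : 0 ≤ C)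
    (hd : ∀ ξ : κ → ℝ, ∀ x : ℝ, HasDerivAt (fun x => f (Function.update ξ k x)) (f' (Function.update ξ k x)) x)
    (hb : ∀ ξ, |f ξ| ≤ C * Real.exp (c * ∑ k, |ξ k|)) (hb' : ∀ ξ, |f' ξ| ≤ C * Real.exp (c * ∑ k, |ξ k|)) :
    ∫ ξ, ξ k * f ξ ∂(stdG κ) = ∫ ξ, f' ξ ∂(stdG κ) := by
  have mp := map_update_stdG (κ := κ) k
  have i1 : Integrable (fun ξ => ξ k * f ξ) (stdG κ) := by
    refine integrable_of_exp_bound (C := C) (c := c + 1) (by fun_prop) fun ξ => ?_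
    rw [abs_mul]
    have e : C * Real.exp ((c+1) * ∑ k, |ξ k|) = Real.exp (∑ k, |ξ k|) * (C * Real.exp (c * ∑ k, |ξ k|)) := by
      rw [add_mul, Real.exp_add]; ring_nf
    rw [e]
    refine mul_le_mul ((abs_le_exp_abs _).trans (Real.exp_le_exp.2 ?_)) (hb ξ) (abs_nonneg _) (Real.exp_pos _).le
    exact Finset.single_le_sum (f := fun k => |ξ k|) (fun _ _ => abs_nonneg _) (Finset.mem_univ k)
  have i2 := integrable_of_exp_bound hf' hb'
  have sumup : ∀ (ξ : κ → ℝ) (x : ℝ), ∑ j, |Function.update ξ k x j| ≤ (∑ j, |ξ j|) + |x| := by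
    intro ξ x
    calc ∑ j, |Function.update ξ k x j| ≤ ∑ j, (|ξ j| + if j = k then |x| else 0) := by
          refine Finset.sum_le_sum fun j _ => ?_
          by_cases hj : j = k
          · subst hj; simp
          · simp [Function.update_of_ne hj, hj]
      _ = _ := by rw [Finset.sum_add_distrib]; simp
  have bd : ∀ (g : (κ → ℝ) → ℝ), (∀ ξ, |g ξ| ≤ C * Real.exp (c * ∑ k, |ξ k|)) → ∀ ξ x,
      |g (Function.update ξ k x)| ≤ (C * Real.exp (c * ∑ j, |ξ j|)) * Real.exp (c * |x|) := by
    intro g hg ξ x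
    refine (hg _).trans ?_
    rw [mul_assoc, ← Real.exp_add, ← mul_add]
    have := sumup ξ x
    gcongr
  have j1 := mp.integrable_comp_of_integrable i1
  have j2 := mp.integrable_comp_of_integrable i2
  rw [← mp.map_eq] at i1 i2
  rw [← mp.map_eq, integral_map mp.aemeasurable i1.aestronglyMeasurable,
    integral_map mp.aemeasurable i2.aestronglyMeasurable]
  rw [show (∫ (x : (κ → ℝ) × ℝ), Function.update x.1 k x.2 k * f (Function.update x.1 k x.2) ∂(stdG κ).prod (gaussianReal 0 1)) = _ from integral_prod _ j1]
  rw [show (∫ (x : (κ → ℝ) × ℝ), f' (Function.update x.1 k x.2) ∂(stdG κ).prod (gaussianReal 0 1)) = _ from integral_prod _ j2]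
  congr 1; ext ξ
  simp only [Function.update_self, Function.comp]
  exact stein1 (hd ξ) (hf'.comp (measurable_update ξ)) (bd f hb ξ) (bd f' hb' ξ)

section comparison
variable {J κ : Type} [Fintype J] [Fintype κ]

noncomputable def linPath (M M' : J → κ → ℝ) (θ : ℝ) (ξ : κ → ℝ) : J → ℝ :=
  fun j => ∑ k, (Real.cos θ * M j k + Real.sin θ * M' j k) * ξ k

noncomputable def linPath' (M M' : J → κ → ℝ) (θ : ℝ) (ξ : κ → ℝ) : J → ℝ :=
  fun j => ∑ k, (-Real.sin θ * M j k + Real.cos θ * M' j k) * ξ k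

lemma hasDerivAt_linPath (M M' : J → κ → ℝ) (θ : ℝ) (ξ : κ → ℝ) :
    HasDerivAt (fun θ => linPath M M' θ ξ) (linPath' M M' θ ξ) θ := by
  refine hasDerivAt_pi.2 fun j => ?_
  unfold linPath linPath'
  refine HasDerivAt.fun_sum fun k _ => ?_
  exact (((Real.hasDerivAt_cos θ).mul_const (M j k)).add
    ((Real.hasDerivAt_sin θ).mul_const (M' j k))).mul_const (ξ k)

lemma continuous_linPath (M M' : J → κ → ℝ) (θ : ℝ) : Continuous (linPath M M' θ) := by
  unfold linPath; fun_prop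

lemma continuous_linPath' (M M' : J → κ → ℝ) (θ : ℝ) : Continuous (linPath' M M' θ) := by
  unfold linPath'; fun_prop

noncomputable def lpB (M M' : J → κ → ℝ) : ℝ := ∑ j, ∑ k, (|M j k| + |M' j k|)

lemma lpB_nonneg (M M' : J → κ → ℝ) : 0 ≤ lpB M M' :=
  Finset.sum_nonneg fun _ _ => Finset.sum_nonneg fun _ _ => by positivity

lemma sum_lin_le (M M' : J → κ → ℝ) (a b : ℝ) (ha : |a| ≤ 1) (hb : |b| ≤ 1) (ξ : κ → ℝ) :
    ∑ j, |∑ k, (a * M j k + b * M' j k) * ξ k| ≤ lpB M M' * ∑ k, |ξ k| := by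
  unfold lpB
  rw [Finset.sum_mul]
  refine Finset.sum_le_sum fun j _ => ?_
  refine (Finset.abs_sum_le_sum_abs _ _).trans ?_
  rw [Finset.mul_sum]
  refine Finset.sum_le_sum fun k _ => ?_
  rw [abs_mul]
  refine mul_le_mul_of_nonneg_right ?_ (abs_nonneg _)
  have h1 : |a * M j k + b * M' j k| ≤ |M j k| + |M' j k| := by
    refine (abs_add_le _ _).trans ?_
    rw [abs_mul, abs_mul]
    nlinarith [abs_nonneg (M j k), abs_nonneg (M' j k)]
  exact h1.trans (Finset.single_le_sum (f := fun k => |M j k| + |M' j k|)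
    (fun _ _ => by positivity) (Finset.mem_univ k))

lemma sum_linPath_le (M M' : J → κ → ℝ) (θ : ℝ) (ξ : κ → ℝ) :
    ∑ j, |linPath M M' θ ξ j| ≤ lpB M M' * ∑ k, |ξ k| :=
  sum_lin_le M M' _ _ (Real.abs_cos_le_one θ) (Real.abs_sin_le_one θ) ξ

lemma sum_linPath'_le (M M' : J → κ → ℝ) (θ : ℝ) (ξ : κ → ℝ) :
    ∑ j, |linPath' M M' θ ξ j| ≤ lpB M M' * ∑ k, |ξ k| :=
  sum_lin_le M M' _ _ (by rw [abs_neg]; exact Real.abs_sin_le_one θ) (Real.abs_cos_le_one θ) ξ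

theorem gauss_comparison [DecidableEq κ] {G : (J → ℝ) → ℝ} {G1 : J → (J → ℝ) → ℝ}
    {G2 : J → J → (J → ℝ) → ℝ} {C c a : ℝ} (hc : 0 ≤ c) (hC : 0 ≤ C)
    (hG : ∀ z, HasFDerivAt G (∑ j, G1 j z • (ContinuousLinearMap.proj j : (J → ℝ) →L[ℝ] ℝ)) z)
    (hG1 : ∀ j z, HasFDerivAt (G1 j)
      (∑ l, G2 j l z • (ContinuousLinearMap.proj l : (J → ℝ) →L[ℝ] ℝ)) z)
    (hG2 : ∀ j l, Continuous (G2 j l))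
    (b0 : ∀ z, |G z| ≤ C * Real.exp (c * ∑ j, |z j|))
    (b1 : ∀ j z, |G1 j z| ≤ C * Real.exp (c * ∑ j, |z j|))
    (b2 : ∀ j l z, |G2 j l z| ≤ C * Real.exp (c * ∑ j, |z j|))
    (M M' : J → κ → ℝ) (horth : ∀ j l, ∑ k, M j k * M' l k = 0)
    (htr : ∀ z, (∃ θ ξ, z = linPath M M' θ ξ) → ∑ j, ∑ l, G2 j l z * (∑ k, M' j k * M' l k - ∑ k, M j k * M l k) ≤ 2 * a * G z) :
    ∫ ξ, G (fun j => ∑ k, M' j k * ξ k) ∂(stdG κ) ≤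
      Real.exp a * ∫ ξ, G (fun j => ∑ k, M j k * ξ k) ∂(stdG κ) := by
  set B := lpB M M' with hB
  have B0 : 0 ≤ B := lpB_nonneg M M'
  have cG : Continuous G := continuous_iff_continuousAt.2 fun z => (hG z).continuousAt
  have cG1 : ∀ j, Continuous (G1 j) := fun j =>
    continuous_iff_continuousAt.2 fun z => (hG1 j z).continuousAt
  have bt : ∀ (F : (J → ℝ) → ℝ), (∀ z, |F z| ≤ C * Real.exp (c * ∑ j, |z j|)) →
      ∀ θ ξ, |F (linPath M M' θ ξ)| ≤ C * Real.exp ((c * B) * ∑ k, |ξ k|) := by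
    intro F hF θ ξ
    refine (hF _).trans ?_
    have := sum_linPath_le M M' θ ξ
    rw [mul_assoc]
    gcongr
  set ψ : ℝ → ℝ := fun θ => ∫ ξ, G (linPath M M' θ ξ) ∂(stdG κ) with hψ
  have hder : ∀ θ, HasDerivAt ψ (∫ ξ, ∑ j, G1 j (linPath M M' θ ξ) * linPath' M M' θ ξ j ∂(stdG κ)) θ := by
    intro θ
    refine (hasDerivAt_integral_of_dominated_loc_of_deriv_le (s := Set.univ)
      (F' := fun θ ξ => ∑ j, G1 j (linPath M M' θ ξ) * linPath' M M' θ ξ j)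
      (bound := fun ξ => C * B * Real.exp ((c * B + 1) * ∑ k, |ξ k|)) Filter.univ_mem
      (Filter.Eventually.of_forall fun θ => ?_) ?_ ?_ ?_ ?_ ?_).2
    · exact (cG.comp (continuous_linPath M M' θ)).aestronglyMeasurable
    · exact integrable_of_exp_bound (cG.comp (continuous_linPath M M' θ)).measurable (bt G b0 θ)
    · refine Continuous.aestronglyMeasurable ?_
      refine continuous_finsetSum _ fun j _ => ?_
      exact ((cG1 j).comp (continuous_linPath M M' θ)).mul
        ((continuous_apply j).comp (continuous_linPath' M M' θ))
    · refine Filter.Eventually.of_forall fun ξ θ _ => ?_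
      rw [Real.norm_eq_abs]
      refine (Finset.abs_sum_le_sum_abs _ _).trans ?_
      calc ∑ j, |G1 j (linPath M M' θ ξ) * linPath' M M' θ ξ j|
          ≤ ∑ j, C * Real.exp ((c * B) * ∑ k, |ξ k|) * |linPath' M M' θ ξ j| := by
            refine Finset.sum_le_sum fun j _ => ?_
            rw [abs_mul]
            exact mul_le_mul_of_nonneg_right (bt _ (b1 j) θ ξ) (abs_nonneg _)
        _ = C * Real.exp ((c * B) * ∑ k, |ξ k|) * ∑ j, |linPath' M M' θ ξ j| :=
            (Finset.mul_sum _ _ _).symm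
        _ ≤ C * Real.exp ((c * B) * ∑ k, |ξ k|) * (B * Real.exp (∑ k, |ξ k|)) := by
            refine mul_le_mul_of_nonneg_left ?_ (by positivity)
            refine (sum_linPath'_le M M' θ ξ).trans (mul_le_mul_of_nonneg_left ?_ B0)
            have := Real.add_one_le_exp (∑ k, |ξ k|); linarith
        _ = _ := by rw [add_mul, Real.exp_add]; ring_nf
    · exact (integrable_exp_sum_abs _).const_mul _
    · refine Filter.Eventually.of_forall fun ξ θ _ => ?_
      have := (hG (linPath M M' θ ξ)).comp_hasDerivAt θ (hasDerivAt_linPath M M' θ ξ)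
      refine this.congr_deriv ?_
      simp [ContinuousLinearMap.sum_apply]
  have hst : ∀ θ j k, ∫ ξ, ξ k * G1 j (linPath M M' θ ξ) ∂(stdG κ) =
      ∫ ξ, ∑ l, G2 j l (linPath M M' θ ξ) * (Real.cos θ * M l k + Real.sin θ * M' l k) ∂(stdG κ) := by
    intro θ j k
    have hle : ∀ l, |Real.cos θ * M l k + Real.sin θ * M' l k| ≤ B := by
      intro l
      have h1 : |Real.cos θ * M l k + Real.sin θ * M' l k| ≤ |M l k| + |M' l k| := by
        refine (abs_add_le _ _).trans ?_
        rw [abs_mul, abs_mul]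
        nlinarith [abs_nonneg (M l k), abs_nonneg (M' l k), Real.abs_cos_le_one θ, Real.abs_sin_le_one θ]
      refine h1.trans ?_
      refine (Finset.single_le_sum (f := fun k => |M l k| + |M' l k|)
        (fun _ _ => by positivity) (Finset.mem_univ k)).trans ?_
      exact Finset.single_le_sum (f := fun l => ∑ k, (|M l k| + |M' l k|))
        (fun _ _ => Finset.sum_nonneg fun _ _ => by positivity) (Finset.mem_univ l)
    refine stein_pi k (C := C + (Fintype.card J) * (C * B)) (c := c * B) ?_ ?_ (by positivity) (by positivity) ?_ ?_ ?_
    · exact ((cG1 j).comp (continuous_linPath M M' θ)).measurable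
    · refine (continuous_finsetSum _ fun l _ => ?_).measurable
      exact ((hG2 j l).comp (continuous_linPath M M' θ)).mul_const _
    · intro ξ x
      have hz : HasDerivAt (fun x => linPath M M' θ (Function.update ξ k x))
          (fun l => Real.cos θ * M l k + Real.sin θ * M' l k) x := by
        refine hasDerivAt_pi.2 fun l => ?_
        unfold linPath
        have : ∀ i ∈ (Finset.univ : Finset κ), HasDerivAt (fun x => (Real.cos θ * M l i + Real.sin θ * M' l i) * Function.update ξ k x i)
            (if i = k then (Real.cos θ * M l i + Real.sin θ * M' l i) else 0) x := by
          intro i _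
          by_cases hi : i = k
          · subst hi
            simpa using (hasDerivAt_id x).const_mul (Real.cos θ * M l i + Real.sin θ * M' l i)
          · simp only [Function.update_of_ne hi, hi, if_false]
            exact hasDerivAt_const _ _
        have h2 := HasDerivAt.fun_sum this
        simpa using h2
      have := (hG1 j (linPath M M' θ (Function.update ξ k x))).comp_hasDerivAt x hz
      refine this.congr_deriv ?_
      simp [ContinuousLinearMap.sum_apply]
    · intro ξ
      refine (bt _ (b1 j) θ ξ).trans ?_
      refine mul_le_mul_of_nonneg_right ?_ (Real.exp_pos _).le
      have : 0 ≤ (Fintype.card J : ℝ) * (C * B) := by positivity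
      linarith
    · intro ξ
      refine (Finset.abs_sum_le_sum_abs _ _).trans ?_
      calc _ ≤ ∑ l : J, (C * Real.exp ((c * B) * ∑ k, |ξ k|)) * B := by
            refine Finset.sum_le_sum fun l _ => ?_
            rw [abs_mul]
            exact mul_le_mul (bt _ (b2 j l) θ ξ) (hle l) (abs_nonneg _) (by positivity)
        _ = ((Fintype.card J) * (C * B)) * Real.exp ((c * B) * ∑ k, |ξ k|) := by
            simp; ring
        _ ≤ _ := by
            refine mul_le_mul_of_nonneg_right ?_ (Real.exp_pos _).le
            linarith
  have i2 : ∀ θ j l, Integrable (fun ξ => G2 j l (linPath M M' θ ξ)) (stdG κ) := fun θ j l =>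
    integrable_of_exp_bound ((hG2 j l).comp (continuous_linPath M M' θ)).measurable (bt _ (b2 j l) θ)
  have i1 : ∀ θ j k, Integrable (fun ξ => ξ k * G1 j (linPath M M' θ ξ)) (stdG κ) := by
    intro θ j k
    refine integrable_of_exp_bound (C := C) (c := c * B + 1)
      ((continuous_apply k).mul ((cG1 j).comp (continuous_linPath M M' θ))).measurable fun ξ => ?_
    rw [abs_mul]
    have e : C * Real.exp ((c * B+1) * ∑ k, |ξ k|) = Real.exp (∑ k, |ξ k|) * (C * Real.exp (c * B * ∑ k, |ξ k|)) := by
      rw [add_mul, Real.exp_add]; ring_nf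
    rw [e]
    refine mul_le_mul ((abs_le_exp_abs _).trans (Real.exp_le_exp.2 ?_)) (bt _ (b1 j) θ ξ) (abs_nonneg _) (Real.exp_pos _).le
    exact Finset.single_le_sum (f := fun k => |ξ k|) (fun _ _ => abs_nonneg _) (Finset.mem_univ k)
  have hder2 : ∀ θ, ∫ ξ, ∑ j, G1 j (linPath M M' θ ξ) * linPath' M M' θ ξ j ∂(stdG κ) =
      Real.sin θ * Real.cos θ * ∫ ξ, ∑ j, ∑ l, G2 j l (linPath M M' θ ξ) *
        (∑ k, M' j k * M' l k - ∑ k, M j k * M l k) ∂(stdG κ) := by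
    intro θ
    have e1 : ∀ ξ, ∑ j, G1 j (linPath M M' θ ξ) * linPath' M M' θ ξ j =
        ∑ j, ∑ k, (-Real.sin θ * M j k + Real.cos θ * M' j k) * (ξ k * G1 j (linPath M M' θ ξ)) := by
      intro ξ
      refine Finset.sum_congr rfl fun j _ => ?_
      unfold linPath'
      rw [Finset.mul_sum]
      refine Finset.sum_congr rfl fun k _ => ?_
      ring
    simp_rw [e1]
    rw [integral_finsetSum _ fun j _ => integrable_finsetSum _ fun k _ => (i1 θ j k).const_mul _]
    rw [integral_finsetSum _ fun j _ => integrable_finsetSum _ fun l _ => (i2 θ j l).mul_const _]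
    rw [Finset.mul_sum]
    refine Finset.sum_congr rfl fun j _ => ?_
    rw [integral_finsetSum _ fun k _ => (i1 θ j k).const_mul _]
    rw [integral_finsetSum _ fun l _ => (i2 θ j l).mul_const _]
    simp_rw [integral_const_mul, integral_mul_const, hst θ j]
    simp_rw [integral_finsetSum _ fun l _ => (i2 θ j l).mul_const _, integral_mul_const]
    simp_rw [Finset.mul_sum]
    rw [Finset.sum_comm]
    refine Finset.sum_congr rfl fun l _ => ?_
    have e3 : Real.sin θ * Real.cos θ * (∑ k, M' j k * M' l k - ∑ k, M j k * M l k) =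
        ∑ k, (-Real.sin θ * M j k + Real.cos θ * M' j k) * (Real.cos θ * M l k + Real.sin θ * M' l k) := by
      have e4 : ∀ k, (-Real.sin θ * M j k + Real.cos θ * M' j k) * (Real.cos θ * M l k + Real.sin θ * M' l k)
        = Real.sin θ * Real.cos θ * (M' j k * M' l k) - Real.sin θ * Real.cos θ * (M j k * M l k)
          + (Real.cos θ)^2 * (M l k * M' j k) - (Real.sin θ)^2 * (M j k * M' l k) := fun k => by ring
      simp_rw [e4]
      rw [Finset.sum_sub_distrib, Finset.sum_add_distrib, Finset.sum_sub_distrib]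
      simp_rw [← Finset.mul_sum]
      rw [horth l j, horth j l]; ring
    calc _ = (∫ ξ, G2 j l (linPath M M' θ ξ) ∂(stdG κ)) * ∑ k, (-Real.sin θ * M j k + Real.cos θ * M' j k) * (Real.cos θ * M l k + Real.sin θ * M' l k) := by
          rw [Finset.mul_sum]; exact Finset.sum_congr rfl fun k _ => by ring
      _ = _ := by rw [← e3]; ring
  have hle : ∀ θ ∈ Set.Icc (0:ℝ) (Real.pi/2), (∫ ξ, ∑ j, G1 j (linPath M M' θ ξ) * linPath' M M' θ ξ j ∂(stdG κ))
      ≤ 2 * Real.sin θ * Real.cos θ * a * ψ θ := by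
    intro θ hθ
    rw [hder2]
    have hs : 0 ≤ Real.sin θ := Real.sin_nonneg_of_nonneg_of_le_pi hθ.1 (by linarith [hθ.2, Real.pi_pos])
    have hco : 0 ≤ Real.cos θ := Real.cos_nonneg_of_mem_Icc ⟨by linarith [hθ.1, Real.pi_pos], hθ.2⟩
    have : ∫ ξ, ∑ j, ∑ l, G2 j l (linPath M M' θ ξ) *
        (∑ k, M' j k * M' l k - ∑ k, M j k * M l k) ∂(stdG κ) ≤ 2 * a * ψ θ := by
      rw [hψ, ← integral_const_mul]
      refine integral_mono ?_ ?_ fun ξ => htr _ ⟨θ, ξ, rfl⟩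
      · exact integrable_finsetSum _ fun j _ => integrable_finsetSum _ fun l _ => (i2 θ j l).mul_const _
      · exact (integrable_of_exp_bound (cG.comp (continuous_linPath M M' θ)).measurable (bt G b0 θ)).const_mul _
    have h3 := mul_le_mul_of_nonneg_left this (mul_nonneg hs hco)
    linarith
  set χ : ℝ → ℝ := fun θ => Real.exp (-(a * Real.sin θ ^ 2)) * ψ θ with hχ
  have hχd : ∀ θ, HasDerivAt χ (Real.exp (-(a * Real.sin θ ^ 2)) * (-(a * (2 * Real.sin θ * Real.cos θ))) * ψ θ
      + Real.exp (-(a * Real.sin θ ^ 2)) * (∫ ξ, ∑ j, G1 j (linPath M M' θ ξ) * linPath' M M' θ ξ j ∂(stdG κ))) θ := by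
    intro θ
    have h1 : HasDerivAt (fun θ => -(a * Real.sin θ ^ 2)) (-(a * (2 * Real.sin θ * Real.cos θ))) θ := by
      refine (((Real.hasDerivAt_sin θ).pow 2).const_mul a).neg.congr_deriv ?_
      simp
    exact h1.exp.mul (hder θ)
  have hanti : AntitoneOn χ (Set.Icc 0 (Real.pi/2)) := by
    refine antitoneOn_of_deriv_nonpos (convex_Icc _ _)
      (fun θ _ => (hχd θ).continuousAt.continuousWithinAt)
      (fun θ _ => (hχd θ).differentiableAt.differentiableWithinAt) fun θ hθ => ?_
    rw [(hχd θ).deriv]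
    have h1 := hle θ (interior_subset hθ)
    have h2 := Real.exp_pos (-(a * Real.sin θ ^ 2))
    have h3 := mul_le_mul_of_nonneg_left h1 h2.le
    nlinarith
  have hp : (0:ℝ) ≤ Real.pi / 2 := by positivity
  have hfin := hanti (Set.left_mem_Icc.2 hp) (Set.right_mem_Icc.2 hp) hp
  have e0 : ∀ ξ, linPath M M' 0 ξ = fun j => ∑ k, M j k * ξ k := by
    intro ξ; ext j; simp [linPath]
  have e1 : ∀ ξ, linPath M M' (Real.pi/2) ξ = fun j => ∑ k, M' j k * ξ k := by
    intro ξ; ext j; simp [linPath]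
  simp only [hχ, hψ, e0, e1, Real.sin_zero, Real.sin_pi_div_two] at hfin
  have h4 := mul_le_mul_of_nonneg_left hfin (Real.exp_pos a).le
  rw [← mul_assoc, ← Real.exp_add] at h4
  simpa using h4
end comparison

set_option linter.unusedSectionVars false
set_option linter.unusedSimpArgs false
set_option linter.deprecated false
section growth
variable {J : Type} [Fintype J]

def EG (f : (J → ℝ) → ℝ) : Prop :=
  ∃ C c : ℝ, 0 ≤ C ∧ 0 ≤ c ∧ ∀ z, |f z| ≤ C * Real.exp (c * ∑ j, |z j|)

def EP (f : (J → ℝ) → ℝ) : Prop :=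
  ∃ C c : ℝ, 0 ≤ C ∧ 0 ≤ c ∧ ∀ z, 0 < f z ∧ |Real.log (f z)| ≤ C + c * ∑ j, |z j|

lemma sumabs_nonneg (z : J → ℝ) : 0 ≤ ∑ j, |z j| := Finset.sum_nonneg fun _ _ => abs_nonneg _

lemma EP.pos {f : (J → ℝ) → ℝ} (h : EP f) (z) : 0 < f z := by
  obtain ⟨C, c, _, _, h⟩ := h; exact (h z).1

lemma EP.eg {f : (J → ℝ) → ℝ} (h : EP f) : EG f := by
  obtain ⟨C, c, hC, hc, h⟩ := h
  refine ⟨Real.exp C, c, (Real.exp_pos _).le, hc, fun z => ?_⟩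
  rw [← Real.exp_add, abs_of_pos (h z).1, ← Real.log_le_iff_le_exp (h z).1]
  exact (le_abs_self _).trans (h z).2

lemma EG.mul {f g : (J → ℝ) → ℝ} (hf : EG f) (hg : EG g) : EG fun z => f z * g z := by
  obtain ⟨C, c, hC, hc, h⟩ := hf
  obtain ⟨C', c', hC', hc', h'⟩ := hg
  refine ⟨C * C', c + c', by positivity, by positivity, fun z => ?_⟩
  rw [abs_mul, add_mul, Real.exp_add]
  calc _ ≤ (C * Real.exp (c * ∑ j, |z j|)) * (C' * Real.exp (c' * ∑ j, |z j|)) :=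
        mul_le_mul (h z) (h' z) (abs_nonneg _) (by positivity)
    _ = _ := by ring

lemma EG.const (a : ℝ) : EG (fun _ : J → ℝ => a) :=
  ⟨|a|, 0, abs_nonneg _, le_rfl, fun z => by simp⟩

lemma EG.add {f g : (J → ℝ) → ℝ} (hf : EG f) (hg : EG g) : EG fun z => f z + g z := by
  obtain ⟨C, c, hC, hc, h⟩ := hf
  obtain ⟨C', c', hC', hc', h'⟩ := hg
  refine ⟨C + C', c + c', by positivity, by positivity, fun z => ?_⟩
  have hz := sumabs_nonneg z
  calc _ ≤ _ := abs_add_le _ _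
    _ ≤ _ := add_le_add (h z) (h' z)
    _ ≤ C * Real.exp ((c + c') * ∑ j, |z j|) + C' * Real.exp ((c + c') * ∑ j, |z j|) := by
        gcongr <;> nlinarith
    _ = _ := by ring

lemma EG.common {ι : Type} [Fintype ι] {f : ι → (J → ℝ) → ℝ} (h : ∀ i, EG (f i)) :
    ∃ C c : ℝ, 0 ≤ C ∧ 0 ≤ c ∧ ∀ i z, |f i z| ≤ C * Real.exp (c * ∑ j, |z j|) := by
  choose C c hC hc hb using h
  refine ⟨∑ i, C i, ∑ i, c i, Finset.sum_nonneg fun i _ => hC i, Finset.sum_nonneg fun i _ => hc i,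
    fun i z => (hb i z).trans ?_⟩
  have hz := sumabs_nonneg z
  have h1 : C i ≤ ∑ i, C i := Finset.single_le_sum (fun i _ => hC i) (Finset.mem_univ i)
  have h2 : c i ≤ ∑ i, c i := Finset.single_le_sum (fun i _ => hc i) (Finset.mem_univ i)
  have := hC i
  gcongr
  exact this.trans h1

lemma EP.mul {f g : (J → ℝ) → ℝ} (hf : EP f) (hg : EP g) : EP fun z => f z * g z := by
  obtain ⟨C, c, hC, hc, h⟩ := hf
  obtain ⟨C', c', hC', hc', h'⟩ := hg
  refine ⟨C + C', c + c', by positivity, by positivity, fun z => ⟨mul_pos (h z).1 (h' z).1, ?_⟩⟩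
  rw [Real.log_mul (h z).1.ne' (h' z).1.ne']
  have := (abs_add_le (Real.log (f z)) (Real.log (g z))).trans (add_le_add (h z).2 (h' z).2)
  linarith

lemma EP.rpow {f : (J → ℝ) → ℝ} (hf : EP f) (q : ℝ) : EP fun z => f z ^ q := by
  obtain ⟨C, c, hC, hc, h⟩ := hf
  refine ⟨|q| * C, |q| * c, by positivity, by positivity, fun z => ⟨Real.rpow_pos_of_pos (h z).1 _, ?_⟩⟩
  rw [Real.log_rpow (h z).1, abs_mul]
  have := mul_le_mul_of_nonneg_left (h z).2 (abs_nonneg q)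
  linarith

lemma EP.inv {f : (J → ℝ) → ℝ} (hf : EP f) : EP fun z => (f z)⁻¹ := by
  obtain ⟨C, c, hC, hc, h⟩ := hf
  refine ⟨C, c, hC, hc, fun z => ⟨inv_pos.2 (h z).1, ?_⟩⟩
  rw [Real.log_inv, abs_neg]; exact (h z).2

lemma EP.exp (s : ℝ) (j : J) : EP fun z => Real.exp (s * z j) := by
  refine ⟨0, |s|, le_rfl, abs_nonneg _, fun z => ⟨Real.exp_pos _, ?_⟩⟩
  rw [Real.log_exp, abs_mul, zero_add]
  exact mul_le_mul_of_nonneg_left (Finset.single_le_sum (f := fun j => |z j|)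
    (fun _ _ => abs_nonneg _) (Finset.mem_univ j)) (abs_nonneg _)

lemma EP.sum {ι : Type} [Fintype ι] [Nonempty ι] {f : ι → (J → ℝ) → ℝ} (h : ∀ i, EP (f i)) :
    EP fun z => ∑ i, f i z := by
  choose C c hC hc hb using h
  have hcard : (0:ℝ) < Fintype.card ι := by exact_mod_cast Fintype.card_pos
  have hcard1 : (1:ℝ) ≤ Fintype.card ι := by exact_mod_cast Fintype.card_pos
  have hCn : 0 ≤ ∑ i, C i := Finset.sum_nonneg fun i _ => hC i
  have hl : 0 ≤ Real.log (Fintype.card ι) := Real.log_nonneg hcard1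
  refine ⟨∑ i, C i + Real.log (Fintype.card ι), ∑ i, c i, by positivity,
    Finset.sum_nonneg fun i _ => hc i, fun z => ?_⟩
  have hz := sumabs_nonneg z
  have hb' : ∀ i, |Real.log (f i z)| ≤ ∑ i, C i + (∑ i, c i) * ∑ j, |z j| := by
    intro i
    refine (hb i z).2.trans ?_
    have h1 : C i ≤ ∑ i, C i := Finset.single_le_sum (fun i _ => hC i) (Finset.mem_univ i)
    have h2 : c i ≤ ∑ i, c i := Finset.single_le_sum (fun i _ => hc i) (Finset.mem_univ i)
    gcongr
  have hpos : 0 < ∑ i, f i z := Finset.sum_pos (fun i _ => (hb i z).1) Finset.univ_nonempty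
  refine ⟨hpos, abs_le.2 ⟨?_, ?_⟩⟩
  · obtain ⟨i⟩ := ‹Nonempty ι›
    have h1 : f i z ≤ ∑ i, f i z := Finset.single_le_sum (f := fun i => f i z) (fun i _ => (hb i z).1.le) (Finset.mem_univ i)
    have h2 := Real.log_le_log (hb i z).1 h1
    have h3 := (abs_le.1 (hb' i)).1
    linarith
  · rw [Real.log_le_iff_le_exp hpos]
    have e : Real.exp (∑ i, C i + Real.log (Fintype.card ι) + (∑ i, c i) * ∑ j, |z j|)
      = ∑ i : ι, Real.exp (∑ i, C i + (∑ i, c i) * ∑ j, |z j|) := by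
      rw [add_right_comm, Real.exp_add, Real.exp_log hcard]; simp [mul_comm]
    rw [e]
    refine Finset.sum_le_sum fun i _ => ?_
    rw [← Real.log_le_iff_le_exp (hb i z).1]
    exact (le_abs_self _).trans (hb' i)
end growth

section gordonfun
variable {X Y : Type} [Fintype X] [Fintype Y] [DecidableEq X] [DecidableEq Y] [Nonempty X] [Nonempty Y]

noncomputable def gE (s : ℝ) (j : X × Y) (z : X × Y → ℝ) : ℝ := Real.exp (s * z j)
noncomputable def gS (s : ℝ) (x : X) (z : X × Y → ℝ) : ℝ := ∑ y, gE s (x, y) z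
noncomputable def gF (s : ℝ) (z : X × Y → ℝ) : ℝ := ∑ x, (gS s x z)⁻¹
noncomputable def gF1 (s : ℝ) (j : X × Y) (z : X × Y → ℝ) : ℝ := -(s * (((gS s j.1 z)⁻¹) ^ 2 * gE s j z))
noncomputable def gF2 (s : ℝ) (j l : X × Y) (z : X × Y → ℝ) : ℝ :=
  (if j.1 = l.1 then 2 * s ^ 2 * ((gS s j.1 z)⁻¹ ^ 3 * (gE s j z * gE s l z)) else 0) +
    (if j = l then -s ^ 2 * ((gS s j.1 z)⁻¹ ^ 2 * gE s j z) else 0)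
noncomputable def gG (s p : ℝ) (z : X × Y → ℝ) : ℝ := gF s z ^ p
noncomputable def gG1 (s p : ℝ) (j : X × Y) (z : X × Y → ℝ) : ℝ := p * gF s z ^ (p - 1) * gF1 s j z
noncomputable def gG2 (s p : ℝ) (j l : X × Y) (z : X × Y → ℝ) : ℝ :=
  p * ((p - 1) * gF s z ^ (p - 1 - 1) * gF1 s l z) * gF1 s j z + p * gF s z ^ (p - 1) * gF2 s j l z

abbrev dform {J : Type} [Fintype J] (a : J → ℝ) : (J → ℝ) →L[ℝ] ℝ :=
  ∑ j, a j • (ContinuousLinearMap.proj j : (J → ℝ) →L[ℝ] ℝ)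

lemma dform_apply {J : Type} [Fintype J] (a : J → ℝ) (v : J → ℝ) : dform a v = ∑ j, a j * v j := by
  simp [dform]

lemma EP_gE (s : ℝ) (j : X × Y) : EP (gE s j) := EP.exp s j
lemma EP_gS (s : ℝ) (x : X) : EP (gS (Y := Y) s x) := EP.sum fun y => EP_gE s (x, y)
lemma EP_gF (s : ℝ) : EP (gF (X := X) (Y := Y) s) := EP.sum fun x => (EP_gS s x).inv

lemma hd_gE (s : ℝ) (j : X × Y) (z) :
    HasFDerivAt (gE s j) ((s * gE s j z) • (ContinuousLinearMap.proj j : (X × Y → ℝ) →L[ℝ] ℝ)) z := by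
  have h1 : HasFDerivAt (fun z : X × Y → ℝ => z j) (ContinuousLinearMap.proj j : (X × Y → ℝ) →L[ℝ] ℝ) z :=
    hasFDerivAt_apply j z
  have := (h1.const_mul s).exp
  refine this.congr_fderiv ?_
  ext v; simp [gE]; ring

lemma hd_gS (s : ℝ) (x : X) (z) :
    HasFDerivAt (gS (Y := Y) s x) (∑ y, (s * gE s (x, y) z) • (ContinuousLinearMap.proj (x, y) : (X × Y → ℝ) →L[ℝ] ℝ)) z :=
  HasFDerivAt.fun_sum fun y _ => hd_gE s (x, y) z

lemma hd_gSi (s : ℝ) (x : X) (z) :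
    HasFDerivAt (fun z => (gS (Y := Y) s x z)⁻¹) ((-((gS s x z)⁻¹ ^ 2)) • (∑ y, (s * gE s (x, y) z) • (ContinuousLinearMap.proj (x, y) : (X × Y → ℝ) →L[ℝ] ℝ))) z := by
  have := (hasDerivAt_inv ((EP_gS (Y := Y) s x).pos z).ne').comp_hasFDerivAt z (hd_gS s x z)
  refine this.congr_fderiv ?_
  rw [inv_pow]

lemma hd_gF (s : ℝ) (z) : HasFDerivAt (gF (X := X) (Y := Y) s) (dform fun j => gF1 s j z) z := by
  have := HasFDerivAt.fun_sum (u := Finset.univ) fun x _ => hd_gSi (Y := Y) s (x : X) z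
  refine this.congr_fderiv ?_
  ext v
  rw [dform_apply, Fintype.sum_prod_type]
  simp only [ContinuousLinearMap.coe_sum', Finset.sum_apply, ContinuousLinearMap.coe_smul', Pi.smul_apply,
    ContinuousLinearMap.proj_apply, smul_eq_mul, Finset.mul_sum, gF1]
  refine Finset.sum_congr rfl fun x _ => Finset.sum_congr rfl fun y _ => ?_
  ring

lemma hd_gF1 (s : ℝ) (j) (z) : HasFDerivAt (gF1 (X := X) (Y := Y) s j) (dform fun l => gF2 s j l z) z := by
  have := ((((hd_gSi (Y := Y) s (j.1 : X) z).pow 2).mul (hd_gE s j z)).const_mul s).neg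
  refine this.congr_fderiv ?_
  ext v
  rw [dform_apply]
  simp only [gF2, add_mul, Finset.sum_add_distrib, ite_mul, zero_mul]
  rw [Fintype.sum_prod_type]
  simp [Finset.mul_sum]
  congr 1
  · refine Finset.sum_congr rfl fun y _ => ?_
    ring
  · ring

lemma hd_gG (s p : ℝ) (z) : HasFDerivAt (gG (X := X) (Y := Y) s p) (dform fun j => gG1 s p j z) z := by
  have := (Real.hasDerivAt_rpow_const (p := p) (Or.inl ((EP_gF (X := X) (Y := Y) s).pos z).ne')).comp_hasFDerivAt z (hd_gF s z)
  refine this.congr_fderiv ?_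
  ext v
  simp only [ContinuousLinearMap.coe_smul', Pi.smul_apply, smul_eq_mul, dform_apply, Finset.mul_sum, gG1]
  refine Finset.sum_congr rfl fun y _ => ?_
  ring

lemma hd_gG1 (s p : ℝ) (j) (z) : HasFDerivAt (gG1 (X := X) (Y := Y) s p j) (dform fun l => gG2 s p j l z) z := by
  have h1 := (Real.hasDerivAt_rpow_const (p := p - 1) (Or.inl ((EP_gF (X := X) (Y := Y) s).pos z).ne')).comp_hasFDerivAt z (hd_gF s z)
  have := (h1.const_mul p).mul (hd_gF1 s j z)
  refine this.congr_fderiv ?_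
  ext v
  simp only [ContinuousLinearMap.add_apply, ContinuousLinearMap.coe_smul', Pi.smul_apply, smul_eq_mul, dform_apply, Finset.mul_sum, gG2]
  rw [← Finset.sum_add_distrib]
  refine Finset.sum_congr rfl fun y _ => ?_
  simp only [Function.comp]
  ring

lemma cont_gE (s : ℝ) (j) : Continuous (gE (X := X) (Y := Y) s j) :=
  continuous_iff_continuousAt.2 fun z => (hd_gE s j z).continuousAt
lemma cont_gSi (s : ℝ) (x) : Continuous (fun z => (gS (X := X) (Y := Y) s x z)⁻¹) :=
  continuous_iff_continuousAt.2 fun z => (hd_gSi s x z).continuousAt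
lemma cont_gF (s : ℝ) : Continuous (gF (X := X) (Y := Y) s) :=
  continuous_iff_continuousAt.2 fun z => (hd_gF s z).continuousAt
lemma cont_gF1 (s : ℝ) (j) : Continuous (gF1 (X := X) (Y := Y) s j) :=
  continuous_iff_continuousAt.2 fun z => (hd_gF1 s j z).continuousAt
lemma cont_gFr (s q : ℝ) : Continuous (fun z => gF (X := X) (Y := Y) s z ^ q) :=
  (cont_gF s).rpow_const fun z => Or.inl ((EP_gF s).pos z).ne'
lemma cont_gF2 (s : ℝ) (j l) : Continuous (gF2 (X := X) (Y := Y) s j l) := by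
  unfold gF2
  have h1 := cont_gE (X := X) (Y := Y) s j
  have h2 := cont_gE (X := X) (Y := Y) s l
  have h3 := cont_gSi (X := X) (Y := Y) s j.1
  split_ifs <;> fun_prop
lemma cont_gG2 (s p : ℝ) (j l) : Continuous (gG2 (X := X) (Y := Y) s p j l) := by
  unfold gG2
  have h1 := cont_gF1 (X := X) (Y := Y) s j
  have h2 := cont_gF1 (X := X) (Y := Y) s l
  have h3 := cont_gF2 (X := X) (Y := Y) s j l
  have h4 := cont_gFr (X := X) (Y := Y) s (p-1)
  have h5 := cont_gFr (X := X) (Y := Y) s (p-1-1)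
  fun_prop

lemma EP.npow {J : Type} [Fintype J] {f : (J → ℝ) → ℝ} (hf : EP f) (k : ℕ) : EP fun z => f z ^ k := by
  have := hf.rpow k
  simpa using this

lemma EG_gF1 (s : ℝ) (j) : EG (gF1 (X := X) (Y := Y) s j) := by
  have := (EG.const (J := X × Y) (-s)).mul (((EP_gS (Y := Y) s j.1).inv.npow 2).mul (EP_gE s j)).eg
  refine (funext fun z => ?_ : gF1 (X := X) (Y := Y) s j = _) ▸ this
  unfold gF1; ring
lemma EG_gF2 (s : ℝ) (j l) : EG (gF2 (X := X) (Y := Y) s j l) := by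
  have h1 := (EG.const (J := X × Y) (2 * s^2)).mul (((EP_gS (Y := Y) s j.1).inv.npow 3).mul ((EP_gE s j).mul (EP_gE s l))).eg
  have h2 := (EG.const (J := X × Y) (-s^2)).mul (((EP_gS (Y := Y) s j.1).inv.npow 2).mul (EP_gE s j)).eg
  have h0 := EG.const (J := X × Y) 0
  unfold gF2
  refine EG.add ?_ ?_
  · split_ifs
    exacts [h1, h0]
  · split_ifs
    exacts [h2, h0]
lemma EG_gG1 (s p : ℝ) (j) : EG (gG1 (X := X) (Y := Y) s p j) :=
  ((EG.const p).mul ((EP_gF s).rpow _).eg).mul (EG_gF1 s j)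
lemma EG_gG2 (s p : ℝ) (j l) : EG (gG2 (X := X) (Y := Y) s p j l) :=
  ((((EG.const p).mul (((EG.const (p-1)).mul ((EP_gF s).rpow _).eg).mul (EG_gF1 s l))).mul (EG_gF1 s j))).add
    (((EG.const p).mul ((EP_gF s).rpow _).eg).mul (EG_gF2 s j l))

theorem gG_comparison {κ : Type} [Fintype κ] [DecidableEq κ] (s p a : ℝ)
    (M M' : X × Y → κ → ℝ) (horth : ∀ j l, ∑ k, M j k * M' l k = 0)
    (htr : ∀ z, (∃ θ ξ, z = linPath M M' θ ξ) → ∑ j, ∑ l, gG2 s p j l z * (∑ k, M' j k * M' l k - ∑ k, M j k * M l k) ≤ 2 * a * gG s p z) :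
    ∫ ξ, gG s p (fun j => ∑ k, M' j k * ξ k) ∂(stdG κ) ≤
      Real.exp a * ∫ ξ, gG s p (fun j => ∑ k, M j k * ξ k) ∂(stdG κ) := by
  have h0 : EG (gG (X := X) (Y := Y) s p) := ((EP_gF s).rpow p).eg
  have := EG.common (ι := Unit ⊕ (X × Y) ⊕ ((X × Y) × (X × Y)))
    (f := Sum.elim (fun _ => gG (X := X) (Y := Y) s p) (Sum.elim (fun j => gG1 s p j) (fun j => gG2 s p j.1 j.2)))
    (by rintro (_ | j | j)
        exacts [h0, EG_gG1 s p j, EG_gG2 s p j.1 j.2])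
  obtain ⟨C, c, hC, hc, hb⟩ := this
  exact gauss_comparison hc hC (hd_gG s p) (hd_gG1 s p) (cont_gG2 s p)
    (hb (Sum.inl ())) (fun j => hb (Sum.inr (Sum.inl j))) (fun j l => hb (Sum.inr (Sum.inr (j, l)))) M M' horth htr
end gordonfun

lemma mp_sum (κ₁ κ₂ : Type) [Fintype κ₁] [Fintype κ₂] :
    MeasurePreserving (fun ξ : κ₁ ⊕ κ₂ → ℝ => (fun i => ξ (Sum.inl i), fun i => ξ (Sum.inr i)))
      (stdG (κ₁ ⊕ κ₂)) ((stdG κ₁).prod (stdG κ₂)) := by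
  exact measurePreserving_sumPiEquivProdPi (fun _ : κ₁ ⊕ κ₂ => gaussianReal 0 1)

lemma int_sum_mul {κ₁ κ₂ : Type} [Fintype κ₁] [Fintype κ₂] (f : (κ₁ → ℝ) → ℝ) (g : (κ₂ → ℝ) → ℝ)
    (hf : Measurable f) (hg : Measurable g) :
    ∫ ξ, f (fun i => ξ (Sum.inl i)) * g (fun i => ξ (Sum.inr i)) ∂(stdG (κ₁ ⊕ κ₂)) =
      (∫ ξ, f ξ ∂(stdG κ₁)) * ∫ ξ, g ξ ∂(stdG κ₂) := by
  rw [← integral_prod_mul f g, ← (mp_sum κ₁ κ₂).map_eq]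
  rw [integral_map (mp_sum κ₁ κ₂).measurable.aemeasurable]
  exact (by fun_prop : Measurable fun z : (κ₁ → ℝ) × (κ₂ → ℝ) => f z.1 * g z.2).aestronglyMeasurable

lemma int_sum_fst {κ₁ κ₂ : Type} [Fintype κ₁] [Fintype κ₂] (f : (κ₁ → ℝ) → ℝ) (hf : Measurable f) :
    ∫ ξ, f (fun i => ξ (Sum.inl i)) ∂(stdG (κ₁ ⊕ κ₂)) = ∫ ξ, f ξ ∂(stdG κ₁) := by
  simpa using int_sum_mul (κ₂ := κ₂) f (fun _ => 1) hf measurable_const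

lemma int_sum_snd {κ₁ κ₂ : Type} [Fintype κ₁] [Fintype κ₂] (f : (κ₂ → ℝ) → ℝ) (hf : Measurable f) :
    ∫ ξ, f (fun i => ξ (Sum.inr i)) ∂(stdG (κ₁ ⊕ κ₂)) = ∫ ξ, f ξ ∂(stdG κ₂) := by
  simpa using int_sum_mul (κ₁ := κ₁) (fun _ => 1) f measurable_const hf

section gordon
variable {X Y : Type} [Fintype X] [Fintype Y] [DecidableEq X] [DecidableEq Y] [Nonempty X] [Nonempty Y]

lemma gordon_trace (s p : ℝ) (hp0 : 0 ≤ p) (hp1 : p ≤ 1) (Δ : X × Y → X × Y → ℝ)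
    (h0 : ∀ j l, 0 ≤ Δ j l) (h1 : ∀ j l, j.1 = l.1 → Δ j l = 0) (z) :
    ∑ j, ∑ l, gG2 s p j l z * Δ j l ≤ 0 := by
  refine Finset.sum_nonpos fun j _ => Finset.sum_nonpos fun l _ => ?_
  by_cases h : j.1 = l.1
  · simp [h1 j l h]
  · refine mul_nonpos_of_nonpos_of_nonneg ?_ (h0 j l)
    have h' : j ≠ l := fun e => h (by rw [e])
    unfold gG2 gF2 gF1
    simp only [h, h', if_false, add_zero, mul_zero]
    have e1 := (EP_gE s j).pos z
    have e2 := (EP_gE s l).pos z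
    have e3 := (EP_gS (Y := Y) s j.1).pos z
    have e4 := (EP_gS (Y := Y) s l.1).pos z
    have e5 := ((EP_gF (X := X) (Y := Y) s).rpow (p-1-1)).pos z
    have : 0 ≤ (p * gF s z ^ (p - 1 - 1)) * (s^2 * (((gS s j.1 z)⁻¹ ^ 2 * gE s j z) * ((gS s l.1 z)⁻¹ ^ 2 * gE s l z))) := by
      positivity
    have h2 := mul_nonneg this (sub_nonneg.2 hp1)
    nlinarith

variable {I K : Type} [Fintype I] [Fintype K] [DecidableEq I] [DecidableEq K]

noncomputable def vn {I : Type} [Fintype I] (v : I → ℝ) : ℝ := Real.sqrt (∑ i, v i ^ 2)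
lemma vn_nonneg {I : Type} [Fintype I] (v : I → ℝ) : 0 ≤ vn v := Real.sqrt_nonneg _
lemma vn_sq {I : Type} [Fintype I] (v : I → ℝ) : vn v ^ 2 = ∑ i, v i ^ 2 :=
  Real.sq_sqrt (Finset.sum_nonneg fun _ _ => sq_nonneg _)
lemma dot_le_vn {I : Type} [Fintype I] (v w : I → ℝ) : ∑ i, v i * w i ≤ vn v * vn w :=
  Real.sum_mul_le_sqrt_mul_sqrt _ _ _

/-- primal coefficient -/
noncomputable def gdM' (xv : X → K → ℝ) (yv : Y → I → ℝ) (j : X × Y) : ((I × K) ⊕ Unit) ⊕ (I ⊕ K) → ℝ :=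
  Sum.elim (Sum.elim (fun ab => yv j.2 ab.1 * xv j.1 ab.2) (fun _ => vn (xv j.1) * vn (yv j.2))) (fun _ => 0)
noncomputable def gdM (xv : X → K → ℝ) (yv : Y → I → ℝ) (j : X × Y) : ((I × K) ⊕ Unit) ⊕ (I ⊕ K) → ℝ :=
  Sum.elim (fun _ => 0) (Sum.elim (fun a => vn (xv j.1) * yv j.2 a) (fun b => vn (yv j.2) * xv j.1 b))

lemma half_prob : (1/2 : ℝ) ≤ (stdG Unit).real {γ | γ () ≤ 0} := by
  have h1 : (stdG Unit).real {γ | γ () ≤ 0} = (gaussianReal 0 1).real (Set.Iic 0) := by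
    have mp := measurePreserving_eval (fun _ : Unit => gaussianReal 0 1) ()
    rw [← mp.map_eq, map_measureReal_apply mp.measurable measurableSet_Iic]
    rfl
  have h2 : (gaussianReal 0 1).real (Set.Iic 0) = (gaussianReal 0 1).real (Set.Ici 0) := by
    have := gaussianReal_map_neg (μ := 0) (v := 1)
    rw [neg_zero] at this
    conv_lhs => rw [← this]
    rw [map_measureReal_apply measurable_neg measurableSet_Iic]
    congr 1; ext x; simp
  have h3 : (1:ℝ) ≤ (gaussianReal 0 1).real (Set.Iic 0) + (gaussianReal 0 1).real (Set.Ici 0) := by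
    rw [← probReal_univ (μ := gaussianReal 0 1), ← Set.Iic_union_Ici (a := (0:ℝ))]
    exact measureReal_union_le _ _
  rw [h1]; linarith

lemma gd_horth (xv : X → K → ℝ) (yv : Y → I → ℝ) (j l : X × Y) :
    ∑ k, gdM xv yv j k * gdM' xv yv l k = 0 := by
  simp [gdM, gdM', Fintype.sum_sum_type]

lemma gd_diff (xv : X → K → ℝ) (yv : Y → I → ℝ) (j l : X × Y) :
    ∑ k, gdM' xv yv j k * gdM' xv yv l k - ∑ k, gdM xv yv j k * gdM xv yv l k =
    (vn (xv j.1) * vn (xv l.1) - ∑ b, xv j.1 b * xv l.1 b) *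
    (vn (yv j.2) * vn (yv l.2) - ∑ a, yv j.2 a * yv l.2 a) := by
  have e1 : ∑ ab : I × K, yv j.2 ab.1 * xv j.1 ab.2 * (yv l.2 ab.1 * xv l.1 ab.2) =
      (∑ a, yv j.2 a * yv l.2 a) * ∑ b, xv j.1 b * xv l.1 b := by
    rw [Fintype.sum_prod_type, Finset.sum_mul_sum]
    exact Finset.sum_congr rfl fun a _ => Finset.sum_congr rfl fun b _ => by ring
  have e2 : ∑ a, vn (xv j.1) * yv j.2 a * (vn (xv l.1) * yv l.2 a) = vn (xv j.1) * vn (xv l.1) * ∑ a, yv j.2 a * yv l.2 a := by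
    rw [Finset.mul_sum]; exact Finset.sum_congr rfl fun a _ => by ring
  have e3 : ∑ b, vn (yv j.2) * xv j.1 b * (vn (yv l.2) * xv l.1 b) = vn (yv j.2) * vn (yv l.2) * ∑ b, xv j.1 b * xv l.1 b := by
    rw [Finset.mul_sum]; exact Finset.sum_congr rfl fun a _ => by ring
  simp only [gdM, gdM', Fintype.sum_sum_type, Sum.elim_inl, Sum.elim_inr, e1, e2, e3]
  simp
  ring

theorem gordon_s (xv : X → K → ℝ) (yv : Y → I → ℝ) (s lam : ℝ) (hl : 0 < lam) (hs : lam ≤ s) (c : ℝ)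
    (R : (I → ℝ) → (K → ℝ) → ℝ) (hR : ∀ g h x, ∃ y,
      Real.exp (-lam * (vn (xv x) * (∑ a, yv y a * g a) + vn (yv y) * ∑ b, xv x b * h b)) ≤ R g h)
    (hRm : Measurable fun q : (I → ℝ) × (K → ℝ) => R q.1 q.2)
    (hRi : Integrable (fun ξ : I ⊕ K → ℝ => R (fun i => ξ (Sum.inl i)) (fun i => ξ (Sum.inr i))) (stdG (I ⊕ K))) :
    (stdG (I × K)).real {B | ∃ x, ∀ y, ∑ a, ∑ b, B (a, b) * yv y a * xv x b ≤ c} * (1/2) *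
      ((Fintype.card Y : ℝ) ^ (-(lam / s)) * Real.exp (-lam * c)) ≤
      (Fintype.card X : ℝ) ^ (lam / s) * ∫ ξ, R (fun i => ξ (Sum.inl i)) (fun i => ξ (Sum.inr i)) ∂(stdG (I ⊕ K)) := by
  have hs0 : 0 < s := hl.trans_le hs
  set p := lam / s with hp
  have hp0 : 0 < p := div_pos hl hs0
  have hp1 : p ≤ 1 := (div_le_one hs0).2 hs
  have hsp : s * p = lam := by rw [hp]; field_simp
  have hcY : (0:ℝ) < Fintype.card Y := by exact_mod_cast Fintype.card_pos
  have hcX : (0:ℝ) < Fintype.card X := by exact_mod_cast Fintype.card_pos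
  have comp := gG_comparison s p 0 (gdM xv yv) (gdM' xv yv) (gd_horth xv yv) (fun z _ => by
    rw [mul_zero, zero_mul]
    refine gordon_trace s p hp0.le hp1 _ (fun j l => ?_) (fun j l h => ?_) z
    · rw [gd_diff]
      exact mul_nonneg (sub_nonneg.2 (dot_le_vn _ _)) (sub_nonneg.2 (dot_le_vn _ _))
    · rw [gd_diff, h]
      have : vn (xv l.1) * vn (xv l.1) - ∑ b, xv l.1 b * xv l.1 b = 0 := by
        have := vn_sq (xv l.1)
        simp only [pow_two] at this
        rw [this, sub_self]
      rw [this, zero_mul])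
  rw [Real.exp_zero, one_mul] at comp
  set Ev : Set (I × K → ℝ) := {B | ∃ x, ∀ y, ∑ a, ∑ b, B (a, b) * yv y a * xv x b ≤ c} with hEv
  have mEv : MeasurableSet Ev := by
    have : Ev = ⋃ x, ⋂ y, {B | ∑ a, ∑ b, B (a, b) * yv y a * xv x b ≤ c} := by
      ext B; simp [hEv]
    rw [this]
    refine MeasurableSet.iUnion fun x => MeasurableSet.iInter fun y => ?_
    exact measurableSet_le (by fun_prop) measurable_const
  have mU : MeasurableSet {γ : Unit → ℝ | γ () ≤ 0} := measurableSet_le (by fun_prop) measurable_const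
  have hEG : EG (gG (X := X) (Y := Y) s p) := ((EP_gF s).rpow p).eg
  have hcont : Continuous (gG (X := X) (Y := Y) s p) := cont_gFr s p
  have hint : ∀ N : X × Y → ((I × K) ⊕ Unit) ⊕ (I ⊕ K) → ℝ,
      Integrable (fun ξ => gG s p (fun j => ∑ k, N j k * ξ k)) (stdG (((I × K) ⊕ Unit) ⊕ (I ⊕ K))) := by
    intro N
    obtain ⟨C, c', hC, hc', hb⟩ := hEG
    refine integrable_of_exp_bound (C := C) (c := c' * lpB N 0) (hcont.comp (by fun_prop)).measurable fun ξ => ?_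
    refine (hb _).trans ?_
    have := sum_lin_le N 0 1 0 (by simp) (by simp) ξ
    simp only [one_mul, Pi.zero_apply, mul_zero, add_zero] at this
    rw [mul_assoc]
    gcongr
  have low : (stdG (I × K)).real Ev * (1/2) * ((Fintype.card Y : ℝ) ^ (-p) * Real.exp (-lam * c)) ≤
      ∫ ξ, gG s p (fun j => ∑ k, gdM' xv yv j k * ξ k) ∂(stdG (((I × K) ⊕ Unit) ⊕ (I ⊕ K))) := by
    have e1 : (stdG (I × K)).real Ev * (stdG Unit).real {γ | γ () ≤ 0} =
        ∫ ξ, (Ev.indicator (1 : (I × K → ℝ) → ℝ) (fun i => ξ (Sum.inl (Sum.inl i))) *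
          ({γ : Unit → ℝ | γ () ≤ 0}).indicator (1 : (Unit → ℝ) → ℝ) (fun i => ξ (Sum.inl (Sum.inr i)))) ∂(stdG (((I × K) ⊕ Unit) ⊕ (I ⊕ K))) := by
      have m1 : Measurable (Ev.indicator (1 : (I × K → ℝ) → ℝ)) := measurable_one.indicator mEv
      have m2 : Measurable (({γ : Unit → ℝ | γ () ≤ 0}).indicator (1 : (Unit → ℝ) → ℝ)) := measurable_one.indicator mU
      rw [int_sum_fst (κ₁ := (I × K) ⊕ Unit) (fun ξ => Ev.indicator (1 : (I × K → ℝ) → ℝ) (fun i => ξ (Sum.inl i)) *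
          ({γ : Unit → ℝ | γ () ≤ 0}).indicator (1 : (Unit → ℝ) → ℝ) (fun i => ξ (Sum.inr i)))
          ((m1.comp (by fun_prop)).mul (m2.comp (by fun_prop)))]
      rw [int_sum_mul _ _ m1 m2, integral_indicator_one mEv, integral_indicator_one mU]
    have hk : 0 ≤ (Fintype.card Y : ℝ) ^ (-p) * Real.exp (-lam * c) := by positivity
    calc _ ≤ ((stdG (I × K)).real Ev * (stdG Unit).real {γ | γ () ≤ 0}) * ((Fintype.card Y : ℝ) ^ (-p) * Real.exp (-lam * c)) := by
          gcongr; exact half_prob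
      _ = _ := by rw [e1, ← integral_mul_const]
      _ ≤ _ := by
          refine integral_mono_of_nonneg (Filter.Eventually.of_forall fun ξ => ?_) (hint _) (Filter.Eventually.of_forall fun ξ => ?_)
          · refine mul_nonneg (mul_nonneg ?_ ?_) hk <;> exact Set.indicator_nonneg (fun _ _ => zero_le_one) _
          · have hpos : 0 ≤ gG s p (fun j => ∑ k, gdM' xv yv j k * ξ k) :=
              (((EP_gF (X := X) (Y := Y) s).rpow p).pos _).le
            by_cases hB : (fun i => ξ (Sum.inl (Sum.inl i))) ∈ Ev
            · by_cases hγ : (fun i => ξ (Sum.inl (Sum.inr i))) ∈ {γ : Unit → ℝ | γ () ≤ 0}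
              · simp only [Set.indicator_of_mem hB, Set.indicator_of_mem hγ, Pi.one_apply, one_mul]
                obtain ⟨x, hx⟩ := hB
                simp only [Set.mem_setOf_eq] at hγ
                have hz : ∀ y, ∑ k, gdM' xv yv (x, y) k * ξ k ≤ c := by
                  intro y
                  simp only [gdM', Fintype.sum_sum_type, Sum.elim_inl, Sum.elim_inr, Fintype.sum_prod_type]
                  have h1 := hx y
                  have h2 : vn (xv x) * vn (yv y) * ξ (Sum.inl (Sum.inr ())) ≤ 0 :=
                    mul_nonpos_of_nonneg_of_nonpos (mul_nonneg (vn_nonneg _) (vn_nonneg _)) hγ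
                  have h3 : ∑ a, ∑ b, yv y a * xv x b * ξ (Sum.inl (Sum.inl (a, b))) = ∑ a, ∑ b, ξ (Sum.inl (Sum.inl (a, b))) * yv y a * xv x b :=
                    Finset.sum_congr rfl fun a _ => Finset.sum_congr rfl fun b _ => by ring
                  simp only [Finset.univ_unique, PUnit.default_eq_unit, Finset.sum_singleton, zero_mul, Finset.sum_const_zero, add_zero]
                  linarith
                set z : X × Y → ℝ := fun j => ∑ k, gdM' xv yv j k * ξ k
                have hS : gS s x z ≤ Fintype.card Y * Real.exp (s * c) := by
                  unfold gS gE
                  calc _ ≤ ∑ y : Y, Real.exp (s * c) := Finset.sum_le_sum fun y _ =>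
                        Real.exp_le_exp.2 (mul_le_mul_of_nonneg_left (hz y) hs0.le)
                    _ = _ := by simp
                have hSp := (EP_gS (Y := Y) s x).pos z
                have hF : (Fintype.card Y * Real.exp (s * c))⁻¹ ≤ gF s z := by
                  refine (inv_anti₀ hSp hS).trans ?_
                  exact Finset.single_le_sum (f := fun x => (gS s x z)⁻¹) (fun x _ => (inv_pos.2 ((EP_gS s x).pos z)).le) (Finset.mem_univ x)
                refine le_trans (le_of_eq ?_) (Real.rpow_le_rpow (by positivity) hF hp0.le)
                rw [← Real.rpow_neg_eq_inv_rpow, Real.mul_rpow hcY.le (Real.exp_pos _).le, ← Real.exp_mul]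
                congr 2
                rw [← hsp]; ring
              · simp only [Set.indicator_of_notMem hγ]; simpa using hpos
            · simp only [Set.indicator_of_notMem hB]; simpa using hpos
  have up : ∫ ξ, gG s p (fun j => ∑ k, gdM xv yv j k * ξ k) ∂(stdG (((I × K) ⊕ Unit) ⊕ (I ⊕ K))) ≤
      (Fintype.card X : ℝ) ^ p * ∫ ξ, R (fun i => ξ (Sum.inl i)) (fun i => ξ (Sum.inr i)) ∂(stdG (I ⊕ K)) := by
    have hRm' : Measurable fun ξ : I ⊕ K → ℝ => R (fun i => ξ (Sum.inl i)) (fun i => ξ (Sum.inr i)) :=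
      hRm.comp (by fun_prop : Measurable fun ξ : I ⊕ K → ℝ => ((fun i => ξ (Sum.inl i), fun i => ξ (Sum.inr i)) : (I → ℝ) × (K → ℝ)))
    rw [← int_sum_snd (κ₁ := (I × K) ⊕ Unit) _ hRm', ← integral_const_mul]
    have mp2 : MeasurePreserving (fun ξ : ((I × K) ⊕ Unit) ⊕ (I ⊕ K) → ℝ => fun i => ξ (Sum.inr i)) (stdG _) (stdG (I ⊕ K)) :=
      measurePreserving_snd.comp (mp_sum ((I × K) ⊕ Unit) (I ⊕ K))
    refine integral_mono (hint _) ((mp2.integrable_comp_of_integrable hRi).const_mul _) fun ξ => ?_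
    simp only
    set r := R (fun i => ξ (Sum.inr (Sum.inl i))) (fun i => ξ (Sum.inr (Sum.inr i))) with hr
    set z : X × Y → ℝ := fun j => ∑ k, gdM xv yv j k * ξ k with hz
    have key : ∀ x, 0 < r ∧ (gS s x z)⁻¹ ≤ r ^ (1 / p) := by
      intro x
      obtain ⟨y, hy⟩ := hR (fun i => ξ (Sum.inr (Sum.inl i))) (fun i => ξ (Sum.inr (Sum.inr i))) x
      rw [← hr] at hy
      have hr0 : 0 < r := (Real.exp_pos _).trans_le hy
      refine ⟨hr0, ?_⟩
      have e1 : z (x, y) = vn (xv x) * (∑ a, yv y a * ξ (Sum.inr (Sum.inl a))) + vn (yv y) * ∑ b, xv x b * ξ (Sum.inr (Sum.inr b)) := by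
        simp only [hz, gdM, Fintype.sum_sum_type, Sum.elim_inl, Sum.elim_inr, Finset.mul_sum]
        simp [mul_assoc]
      rw [← e1] at hy
      have h1 : (gS s x z)⁻¹ ≤ (gE s (x, y) z)⁻¹ := by
        refine inv_anti₀ (Real.exp_pos _) ?_
        exact Finset.single_le_sum (f := fun y => gE s (x, y) z) (fun y _ => (Real.exp_pos _).le) (Finset.mem_univ y)
      refine h1.trans ?_
      have h2 := Real.rpow_le_rpow (Real.exp_pos _).le hy (by positivity : 0 ≤ 1 / p)
      refine le_trans (le_of_eq ?_) h2
      rw [← Real.exp_mul, gE, ← Real.exp_neg]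
      congr 1
      rw [← hsp]; field_simp
    have hr0 : 0 < r := (key (Classical.arbitrary X)).1
    have hF : gF s z ≤ Fintype.card X * r ^ (1 / p) := by
      unfold gF
      calc _ ≤ ∑ x : X, r ^ (1 / p) := Finset.sum_le_sum fun x _ => (key x).2
        _ = _ := by simp
    refine (Real.rpow_le_rpow ((EP_gF s).pos z).le hF hp0.le).trans (le_of_eq ?_)
    rw [Real.mul_rpow hcX.le (by positivity), ← Real.rpow_mul hr0.le, one_div_mul_cancel hp0.ne', Real.rpow_one]
  exact low.trans (comp.trans up)

theorem gordon (xv : X → K → ℝ) (yv : Y → I → ℝ) (lam : ℝ) (hl : 0 < lam) (c : ℝ)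
    (R : (I → ℝ) → (K → ℝ) → ℝ) (hR : ∀ g h x, ∃ y,
      Real.exp (-lam * (vn (xv x) * (∑ a, yv y a * g a) + vn (yv y) * ∑ b, xv x b * h b)) ≤ R g h)
    (hRm : Measurable fun q : (I → ℝ) × (K → ℝ) => R q.1 q.2)
    (hRi : Integrable (fun ξ : I ⊕ K → ℝ => R (fun i => ξ (Sum.inl i)) (fun i => ξ (Sum.inr i))) (stdG (I ⊕ K))) :
    (stdG (I × K)).real {B | ∃ x, ∀ y, ∑ a, ∑ b, B (a, b) * yv y a * xv x b ≤ c} ≤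
      2 * Real.exp (lam * c) * ∫ ξ, R (fun i => ξ (Sum.inl i)) (fun i => ξ (Sum.inr i)) ∂(stdG (I ⊕ K)) := by
  have h := fun s hs => gordon_s xv yv s lam hl hs c R hR hRm hRi
  set P := (stdG (I × K)).real {B | ∃ x, ∀ y, ∑ a, ∑ b, B (a, b) * yv y a * xv x b ≤ c}
  set V := ∫ ξ, R (fun i => ξ (Sum.inl i)) (fun i => ξ (Sum.inr i)) ∂(stdG (I ⊕ K))
  have hcY : (0:ℝ) < Fintype.card Y := by exact_mod_cast Fintype.card_pos
  have hcX : (0:ℝ) < Fintype.card X := by exact_mod_cast Fintype.card_pos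
  have t0 : Filter.Tendsto (fun s : ℝ => lam / s) Filter.atTop (nhds 0) :=
    Filter.Tendsto.div_atTop tendsto_const_nhds Filter.tendsto_id
  have t1 : Filter.Tendsto (fun s : ℝ => P * (1/2) * ((Fintype.card Y : ℝ) ^ (-(lam / s)) * Real.exp (-lam * c))) Filter.atTop
      (nhds (P * (1/2) * ((Fintype.card Y : ℝ) ^ (-(0:ℝ)) * Real.exp (-lam * c)))) := by
    refine tendsto_const_nhds.mul (Filter.Tendsto.mul_const _ ?_)
    exact (Real.continuousAt_const_rpow hcY.ne').tendsto.comp t0.neg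
  have t2 : Filter.Tendsto (fun s : ℝ => (Fintype.card X : ℝ) ^ (lam / s) * V) Filter.atTop (nhds ((Fintype.card X : ℝ) ^ (0:ℝ) * V)) :=
    ((Real.continuousAt_const_rpow hcX.ne').tendsto.comp t0).mul_const _
  have := le_of_tendsto_of_tendsto t1 t2 (Filter.eventually_atTop.2 ⟨lam, fun s hs => h s hs⟩)
  simp only [neg_zero, Real.rpow_zero, one_mul] at this
  have h2 := mul_le_mul_of_nonneg_left this (by positivity : 0 ≤ 2 * Real.exp (lam * c))
  have e : 2 * Real.exp (lam * c) * (P * (1/2) * Real.exp (-lam * c)) = P := by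
    have : Real.exp (lam * c) * Real.exp (-lam * c) = 1 := by
      rw [← Real.exp_add]; simp
    linear_combination P * this
  linarith
end gordon

section conc
variable {T K : Type} [Fintype T] [DecidableEq T] [Nonempty T] [Fintype K] [DecidableEq K]

lemma tr_id1 (q p u : T → ℝ) (hq : ∑ x, q x = 1) (hp : ∑ x, p x = 1) :
    ∑ j : T × T, ∑ l : T × T, (q j.1 * p j.2 * (q l.1 * p l.2)) * (u j.2 * u l.1 + u j.1 * u l.2)
      = 2 * ((∑ x, p x * u x) * (∑ x, q x * u x)) := by
  have e : ∀ j : T × T, ∑ l : T × T, (q j.1 * p j.2 * (q l.1 * p l.2)) * (u j.2 * u l.1 + u j.1 * u l.2)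
      = (q j.1 * (p j.2 * u j.2)) * (∑ x, q x * u x) + (q j.1 * u j.1 * p j.2) * ∑ x, p x * u x := by
    intro j
    rw [Fintype.sum_prod_type]
    have : ∀ x y, q j.1 * p j.2 * (q x * p y) * (u j.2 * u x + u j.1 * u y) =
       q j.1 * (p j.2 * u j.2) * ((q x * u x) * p y) + (q j.1 * u j.1 * p j.2) * (q x * (p y * u y)) := fun x y => by ring
    simp_rw [this, Finset.sum_add_distrib, ← Finset.mul_sum, hp, mul_one, ← Finset.sum_mul, hq, one_mul]
  simp_rw [e, Finset.sum_add_distrib, ← Finset.sum_mul, Fintype.sum_prod_type, ← Finset.mul_sum, ← Finset.sum_mul, hq, hp]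
  ring

lemma tr_id2 (q p u : T → ℝ) (hp : ∑ x, p x = 1) :
    ∑ j : T × T, ∑ l : T × T, (if j.1 = l.1 then (q j.1 * p j.2 * p l.2) else 0) * (u j.2 * u l.1 + u j.1 * u l.2)
      = 2 * ((∑ x, p x * u x) * (∑ x, q x * u x)) := by
  have e : ∀ j : T × T, ∑ l : T × T, (if j.1 = l.1 then (q j.1 * p j.2 * p l.2) else 0) * (u j.2 * u l.1 + u j.1 * u l.2)
      = (q j.1 * u j.1) * (p j.2 * u j.2) + (q j.1 * u j.1) * p j.2 * ∑ x, p x * u x := by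
    intro j
    rw [Fintype.sum_prod_type]
    simp only [ite_mul, zero_mul]
    rw [Finset.sum_eq_single j.1]
    · simp only [if_true]
      have : ∀ y, q j.1 * p j.2 * p y * (u j.2 * u j.1 + u j.1 * u y) =
        (q j.1 * u j.1 * (p j.2 * u j.2)) * p y + (q j.1 * u j.1 * p j.2) * (p y * u y) := fun y => by ring
      simp_rw [this, Finset.sum_add_distrib, ← Finset.mul_sum, hp]
      ring
    · intro b _ hb; simp [Ne.symm hb]
    · simp
  simp_rw [e, Finset.sum_add_distrib, Fintype.sum_prod_type, ← Finset.sum_mul, ← Finset.mul_sum, ← Finset.sum_mul, hp]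
  ring

lemma tr_id3 (q p u : T → ℝ) :
    ∑ j : T × T, ∑ l : T × T, (if j = l then (q j.1 * p j.2) else 0) * (u j.2 * u l.1 + u j.1 * u l.2)
      = 2 * ((∑ x, p x * u x) * (∑ x, q x * u x)) := by
  simp only [ite_mul, zero_mul, Finset.sum_ite_eq, Finset.mem_univ, if_true]
  have : ∀ j : T × T, q j.1 * p j.2 * (u j.2 * u j.1 + u j.1 * u j.2) = 2 * (q j.1 * u j.1) * (p j.2 * u j.2) := fun j => by ring
  simp_rw [this, Fintype.sum_prod_type, ← Finset.mul_sum, ← Finset.sum_mul, ← Finset.mul_sum]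
  ring

lemma conc_trace (v : T → K → ℝ) (ρ : ℝ) (hv : ∀ y, vn (v y) ≤ ρ) (s p : ℝ) (a b : T → ℝ) (z : T × T → ℝ)
    (hz : ∀ j, z j = a j.2 - b j.1) :
    ∑ j, ∑ l, gG2 s p j l z * (∑ k, (v j.2 k * v l.1 k + v j.1 k * v l.2 k)) ≤ 2 * (s * p) ^ 2 * ρ ^ 2 * gG s p z := by
  set A := ∑ y, Real.exp (s * a y) with hA
  set B := ∑ x, Real.exp (s * b x) with hB
  have hA0 : 0 < A := Finset.sum_pos (fun _ _ => Real.exp_pos _) Finset.univ_nonempty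
  have hB0 : 0 < B := Finset.sum_pos (fun _ _ => Real.exp_pos _) Finset.univ_nonempty
  set P : T → ℝ := fun y => Real.exp (s * a y) / A with hP
  set Q : T → ℝ := fun x => Real.exp (s * b x) / B with hQ
  have hP1 : ∑ y, P y = 1 := by rw [hP, ← Finset.sum_div]; exact div_self hA0.ne'
  have hQ1 : ∑ y, Q y = 1 := by rw [hQ, ← Finset.sum_div]; exact div_self hB0.ne'
  have hE : ∀ j, gE s j z = Real.exp (s * a j.2) / Real.exp (s * b j.1) := by
    intro j; rw [gE, hz, mul_sub, Real.exp_sub]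
  have hS : ∀ x, gS s x z = A / Real.exp (s * b x) := by
    intro x; rw [gS]; simp_rw [hE]; rw [← Finset.sum_div]
  set F := gF s z with hF
  have hFe : F = B / A := by
    rw [hF, gF]; simp_rw [hS, inv_div]; rw [← Finset.sum_div]
  have hF0 : 0 < F := by rw [hFe]; positivity
  have hF1 : ∀ j, gF1 s j z = -(s * F * (Q j.1 * P j.2)) := by
    intro j
    rw [gF1, hS, hE, hFe, hP, hQ]
    have := Real.exp_pos (s * b j.1)
    field_simp
  have hF2 : ∀ j l, gF2 s j l z = s ^ 2 * F * (2 * (if j.1 = l.1 then (Q j.1 * P j.2 * P l.2) else 0) - (if j = l then (Q j.1 * P j.2) else 0)) := by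
    intro j l
    rw [gF2, hS, hE, hE, hFe, hP, hQ, mul_sub, sub_eq_add_neg]
    have := Real.exp_pos (s * b j.1)
    congr 1
    · split_ifs with h
      · rw [← h]; field_simp
      · simp
    · split_ifs with h
      · field_simp
      · simp
  have hr1 : F ^ (p - 1) * F = F ^ p := by
    rw [← Real.rpow_add_one hF0.ne']; congr 1; ring
  have hr2 : F ^ (p - 1 - 1) * F * F = F ^ p := by
    rw [← Real.rpow_add_one hF0.ne', ← Real.rpow_add_one hF0.ne']; congr 1; ring
  have hG2 : ∀ j l, gG2 s p j l z = p * s ^ 2 * F ^ p * ((p - 1) * (Q j.1 * P j.2 * (Q l.1 * P l.2)) +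
      2 * (if j.1 = l.1 then (Q j.1 * P j.2 * P l.2) else 0) - (if j = l then (Q j.1 * P j.2) else 0)) := by
    intro j l
    rw [gG2, hF1, hF1, hF2, ← hF]
    generalize (if j.1 = l.1 then (Q j.1 * P j.2 * P l.2) else 0) = d1
    generalize (if j = l then (Q j.1 * P j.2) else 0) = d2
    linear_combination (p * (p-1) * s^2 * (Q j.1 * P j.2 * (Q l.1 * P l.2))) * hr2 + (p * s^2 * (2 * d1 - d2)) * hr1
  have main : ∑ j, ∑ l, gG2 s p j l z * (∑ k, (v j.2 k * v l.1 k + v j.1 k * v l.2 k)) =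
      ∑ k, 2 * (s * p) ^ 2 * F ^ p * ((∑ x, P x * v x k) * (∑ x, Q x * v x k)) := by
    simp_rw [Finset.mul_sum]
    rw [Finset.sum_congr rfl fun j _ => Finset.sum_comm, Finset.sum_comm]
    refine Finset.sum_congr rfl fun k _ => ?_
    have i1 := tr_id1 Q P (fun x => v x k) hQ1 hP1
    have i2 := tr_id2 Q P (fun x => v x k) hP1
    have i3 := tr_id3 Q P (fun x => v x k)
    have e : ∀ j l : T × T, gG2 s p j l z * (v j.2 k * v l.1 k + v j.1 k * v l.2 k) =
      (p * s^2 * F^p * (p-1)) * ((Q j.1 * P j.2 * (Q l.1 * P l.2)) * (v j.2 k * v l.1 k + v j.1 k * v l.2 k)) +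
      (p * s^2 * F^p * 2) * ((if j.1 = l.1 then (Q j.1 * P j.2 * P l.2) else 0) * (v j.2 k * v l.1 k + v j.1 k * v l.2 k)) -
      (p * s^2 * F^p) * ((if j = l then (Q j.1 * P j.2) else 0) * (v j.2 k * v l.1 k + v j.1 k * v l.2 k)) := by
      intro j l; rw [hG2]; ring
    simp_rw [e, Finset.sum_sub_distrib, Finset.sum_add_distrib, ← Finset.mul_sum]
    rw [i1, i2, i3]
    ring
  rw [main, ← Finset.mul_sum]
  have hPn : ∀ R : T → ℝ, (∀ x, 0 ≤ R x) → ∑ x, R x = 1 → vn (fun k => ∑ x, R x * v x k) ≤ ρ := by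
    intro R hR hR1
    set w := fun k => ∑ x, R x * v x k with hw
    have h1 : vn w ^ 2 ≤ ρ * vn w := by
      rw [vn_sq]
      have : ∑ k, w k ^ 2 = ∑ x, R x * ∑ k, v x k * w k := by
        simp_rw [pow_two, Finset.mul_sum]
        rw [Finset.sum_comm]
        refine Finset.sum_congr rfl fun k _ => ?_
        conv_lhs => rw [hw]
        simp only
        rw [Finset.sum_mul]
        exact Finset.sum_congr rfl fun x _ => by ring
      rw [this]
      calc _ ≤ ∑ x, R x * (ρ * vn w) := Finset.sum_le_sum fun x _ => mul_le_mul_of_nonneg_left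
            ((dot_le_vn _ _).trans (mul_le_mul_of_nonneg_right (hv x) (vn_nonneg _))) (hR x)
        _ = _ := by rw [← Finset.sum_mul, hR1, one_mul]
    have h2 := vn_nonneg w
    have h3 : 0 ≤ ρ := (vn_nonneg _).trans (hv (Classical.arbitrary T))
    nlinarith
  have hPP := hPn P (fun x => by positivity) hP1
  have hQQ := hPn Q (fun x => by positivity) hQ1
  have hd := dot_le_vn (fun k => ∑ x, P x * v x k) (fun k => ∑ x, Q x * v x k)
  have h3 : 0 ≤ ρ := (vn_nonneg _).trans (hv (Classical.arbitrary T))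
  have hd2 : ∑ k, (∑ x, P x * v x k) * (∑ x, Q x * v x k) ≤ ρ ^ 2 :=
    hd.trans (by rw [pow_two]; exact mul_le_mul hPP hQQ (vn_nonneg _) h3)
  have hFp : 0 < F ^ p := Real.rpow_pos_of_pos hF0 _
  calc _ ≤ 2 * (s * p) ^ 2 * F ^ p * ρ ^ 2 := mul_le_mul_of_nonneg_left hd2 (by positivity)
    _ = _ := by rw [gG]; ring

noncomputable def Phi (v : T → K → ℝ) (h : K → ℝ) : ℝ := ⨆ y, ∑ k, v y k * h k

lemma le_Phi (v : T → K → ℝ) (h : K → ℝ) (y : T) : ∑ k, v y k * h k ≤ Phi v h :=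
  le_ciSup (f := fun y => ∑ k, v y k * h k) (Set.finite_range _).bddAbove y

lemma exists_Phi (v : T → K → ℝ) (h : K → ℝ) : ∃ y, ∑ k, v y k * h k = Phi v h :=
  exists_eq_ciSup_of_finite

lemma measurable_Phi (v : T → K → ℝ) : Measurable (Phi v) := by
  unfold Phi
  exact Measurable.iSup fun y => by fun_prop

lemma abs_Phi_le (v : T → K → ℝ) : ∃ C : ℝ, 0 ≤ C ∧ ∀ h, |Phi v h| ≤ C * ∑ k, |h k| := by
  refine ⟨lpB v 0, lpB_nonneg _ _, fun h => ?_⟩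
  obtain ⟨y, hy⟩ := exists_Phi v h
  rw [← hy]
  have := sum_lin_le v 0 1 0 (by simp) (by simp) h
  simp only [one_mul, Pi.zero_apply, mul_zero, add_zero] at this
  exact (Finset.single_le_sum (f := fun y => |∑ k, v y k * h k|) (fun _ _ => abs_nonneg _) (Finset.mem_univ y)).trans this

lemma integrable_exp_Phi (v : T → K → ℝ) (lam : ℝ) : Integrable (fun h => Real.exp (lam * Phi v h)) (stdG K) := by
  obtain ⟨C, hC, h⟩ := abs_Phi_le v
  refine integrable_of_exp_bound (C := 1) (c := |lam| * C) (((measurable_Phi v).const_mul lam).exp) fun ξ => ?_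
  rw [abs_of_pos (Real.exp_pos _), one_mul, Real.exp_le_exp]
  calc _ ≤ |lam * Phi v ξ| := le_abs_self _
    _ = |lam| * |Phi v ξ| := abs_mul _ _
    _ ≤ _ := by rw [mul_assoc]; exact mul_le_mul_of_nonneg_left (h ξ) (abs_nonneg _)

noncomputable def cM (v : T → K → ℝ) (j : T × T) : K ⊕ (K ⊕ K) → ℝ :=
  Sum.elim (fun k => v j.2 k - v j.1 k) (fun _ => 0)
noncomputable def cM' (v : T → K → ℝ) (j : T × T) : K ⊕ (K ⊕ K) → ℝ :=
  Sum.elim (fun _ => 0) (Sum.elim (fun k => v j.2 k) (fun k => - v j.1 k))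

lemma conc_s (v : T → K → ℝ) (ρ : ℝ) (hv : ∀ y, vn (v y) ≤ ρ) (lam s : ℝ) (hl : 0 < lam) (hs : 0 < s) :
    (∫ h, Real.exp (lam * Phi v h) ∂(stdG K)) * (∫ h, Real.exp (-lam * Phi v h) ∂(stdG K)) * (Fintype.card T : ℝ) ^ (-(lam / s))
      ≤ Real.exp (lam ^ 2 * ρ ^ 2) := by
  set p := lam / s with hp
  have hp0 : 0 < p := div_pos hl hs
  have hsp : s * p = lam := by rw [hp]; field_simp
  have hcT : (0:ℝ) < Fintype.card T := by exact_mod_cast Fintype.card_pos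
  have comp := gG_comparison s p (lam ^ 2 * ρ ^ 2) (cM v) (cM' v) (fun j l => by simp [cM, cM', Fintype.sum_sum_type]) (by
    rintro z ⟨θ, ξ, hz⟩
    have := conc_trace v ρ hv s p
      (fun y => Real.cos θ * ∑ k, v y k * ξ (Sum.inl k) + Real.sin θ * ∑ k, v y k * ξ (Sum.inr (Sum.inl k)))
      (fun y => Real.cos θ * ∑ k, v y k * ξ (Sum.inl k) + Real.sin θ * ∑ k, v y k * ξ (Sum.inr (Sum.inr k))) z (by
        intro j
        rw [hz]
        simp only [linPath, cM, cM', Fintype.sum_sum_type, Sum.elim_inl, Sum.elim_inr, Finset.mul_sum]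
        simp only [← Finset.sum_add_distrib, ← Finset.sum_sub_distrib]
        exact Finset.sum_congr rfl fun k _ => by ring)
    rw [hsp] at this
    refine le_trans (le_of_eq ?_) (this.trans (le_of_eq (by ring)))
    refine Finset.sum_congr rfl fun j _ => Finset.sum_congr rfl fun l _ => ?_
    congr 1
    simp only [cM, cM', Fintype.sum_sum_type, Sum.elim_inl, Sum.elim_inr, mul_zero, Finset.sum_const_zero, zero_add, add_zero]
    rw [← Finset.sum_add_distrib, ← Finset.sum_sub_distrib]
    exact Finset.sum_congr rfl fun k _ => by ring)
  have hR : ∀ ξ : K ⊕ (K ⊕ K) → ℝ, gG s p (fun j => ∑ k, cM v j k * ξ k) = 1 := by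
    intro ξ
    have hz : (fun j => ∑ k, cM v j k * ξ k) = fun j : T × T => (∑ k, v j.2 k * ξ (Sum.inl k)) - ∑ k, v j.1 k * ξ (Sum.inl k) := by
      ext j
      simp only [cM, Fintype.sum_sum_type, Sum.elim_inl, Sum.elim_inr, zero_mul, Finset.sum_const_zero, add_zero]
      rw [← Finset.sum_sub_distrib]
      exact Finset.sum_congr rfl fun k _ => by ring
    rw [hz]
    have : gF s (fun j : T × T => (∑ k, v j.2 k * ξ (Sum.inl k)) - ∑ k, v j.1 k * ξ (Sum.inl k)) = 1 := by
      unfold gF gS gE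
      simp only [mul_sub, Real.exp_sub]
      simp_rw [← Finset.sum_div, inv_div]
      rw [← Finset.sum_div]
      exact div_self (Finset.sum_pos (fun _ _ => Real.exp_pos _) Finset.univ_nonempty).ne'
    rw [gG, this, Real.one_rpow]
  simp only [hR, integral_const, probReal_univ, smul_eq_mul, mul_one] at comp
  refine le_trans ?_ comp
  have m1 : Measurable fun h => Real.exp (-lam * Phi v h) := ((measurable_Phi v).const_mul _).exp
  have m2 : Measurable fun h => Real.exp (lam * Phi v h) := ((measurable_Phi v).const_mul _).exp
  have e1 : (∫ h, Real.exp (lam * Phi v h) ∂(stdG K)) * (∫ h, Real.exp (-lam * Phi v h) ∂(stdG K)) =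
    ∫ ξ, Real.exp (-lam * Phi v (fun k => ξ (Sum.inr (Sum.inl k)))) * Real.exp (lam * Phi v (fun k => ξ (Sum.inr (Sum.inr k)))) ∂(stdG (K ⊕ (K ⊕ K))) := by
    rw [int_sum_snd (κ₂ := K ⊕ K) (fun ξ => Real.exp (-lam * Phi v (fun k => ξ (Sum.inl k))) * Real.exp (lam * Phi v (fun k => ξ (Sum.inr k))))
      ((m1.comp (by fun_prop)).mul (m2.comp (by fun_prop)))]
    rw [int_sum_mul _ _ m1 m2, mul_comm]
  rw [e1, ← integral_mul_const]
  have hint : Integrable (fun ξ => gG s p (fun j => ∑ k, cM' v j k * ξ k)) (stdG (K ⊕ (K ⊕ K))) := by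
    obtain ⟨C, c', hC, hc', hb⟩ := ((EP_gF (X := T) (Y := T) s).rpow p).eg
    refine integrable_of_exp_bound (C := C) (c := c' * lpB (cM' v) 0) ((cont_gFr s p).comp (by fun_prop)).measurable fun ξ => ?_
    refine (hb _).trans ?_
    have := sum_lin_le (cM' v) 0 1 0 (by simp) (by simp) ξ
    simp only [one_mul, Pi.zero_apply, mul_zero, add_zero] at this
    rw [mul_assoc]
    gcongr
  refine integral_mono_of_nonneg (Filter.Eventually.of_forall fun ξ => by positivity) hint (Filter.Eventually.of_forall fun ξ => ?_)
  simp only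
  set g := (fun k => ξ (Sum.inr (Sum.inl k)))
  set g' := (fun k => ξ (Sum.inr (Sum.inr k)))
  have hz : (fun j => ∑ k, cM' v j k * ξ k) = fun j : T × T => (∑ k, v j.2 k * g k) - ∑ k, v j.1 k * g' k := by
    ext j
    simp only [cM', Fintype.sum_sum_type, Sum.elim_inl, Sum.elim_inr, zero_mul, Finset.sum_const_zero, zero_add]
    rw [← Finset.sum_add_distrib, ← Finset.sum_sub_distrib]
    exact Finset.sum_congr rfl fun k _ => by ring
  rw [hz]
  have hF : Real.exp (s * Phi v g') / (Fintype.card T * Real.exp (s * Phi v g)) ≤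
      gF s (fun j : T × T => (∑ k, v j.2 k * g k) - ∑ k, v j.1 k * g' k) := by
    unfold gF gS gE
    simp only [mul_sub, Real.exp_sub]
    simp_rw [← Finset.sum_div, inv_div]
    rw [← Finset.sum_div]
    gcongr
    · obtain ⟨y, hy⟩ := exists_Phi v g'
      rw [← hy]
      exact Finset.single_le_sum (f := fun y => Real.exp (s * ∑ k, v y k * g' k)) (fun _ _ => (Real.exp_pos _).le) (Finset.mem_univ y)
    · calc _ ≤ ∑ y : T, Real.exp (s * Phi v g) := Finset.sum_le_sum fun y _ => by
            gcongr; exact le_Phi v g y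
        _ = _ := by simp
  refine le_trans (le_of_eq ?_) (Real.rpow_le_rpow (by positivity) hF hp0.le)
  rw [Real.div_rpow (by positivity) (by positivity), Real.mul_rpow (by positivity) (by positivity), ← Real.exp_mul, ← Real.exp_mul,
    Real.rpow_neg hcT.le]
  have e2 : s * Phi v g' * p = lam * Phi v g' := by rw [← hsp]; ring
  have e3 : s * Phi v g * p = lam * Phi v g := by rw [← hsp]; ring
  rw [e2, e3, neg_mul, Real.exp_neg]
  field_simp

theorem conc (v : T → K → ℝ) (ρ : ℝ) (hv : ∀ y, vn (v y) ≤ ρ) (lam : ℝ) (hl : 0 < lam) :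
    (∫ h, Real.exp (lam * Phi v h) ∂(stdG K)) * (∫ h, Real.exp (-lam * Phi v h) ∂(stdG K)) ≤ Real.exp (lam ^ 2 * ρ ^ 2) := by
  have hcT : (0:ℝ) < Fintype.card T := by exact_mod_cast Fintype.card_pos
  set P := (∫ h, Real.exp (lam * Phi v h) ∂(stdG K)) * (∫ h, Real.exp (-lam * Phi v h) ∂(stdG K)) with hP
  have t0 : Filter.Tendsto (fun s : ℝ => lam / s) Filter.atTop (nhds 0) :=
    Filter.Tendsto.div_atTop tendsto_const_nhds Filter.tendsto_id
  have t1 : Filter.Tendsto (fun s : ℝ => P * (Fintype.card T : ℝ) ^ (-(lam / s))) Filter.atTop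
      (nhds (P * (Fintype.card T : ℝ) ^ (-(0:ℝ)))) :=
    tendsto_const_nhds.mul ((Real.continuousAt_const_rpow hcT.ne').tendsto.comp t0.neg)
  have := le_of_tendsto t1 (Filter.eventually_atTop.2 ⟨1, fun s hs => conc_s v ρ hv lam s hl (by linarith)⟩)
  simpa using this
end conc

section vnorm
variable {I : Type} [Fintype I]
lemma vn_eq (v : I → ℝ) : vn v = ‖WithLp.toLp 2 v‖ := by
  rw [EuclideanSpace.norm_eq]; simp [vn]
lemma vn_add_le (v w : I → ℝ) : vn (v + w) ≤ vn v + vn w := by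
  simp only [vn_eq, WithLp.toLp_add]; exact norm_add_le _ _
lemma vn_smul (c : ℝ) (v : I → ℝ) : vn (c • v) = |c| * vn v := by
  simp only [vn_eq, WithLp.toLp_smul, norm_smul, Real.norm_eq_abs]
lemma vn_neg (v : I → ℝ) : vn (-v) = vn v := by
  simp only [vn_eq, WithLp.toLp_neg, norm_neg]
lemma vn_sub_comm (v w : I → ℝ) : vn (v - w) = vn (w - v) := by
  rw [← vn_neg, neg_sub]
lemma vn_zero : vn (0 : I → ℝ) = 0 := by simp [vn]
lemma cont_vn : Continuous (vn : (I → ℝ) → ℝ) := by unfold vn; fun_prop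
lemma meas_vn : Measurable (vn : (I → ℝ) → ℝ) := cont_vn.measurable
lemma abs_le_vn (v : I → ℝ) (i : I) : |v i| ≤ vn v := by
  rw [vn, ← Real.sqrt_sq_eq_abs]
  exact Real.sqrt_le_sqrt (Finset.single_le_sum (f := fun i => v i ^ 2) (fun _ _ => sq_nonneg _) (Finset.mem_univ i))
lemma vn_le_sum_abs (v : I → ℝ) : vn v ≤ ∑ i, |v i| := by
  rw [vn]
  refine Real.sqrt_le_iff.2 ⟨Finset.sum_nonneg fun _ _ => abs_nonneg _, ?_⟩
  calc ∑ i, v i ^ 2 = ∑ i, |v i| ^ 2 := by simp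
    _ ≤ _ := Finset.sum_sq_le_sq_sum_of_nonneg fun _ _ => abs_nonneg _
lemma vn_le_card (v : I → ℝ) : vn v ≤ Fintype.card I * ‖v‖ := by
  refine (vn_le_sum_abs v).trans ?_
  calc _ ≤ ∑ i : I, ‖v‖ := Finset.sum_le_sum fun i _ => norm_le_pi_norm v i
    _ = _ := by simp
lemma norm_le_vn (v : I → ℝ) : ‖v‖ ≤ vn v :=
  (pi_norm_le_iff_of_nonneg (vn_nonneg v)).2 fun i => abs_le_vn v i

lemma net_exists (S : Set (I → ℝ)) (ρ : ℝ) (hS : ∀ w ∈ S, vn w ≤ ρ) (ε : ℝ) (hε : 0 < ε) :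
    ∃ T : Finset (I → ℝ), ↑T ⊆ S ∧ ∀ x ∈ S, ∃ y ∈ T, vn (x - y) ≤ ε := by
  have hb : TotallyBounded S := by
    have : Bornology.IsBounded S := isBounded_iff_forall_norm_le.2 ⟨ρ, fun w hw => (norm_le_vn w).trans (hS w hw)⟩
    exact (Bornology.IsBounded.isCompact_closure this).totallyBounded.subset subset_closure
  have hc : (0:ℝ) < Fintype.card I + 1 := by positivity
  obtain ⟨t, hts, htf, htc⟩ := Metric.finite_approx_of_totallyBounded hb (ε / (Fintype.card I + 1)) (by positivity)
  refine ⟨htf.toFinset, by simpa using hts, fun x hx => ?_⟩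
  have := htc hx
  simp only [Set.mem_iUnion, Metric.mem_ball, exists_prop] at this
  obtain ⟨y, hy, hd⟩ := this
  refine ⟨y, by simpa using hy, (vn_le_card _).trans ?_⟩
  rw [dist_eq_norm] at hd
  rw [lt_div_iff₀ hc] at hd
  nlinarith [norm_nonneg (x - y)]

lemma sphere_net [Nonempty I] (δ : ℝ) (hδ : 0 < δ) :
    ∃ T : Finset (I → ℝ), T.Nonempty ∧ (∀ y ∈ T, vn y = 1) ∧ (∀ u, vn u = 1 → ∃ y ∈ T, vn (u - y) ≤ δ) ∧
      ∀ g : I → ℝ, ∃ y ∈ T, (1 - δ) * vn g ≤ ∑ i, y i * g i := by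
  classical
  obtain ⟨T, hT, hn⟩ := net_exists {u : I → ℝ | vn u = 1} 1 (fun w hw => le_of_eq hw) δ hδ
  have hne : T.Nonempty := by
    obtain ⟨i⟩ := ‹Nonempty I›
    obtain ⟨y, hy, _⟩ := hn (Pi.single i 1) (by
      simp [vn, Pi.single_apply])
    exact ⟨y, hy⟩
  refine ⟨T, hne, fun y hy => hT hy, hn, fun g => ?_⟩
  by_cases hg : vn g = 0
  · obtain ⟨y, hy⟩ := hne
    refine ⟨y, hy, ?_⟩
    have hz : ∀ i, g i = 0 := fun i => abs_eq_zero.1 (le_antisymm (hg ▸ abs_le_vn g i) (abs_nonneg _))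
    simp [hg, hz]
  · have hg0 : 0 < vn g := lt_of_le_of_ne (vn_nonneg _) (Ne.symm hg)
    obtain ⟨y, hy, hd⟩ := hn ((vn g)⁻¹ • g) (by
      show vn _ = 1
      rw [vn_smul, abs_of_pos (inv_pos.2 hg0), inv_mul_cancel₀ hg])
    refine ⟨y, hy, ?_⟩
    have h1 := dot_le_vn ((vn g)⁻¹ • g - y) g
    have h2 : ∑ i, ((vn g)⁻¹ • g - y) i * g i = vn g - ∑ i, y i * g i := by
      simp only [Pi.sub_apply, Pi.smul_apply, smul_eq_mul, sub_mul, Finset.sum_sub_distrib]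
      congr 1
      simp_rw [mul_assoc, ← Finset.mul_sum, ← pow_two]
      rw [← vn_sq]; field_simp
    rw [h2] at h1
    nlinarith

lemma exists_large [DecidableEq I] (ε : ℝ) (hε : 0 < ε) : ∃ R : ℝ, 0 < R ∧ (stdG I).real {B | R < vn B} ≤ ε := by
  have hint : Integrable (fun ξ : I → ℝ => Real.exp (1 * ∑ k, |ξ k|)) (stdG I) := integrable_exp_sum_abs 1
  set V := ∫ ξ : I → ℝ, Real.exp (1 * ∑ k, |ξ k|) ∂(stdG I)
  have hV : 0 ≤ V := integral_nonneg fun _ => (Real.exp_pos _).le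
  refine ⟨V / ε + 1, by positivity, ?_⟩
  have hm := mul_meas_ge_le_integral_of_nonneg (Filter.Eventually.of_forall fun ξ => (Real.exp_pos _).le) hint (V / ε + 1)
  have hsub : {B : I → ℝ | V / ε + 1 < vn B} ⊆ {ξ | V / ε + 1 ≤ Real.exp (1 * ∑ k, |ξ k|)} := by
    intro B hB
    simp only [Set.mem_setOf_eq, one_mul] at *
    have := vn_le_sum_abs B
    have := Real.add_one_le_exp (∑ k, |B k|)
    linarith
  have h2 := measureReal_mono hsub (μ := stdG I) (by finiteness)
  have h3 : (V / ε + 1) * (stdG I).real {B : I → ℝ | V / ε + 1 < vn B} ≤ V :=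
    (mul_le_mul_of_nonneg_left h2 (by positivity)).trans hm
  have h5 : 0 ≤ (stdG I).real {B : I → ℝ | V / ε + 1 < vn B} := measureReal_nonneg
  have h4 : V / ε * ε = V := by field_simp
  by_contra hcon
  push Not at hcon
  have : 0 ≤ V / ε := by positivity
  nlinarith
end vnorm

section meas
lemma mp_reindex {κ κ' : Type} [Fintype κ] [Fintype κ'] (e : κ' ≃ κ) :
    MeasurePreserving (fun ξ : κ → ℝ => fun j => ξ (e j)) (stdG κ) (stdG κ') := by
  refine ⟨by fun_prop, (Measure.pi_eq fun s hs => ?_).symm⟩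
  rw [Measure.map_apply (by fun_prop) (MeasurableSet.univ_pi hs)]
  have : (fun ξ : κ → ℝ => fun j => ξ (e j)) ⁻¹' (Set.univ.pi s) = Set.univ.pi fun k => s (e.symm k) := by
    ext ξ
    simp only [Set.mem_preimage, Set.mem_pi, Set.mem_univ, true_implies]
    exact ⟨fun h k => by simpa using h (e.symm k), fun h j => by simpa using h (e j)⟩
  rw [this, Measure.pi_pi]
  exact Fintype.prod_equiv e.symm _ _ fun k => rfl

instance muAv_prob (m n : ℕ) (σ : ℝ) : IsProbabilityMeasure (muAv m n σ) := by
  unfold muAv; infer_instance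

noncomputable def Wmap (m n : ℕ) (σ : ℝ) (ω : (Fin m → Fin n → ℝ) × (Fin m → ℝ)) :
    Fin m × (Fin n ⊕ Unit) → ℝ := fun p => Sum.elim (fun j => ω.1 p.1 j) (fun _ => σ⁻¹ * ω.2 p.1) p.2

lemma mp_Wmap (m n : ℕ) (σ : ℝ) (hσ : 0 < σ) :
    MeasurePreserving (Wmap m n σ) (muAv m n σ) (stdG (Fin m × (Fin n ⊕ Unit))) := by
  have hm : Measurable (Wmap m n σ) := by
    refine measurable_pi_iff.2 fun p => ?_
    obtain ⟨i, j | j⟩ := p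
    · simp only [Wmap, Sum.elim_inl]; fun_prop
    · simp only [Wmap, Sum.elim_inr]; fun_prop
  refine ⟨hm, (Measure.pi_eq fun s hs => ?_).symm⟩
  rw [Measure.map_apply hm (MeasurableSet.univ_pi hs)]
  have : Wmap m n σ ⁻¹' (Set.univ.pi s) = (Set.univ.pi fun i => Set.univ.pi fun j => s (i, Sum.inl j)) ×ˢ
      (Set.univ.pi fun i => (fun x => σ⁻¹ * x) ⁻¹' s (i, Sum.inr ())) := by
    ext ω
    simp only [Set.mem_preimage, Set.mem_pi, Set.mem_univ, true_implies, Set.mem_prod, Wmap]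
    constructor
    · exact fun h => ⟨fun i j => h (i, Sum.inl j), fun i => h (i, Sum.inr ())⟩
    · rintro ⟨h1, h2⟩ ⟨i, j | j⟩
      exacts [h1 i j, h2 i]
  rw [this, muAv, Measure.prod_prod, Measure.pi_pi, Measure.pi_pi, Fintype.prod_prod_type]
  simp_rw [Fintype.prod_sum_type, Measure.pi_pi]
  rw [Finset.prod_mul_distrib]
  congr 1
  refine Finset.prod_congr rfl fun i _ => ?_
  have e := gaussianReal_map_const_mul (μ := 0) (v := (σ^2).toNNReal) σ⁻¹
  simp only [mul_zero] at e
  simp only [Finset.univ_unique, PUnit.default_eq_unit, Finset.prod_singleton]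
  rw [← Measure.map_apply (by fun_prop) (hs _)]
  rw [show (fun x => σ⁻¹ * x) = (σ⁻¹ * ·) from rfl, e]
  congr 2
  apply NNReal.eq
  simp [Real.coe_toNNReal _ (sq_nonneg σ), hσ.ne']

end meas

lemma int2i {κ₁ κ₂ : Type} [Fintype κ₁] [Fintype κ₂] {f : (κ₁ → ℝ) → ℝ} {g : (κ₂ → ℝ) → ℝ}
    (hf : Integrable f (stdG κ₁)) (hg : Integrable g (stdG κ₂)) :
    Integrable (fun ξ => f (fun i => ξ (Sum.inl i)) * g (fun i => ξ (Sum.inr i))) (stdG (κ₁ ⊕ κ₂)) :=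
  (mp_sum κ₁ κ₂).integrable_comp_of_integrable (hf.mul_prod hg)

lemma int_unit (f : ℝ → ℝ) : ∫ ξ : Unit → ℝ, f (ξ ()) ∂(stdG Unit) = ∫ x, f x ∂(gaussianReal 0 1) := by
  have := (measurePreserving_piUnique (fun _ : Unit => gaussianReal 0 1)).integral_comp
    (MeasurableEquiv.piUnique (fun _ : Unit => ℝ)).measurableEmbedding f
  exact this

lemma mgf_std (c : ℝ) : ∫ x, Real.exp (c * x) ∂(gaussianReal 0 1) = Real.exp (c ^ 2 / 2) := by
  have := mgf_gaussianReal (X := (id : ℝ → ℝ)) (p := gaussianReal 0 1) (μ := 0) (v := 1) (by simp) c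
  simp only [mgf, id] at this
  rw [this]; congr 1; simp

lemma int_exp_abs_unit (c : ℝ) : ∫ ξ : Unit → ℝ, Real.exp (c * |ξ ()|) ∂(stdG Unit) ≤ 2 * Real.exp (c ^ 2 / 2) := by
  rw [int_unit (fun x => Real.exp (c * |x|))]
  have h1 := (integrable_exp_mul_gaussianReal (μ := 0) (v := 1) c)
  have h2 := (integrable_exp_mul_gaussianReal (μ := 0) (v := 1) (-c))
  calc _ ≤ ∫ x, (Real.exp (c * x) + Real.exp (-c * x)) ∂(gaussianReal 0 1) := by
        refine integral_mono (integrable_exp_abs c) (h1.add h2) fun x => ?_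
        simp only
        rcases abs_cases x with ⟨h, _⟩ | ⟨h, _⟩ <;> rw [h]
        · have := Real.exp_pos (-c * x); linarith
        · have := Real.exp_pos (c * x); rw [mul_neg, ← neg_mul]; linarith
    _ = _ := by rw [integral_add h1 h2, mgf_std, mgf_std]; ring_nf

lemma integrable_exp_abs_unit (c : ℝ) : Integrable (fun ξ : Unit → ℝ => Real.exp (c * |ξ ()|)) (stdG Unit) := by
  have := integrable_exp_sum_abs (κ := Unit) c
  simpa using this

/-- residual -/
noncomputable def res (m n : ℕ) (ω : (Fin m → Fin n → ℝ) × (Fin m → ℝ)) (w : Fin n → ℝ) : Fin m → ℝ :=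
  fun i => ω.2 i - ∑ j, ω.1 i j * w j

noncomputable def xw {n : ℕ} (σ : ℝ) (w : Fin n → ℝ) : Fin n ⊕ Unit → ℝ := Sum.elim (fun j => - w j) (fun _ => σ)

lemma vn_xw {n : ℕ} (σ : ℝ) (w : Fin n → ℝ) : vn (xw σ w) = Real.sqrt (σ ^ 2 + vn w ^ 2) := by
  rw [vn_sq, vn, Fintype.sum_sum_type]; simp [xw, add_comm]

lemma xw_dot {n : ℕ} (σ : ℝ) (w : Fin n → ℝ) (h : Fin n ⊕ Unit → ℝ) :
    ∑ b, xw σ w b * h b = σ * h (Sum.inr ()) - ∑ j, w j * h (Sum.inl j) := by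
  rw [Fintype.sum_sum_type]; simp [xw]; ring

lemma res_eq (m n : ℕ) (σ : ℝ) (hσ : 0 < σ) (ω) (w : Fin n → ℝ) (i : Fin m) :
    res m n ω w i = ∑ b, Wmap m n σ ω (i, b) * xw σ w b := by
  simp_rw [mul_comm (Wmap m n σ ω _)]
  rw [xw_dot]; simp [Wmap, res]
  rw [← mul_assoc, mul_inv_cancel₀ hσ.ne', one_mul]; simp_rw [mul_comm]

lemma vn_xw_sub {n : ℕ} (σ : ℝ) (w w' : Fin n → ℝ) : vn (xw σ w - xw σ w') = vn (w - w') := by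
  rw [vn, vn, Fintype.sum_sum_type]; simp [xw]
  congr 1
  exact Finset.sum_congr rfl fun i _ => by ring

/-- matrix-vector bilinear bound -/
lemma bil_le {I K : Type} [Fintype I] [Fintype K] (B : I × K → ℝ) (y : I → ℝ) (x : K → ℝ) :
    ∑ a, ∑ b, B (a, b) * y a * x b ≤ vn B * (vn y * vn x) := by
  have h := dot_le_vn B (fun p => y p.1 * x p.2)
  have e : vn (fun p : I × K => y p.1 * x p.2) = vn y * vn x := by
    rw [vn, vn, vn, ← Real.sqrt_mul (Finset.sum_nonneg fun _ _ => sq_nonneg _), Fintype.sum_prod_type, Finset.sum_mul]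
    congr 1
    refine Finset.sum_congr rfl fun a _ => ?_
    rw [Finset.mul_sum]
    exact Finset.sum_congr rfl fun b _ => by ring
  rw [e, Fintype.sum_prod_type] at h
  refine le_trans (le_of_eq ?_) h
  exact Finset.sum_congr rfl fun a _ => Finset.sum_congr rfl fun b _ => by ring

theorem PL (m n : ℕ) (hm : 0 < m) (σ : ℝ) (hσ : 0 < σ) (S : Set (Fin n → ℝ)) (hS : S.Nonempty) (ρ : ℝ)
    (hρ : ∀ w ∈ S, vn w ≤ ρ) (δ : ℝ) (hδ : 0 < δ) (lam : ℝ) (hl : 0 < lam) (ε : ℝ) (hε : 0 < ε) :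
    ∃ T : Finset (Fin n → ℝ), T.Nonempty ∧ ↑T ⊆ S ∧
      ∀ (c : ℝ) (a₁ a₂ : (Fin m → ℝ) → ℝ) (b₁ b₂ : (Fin n → ℝ) → ℝ),
        Measurable a₁ → Measurable a₂ → Measurable b₁ → Measurable b₂ →
        Integrable a₁ (stdG (Fin m)) → Integrable a₂ (stdG (Fin m)) →
        Integrable b₁ (stdG (Fin n)) → Integrable b₂ (stdG (Fin n)) →
        (∀ g, 0 ≤ a₁ g) → (∀ g, 0 ≤ a₂ g) → (∀ g, 0 ≤ b₁ g) → (∀ g, 0 ≤ b₂ g) →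
        (∀ g h, ∀ w ∈ T, Real.exp (-lam * ((1 - δ) * Real.sqrt (σ ^ 2 + vn w ^ 2) * vn g - ∑ j, w j * h j)) ≤
          a₁ g * b₁ h + a₂ g * b₂ h) →
        (muAv m n σ).real {ω | ∃ w ∈ S, vn (res m n ω w) ≤ c} ≤
          ε + 4 * Real.exp (lam * (c + 1) + lam ^ 2 * σ ^ 2 / 2) *
            ((∫ g, a₁ g ∂(stdG (Fin m))) * (∫ h, b₁ h ∂(stdG (Fin n))) +
              (∫ g, a₂ g ∂(stdG (Fin m))) * (∫ h, b₂ h ∂(stdG (Fin n)))) := by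
  classical
  haveI : Nonempty (Fin m) := ⟨⟨0, hm⟩⟩
  obtain ⟨R, hR0, hR⟩ := exists_large (I := Fin m × (Fin n ⊕ Unit)) ε hε
  obtain ⟨T, hTS, hT⟩ := net_exists S ρ hρ (1 / R) (by positivity)
  obtain ⟨Y, hYne, hY1, -, hYd⟩ := sphere_net (I := Fin m) δ hδ
  have hTne : T.Nonempty := by
    obtain ⟨w, hw⟩ := hS
    obtain ⟨y, hy, -⟩ := hT w hw
    exact ⟨y, hy⟩
  refine ⟨T, hTne, hTS, ?_⟩
  intro c a₁ a₂ b₁ b₂ ma₁ ma₂ mb₁ mb₂ ia₁ ia₂ ib₁ ib₂ pa₁ pa₂ pb₁ pb₂ hyp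
  haveI : Nonempty T := hTne.to_subtype
  haveI : Nonempty Y := hYne.to_subtype
  have ie := integrable_exp_abs_unit (lam * σ)
  have gd := gordon (X := T) (Y := Y) (I := Fin m) (K := Fin n ⊕ Unit) (fun w => xw σ w.1) (fun y => y.1) lam hl (c + 1)
    (fun g h => a₁ g * (b₁ (fun i => h (Sum.inl i)) * Real.exp (lam * σ * |h (Sum.inr ())|)) +
      a₂ g * (b₂ (fun i => h (Sum.inl i)) * Real.exp (lam * σ * |h (Sum.inr ())|)))
    (by
      intro g h w
      obtain ⟨y, hy, hyd⟩ := hYd g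
      refine ⟨⟨y, hy⟩, ?_⟩
      simp only
      rw [hY1 y hy, one_mul, vn_xw, xw_dot]
      have h1 := hyp g (fun i => h (Sum.inl i)) w.1 w.2
      set s := Real.sqrt (σ ^ 2 + vn w.1 ^ 2)
      have hs : 0 ≤ s := Real.sqrt_nonneg _
      calc _ ≤ Real.exp (-lam * ((1 - δ) * s * vn g - ∑ j, w.1 j * h (Sum.inl j))) * Real.exp (lam * σ * |h (Sum.inr ())|) := by
            rw [← Real.exp_add]
            apply Real.exp_le_exp.2
            have q1 := mul_le_mul_of_nonneg_left hyd hs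
            have q2 := neg_abs_le (h (Sum.inr ()))
            have q3 := mul_le_mul_of_nonneg_left q2 hσ.le
            nlinarith
        _ ≤ _ := mul_le_mul_of_nonneg_right h1 (Real.exp_pos _).le
        _ = _ := by ring)
    (by
      fun_prop)
    ((int2i ia₁ (int2i ib₁ ie)).add (int2i ia₂ (int2i ib₂ ie)))
  have hint : ∫ ξ : Fin m ⊕ (Fin n ⊕ Unit) → ℝ, (a₁ (fun i => ξ (Sum.inl i)) * (b₁ (fun i => ξ (Sum.inr (Sum.inl i))) * Real.exp (lam * σ * |ξ (Sum.inr (Sum.inr ()))|)) +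
      a₂ (fun i => ξ (Sum.inl i)) * (b₂ (fun i => ξ (Sum.inr (Sum.inl i))) * Real.exp (lam * σ * |ξ (Sum.inr (Sum.inr ()))|))) ∂(stdG _)
      = ((∫ g, a₁ g ∂(stdG (Fin m))) * (∫ h, b₁ h ∂(stdG (Fin n))) +
              (∫ g, a₂ g ∂(stdG (Fin m))) * (∫ h, b₂ h ∂(stdG (Fin n)))) * ∫ ξ : Unit → ℝ, Real.exp (lam * σ * |ξ ()|) ∂(stdG Unit) := by
    have me : Measurable fun ξ : Unit → ℝ => Real.exp (lam * σ * |ξ ()|) := by fun_prop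
    have f1 := int_sum_mul (κ₁ := Fin n) (κ₂ := Unit) b₁ _ mb₁ me
    have f2 := int_sum_mul (κ₁ := Fin n) (κ₂ := Unit) b₂ _ mb₂ me
    have e1 := int_sum_mul (κ₁ := Fin m) (κ₂ := Fin n ⊕ Unit) a₁ (fun h => b₁ (fun i => h (Sum.inl i)) * Real.exp (lam * σ * |h (Sum.inr ())|)) ma₁ (by fun_prop)
    have e2 := int_sum_mul (κ₁ := Fin m) (κ₂ := Fin n ⊕ Unit) a₂ (fun h => b₂ (fun i => h (Sum.inl i)) * Real.exp (lam * σ * |h (Sum.inr ())|)) ma₂ (by fun_prop)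
    rw [f1] at e1; rw [f2] at e2
    rw [integral_add (int2i ia₁ (int2i ib₁ ie)) (int2i ia₂ (int2i ib₂ ie)), e1, e2]; ring
  rw [hint] at gd
  have hnn : 0 ≤ ((∫ g, a₁ g ∂(stdG (Fin m))) * (∫ h, b₁ h ∂(stdG (Fin n))) +
              (∫ g, a₂ g ∂(stdG (Fin m))) * (∫ h, b₂ h ∂(stdG (Fin n)))) :=
    add_nonneg (mul_nonneg (integral_nonneg pa₁) (integral_nonneg pb₁)) (mul_nonneg (integral_nonneg pa₂) (integral_nonneg pb₂))
  set Q := ((∫ g, a₁ g ∂(stdG (Fin m))) * (∫ h, b₁ h ∂(stdG (Fin n))) +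
              (∫ g, a₂ g ∂(stdG (Fin m))) * (∫ h, b₂ h ∂(stdG (Fin n))))
  set E1 : Set (Fin m × (Fin n ⊕ Unit) → ℝ) := {B | R < vn B}
  set E2 : Set (Fin m × (Fin n ⊕ Unit) → ℝ) := {B | ∃ x : T, ∀ y : Y, ∑ a, ∑ b, B (a, b) * y.1 a * xw σ x.1 b ≤ c + 1}
  have mE1 : MeasurableSet E1 := measurableSet_lt measurable_const meas_vn
  have mE2 : MeasurableSet E2 := by
    have : E2 = ⋃ x : T, ⋂ y : Y, {B | ∑ a, ∑ b, B (a, b) * y.1 a * xw σ x.1 b ≤ c + 1} := by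
      ext B; simp only [Set.mem_iUnion, Set.mem_iInter]; rfl
    rw [this]
    exact MeasurableSet.iUnion fun x => MeasurableSet.iInter fun y => measurableSet_le (by fun_prop) measurable_const
  have hsub : {ω | ∃ w ∈ S, vn (res m n ω w) ≤ c} ⊆ Wmap m n σ ⁻¹' (E1 ∪ E2) := by
    rintro ω ⟨w, hw, hc⟩
    by_cases hB : R < vn (Wmap m n σ ω)
    · exact Or.inl hB
    · right
      push Not at hB
      obtain ⟨w', hw', hd⟩ := hT w hw
      refine ⟨⟨w', hw'⟩, fun y => ?_⟩
      have e1 : ∑ a, ∑ b, Wmap m n σ ω (a, b) * y.1 a * xw σ w' b =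
          (∑ a, y.1 a * res m n ω w a) + ∑ a, ∑ b, Wmap m n σ ω (a, b) * y.1 a * (xw σ w' - xw σ w) b := by
        simp_rw [res_eq m n σ hσ, Finset.mul_sum, ← Finset.sum_add_distrib]
        refine Finset.sum_congr rfl fun a _ => Finset.sum_congr rfl fun b _ => ?_
        simp only [Pi.sub_apply]; ring
      have h1 := dot_le_vn y.1 (res m n ω w)
      have h2 := bil_le (Wmap m n σ ω) y.1 (xw σ w' - xw σ w)
      rw [hY1 _ y.2, one_mul] at h1 h2
      rw [vn_xw_sub, vn_sub_comm] at h2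
      show _ ≤ _
      rw [e1]
      have h3 : vn (Wmap m n σ ω) * vn (w - w') ≤ R * (1 / R) := mul_le_mul hB hd (vn_nonneg _) hR0.le
      rw [mul_one_div_cancel hR0.ne'] at h3
      linarith
  have hmp := (mp_Wmap m n σ hσ)
  have hpre : ∀ E, MeasurableSet E → (muAv m n σ).real (Wmap m n σ ⁻¹' E) = (stdG (Fin m × (Fin n ⊕ Unit))).real E := by
    intro E hE
    simp only [Measure.real, hmp.measure_preimage hE.nullMeasurableSet]
  calc _ ≤ (muAv m n σ).real (Wmap m n σ ⁻¹' (E1 ∪ E2)) := measureReal_mono hsub (by finiteness)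
    _ = _ := hpre _ (mE1.union mE2)
    _ ≤ (stdG _).real E1 + (stdG _).real E2 := measureReal_union_le _ _
    _ ≤ ε + 2 * Real.exp (lam * (c + 1)) * (Q * (2 * Real.exp ((lam * σ) ^ 2 / 2))) := by
        refine add_le_add hR (gd.trans ?_)
        gcongr
        exact int_exp_abs_unit _
    _ = _ := by rw [Real.exp_add, mul_pow]; ring

theorem PU (m n : ℕ) (hm : 0 < m) (σ : ℝ) (hσ : 0 < σ) (Y : Finset (Fin n → ℝ)) (hYne : Y.Nonempty)
    (lam : ℝ) (hl : 0 < lam) (ε : ℝ) (hε : 0 < ε) (c : ℝ) (a : (Fin m → ℝ) → ℝ) (b : (Fin n → ℝ) → ℝ)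
    (ma : Measurable a) (mb : Measurable b) (ia : Integrable a (stdG (Fin m))) (ib : Integrable b (stdG (Fin n)))
    (pa : ∀ g, 0 ≤ a g) (pb : ∀ g, 0 ≤ b g)
    (hyp : ∀ g h, ∃ w ∈ Y, Real.exp (lam * (Real.sqrt (σ ^ 2 + vn w ^ 2) * vn g - ∑ j, w j * h j)) ≤ a g * b h) :
    (muAv m n σ).real {ω | ∃ u, vn u = 1 ∧ ∀ w ∈ Y, c ≤ ∑ i, u i * res m n ω w i} ≤
          ε + 4 * Real.exp (-lam * (c - 1) + lam ^ 2 * σ ^ 2 / 2) *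
            ((∫ g, a g ∂(stdG (Fin m))) * (∫ h, b h ∂(stdG (Fin n)))) := by
  classical
  haveI : Nonempty (Fin m) := ⟨⟨0, hm⟩⟩
  obtain ⟨R, hR0, hR⟩ := exists_large (I := Fin m × (Fin n ⊕ Unit)) ε hε
  set M : ℝ := ∑ w ∈ Y, vn (xw σ w) with hM
  have hM0 : 0 ≤ M := Finset.sum_nonneg fun _ _ => vn_nonneg _
  have hMle : ∀ w ∈ Y, vn (xw σ w) ≤ M := fun w hw =>
    Finset.single_le_sum (f := fun w => vn (xw σ w)) (fun _ _ => vn_nonneg _) hw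
  obtain ⟨U, hUne, hU1, hUn, -⟩ := sphere_net (I := Fin m) (1 / (R * (M + 1))) (by positivity)
  haveI : Nonempty Y := hYne.to_subtype
  haveI : Nonempty U := hUne.to_subtype
  have ie := integrable_exp_abs_unit (lam * σ)
  have gd := gordon (X := U) (Y := Y) (I := Fin n ⊕ Unit) (K := Fin m) (fun u => u.1) (fun w => - xw σ w.1) lam hl (-(c - 1))
    (fun g h => (b (fun i => g (Sum.inl i)) * Real.exp (lam * σ * |g (Sum.inr ())|)) * a h)
    (by
      intro g h u
      obtain ⟨w, hw, hwd⟩ := hyp h (fun i => g (Sum.inl i))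
      refine ⟨⟨w, hw⟩, ?_⟩
      simp only
      have e1 : ∑ a, (-xw σ w) a * g a = -(∑ a, xw σ w a * g a) := by
        simp [Finset.sum_neg_distrib]
      rw [hU1 _ u.2, one_mul, e1, xw_dot, vn_neg, vn_xw]
      set s := Real.sqrt (σ ^ 2 + vn w ^ 2)
      have hs : 0 ≤ s := Real.sqrt_nonneg _
      have h1 := dot_le_vn (-u.1) h
      rw [vn_neg, hU1 _ u.2, one_mul] at h1
      have e2 : ∑ i, (-u.1) i * h i = -(∑ i, u.1 i * h i) := by
        simp [Finset.sum_neg_distrib]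
      rw [e2] at h1
      calc _ ≤ Real.exp (lam * (s * vn h - ∑ j, w j * g (Sum.inl j))) * Real.exp (lam * σ * |g (Sum.inr ())|) := by
            rw [← Real.exp_add]
            apply Real.exp_le_exp.2
            have q1 := mul_le_mul_of_nonneg_left h1 hs
            have q2 := le_abs_self (g (Sum.inr ()))
            have q3 := mul_le_mul_of_nonneg_left q2 hσ.le
            nlinarith
        _ ≤ _ := mul_le_mul_of_nonneg_right hwd (Real.exp_pos _).le
        _ = _ := by ring)
    (by
      fun_prop)
    (int2i (int2i ib ie) ia)
  have hint : ∫ ξ : (Fin n ⊕ Unit) ⊕ Fin m → ℝ, (b (fun i => ξ (Sum.inl (Sum.inl i))) * Real.exp (lam * σ * |ξ (Sum.inl (Sum.inr ()))|)) * a (fun i => ξ (Sum.inr i)) ∂(stdG _)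
      = ((∫ g, a g ∂(stdG (Fin m))) * (∫ h, b h ∂(stdG (Fin n)))) * ∫ ξ : Unit → ℝ, Real.exp (lam * σ * |ξ ()|) ∂(stdG Unit) := by
    have me : Measurable fun ξ : Unit → ℝ => Real.exp (lam * σ * |ξ ()|) := by fun_prop
    have f1 := int_sum_mul (κ₁ := Fin n) (κ₂ := Unit) b _ mb me
    have e1 := int_sum_mul (κ₁ := Fin n ⊕ Unit) (κ₂ := Fin m) (fun h => b (fun i => h (Sum.inl i)) * Real.exp (lam * σ * |h (Sum.inr ())|)) a (by fun_prop) ma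
    rw [f1] at e1
    rw [e1]; ring
  rw [hint] at gd
  have hnn : 0 ≤ ((∫ g, a g ∂(stdG (Fin m))) * (∫ h, b h ∂(stdG (Fin n)))) :=
    (mul_nonneg (integral_nonneg pa) (integral_nonneg pb))
  set Q := ((∫ g, a g ∂(stdG (Fin m))) * (∫ h, b h ∂(stdG (Fin n))))
  set E1 : Set (Fin m × (Fin n ⊕ Unit) → ℝ) := {B | R < vn B}
  set E2 : Set ((Fin n ⊕ Unit) × Fin m → ℝ) := {B | ∃ x : U, ∀ y : Y, ∑ a, ∑ b, B (a, b) * (-xw σ y.1) a * x.1 b ≤ -(c - 1)}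
  have mE1 : MeasurableSet E1 := measurableSet_lt measurable_const meas_vn
  have mE2 : MeasurableSet E2 := by
    have : E2 = ⋃ x : U, ⋂ y : Y, {B | ∑ a, ∑ b, B (a, b) * (-xw σ y.1) a * x.1 b ≤ -(c - 1)} := by
      ext B; simp only [Set.mem_iUnion, Set.mem_iInter]; rfl
    rw [this]
    exact MeasurableSet.iUnion fun x => MeasurableSet.iInter fun y => measurableSet_le (by fun_prop) measurable_const
  have hmp := (mp_Wmap m n σ hσ)
  have hmp2 := (mp_reindex (Equiv.prodComm (Fin n ⊕ Unit) (Fin m))).comp hmp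
  have hsub : {ω | ∃ u, vn u = 1 ∧ ∀ w ∈ Y, c ≤ ∑ i, u i * res m n ω w i} ⊆ Wmap m n σ ⁻¹' E1 ∪
      ((fun ξ : Fin m × (Fin n ⊕ Unit) → ℝ => fun j => ξ (Equiv.prodComm (Fin n ⊕ Unit) (Fin m) j)) ∘ Wmap m n σ) ⁻¹' E2 := by
    rintro ω ⟨u, hu, hc⟩
    by_cases hB : R < vn (Wmap m n σ ω)
    · exact Or.inl hB
    · right
      push Not at hB
      obtain ⟨u', hu', hd⟩ := hUn u hu
      refine ⟨⟨u', hu'⟩, fun w => ?_⟩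
      show ∑ a, ∑ b, Wmap m n σ ω (b, a) * (-xw σ w.1) a * u' b ≤ -(c - 1)
      have e1 : ∑ a, ∑ b, Wmap m n σ ω (b, a) * (-xw σ w.1) a * u' b =
          -(∑ a, u a * res m n ω w a) + ∑ a, ∑ b, Wmap m n σ ω (a, b) * (u - u') a * (xw σ w.1) b := by
        rw [Finset.sum_comm]
        simp_rw [res_eq m n σ hσ, Finset.mul_sum, ← Finset.sum_neg_distrib, ← Finset.sum_add_distrib]
        refine Finset.sum_congr rfl fun a _ => Finset.sum_congr rfl fun b _ => ?_
        simp only [Pi.sub_apply, Pi.neg_apply]; ring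
      have h1 := hc w.1 w.2
      have h2 := bil_le (Wmap m n σ ω) (u - u') (xw σ w.1)
      rw [e1]
      have h3 : vn (u - u') * vn (xw σ w.1) ≤ 1 / (R * (M + 1)) * (M + 1) :=
        mul_le_mul hd ((hMle _ w.2).trans (by linarith)) (vn_nonneg _) (by positivity)
      have h4 : vn (Wmap m n σ ω) * (vn (u - u') * vn (xw σ w.1)) ≤ R * (1 / (R * (M + 1)) * (M + 1)) :=
        mul_le_mul hB h3 (mul_nonneg (vn_nonneg _) (vn_nonneg _)) hR0.le
      have h5 : R * (1 / (R * (M + 1)) * (M + 1)) = 1 := by field_simp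
      linarith
  calc _ ≤ (muAv m n σ).real _ := measureReal_mono hsub (by finiteness)
    _ ≤ (muAv m n σ).real (Wmap m n σ ⁻¹' E1) + (muAv m n σ).real _ := measureReal_union_le _ _
    _ = (stdG _).real E1 + (stdG _).real E2 := by
        simp only [Measure.real, hmp.measure_preimage mE1.nullMeasurableSet, hmp2.measure_preimage mE2.nullMeasurableSet]
    _ ≤ ε + 2 * Real.exp (lam * -(c - 1)) * (Q * (2 * Real.exp ((lam * σ) ^ 2 / 2))) := by
        refine add_le_add hR (gd.trans ?_)
        gcongr
        exact int_exp_abs_unit _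
    _ = _ := by rw [Real.exp_add, mul_pow]; ring_nf

lemma integrable_of_pdf_mul {f : ℝ → ℝ} (h : Integrable (fun x => gaussianPDFReal 0 1 x * f x)) :
    Integrable f (gaussianReal 0 1) := by
  rw [gaussianReal_of_var_ne_zero _ (by simp : (1:NNReal) ≠ 0)]
  rw [integrable_withDensity_iff_integrable_smul' (measurable_gaussianPDF _ _)
    (Filter.Eventually.of_forall fun x => gaussianPDF_lt_top)]
  simpa [toReal_gaussianPDF] using h

lemma pdf_std (x : ℝ) : gaussianPDFReal 0 1 x = (Real.sqrt (2 * Real.pi))⁻¹ * Real.exp (-x ^ 2 / 2) := by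
  simp [gaussianPDFReal]

lemma int_exp_quad : Integrable (fun x : ℝ => Real.exp ((1 + x ^ 2) / 4)) (gaussianReal 0 1) := by
  apply integrable_of_pdf_mul
  have := (integrable_exp_neg_mul_sq (by norm_num : (0:ℝ) < 1/4)).const_mul ((Real.sqrt (2 * Real.pi))⁻¹ * Real.exp (1/4))
  refine this.congr (Filter.Eventually.of_forall fun x => ?_)
  simp only [pdf_std]
  rw [mul_assoc, mul_assoc, ← Real.exp_add, ← Real.exp_add]
  congr 2; ring

def QG (ψ : ℝ → ℝ) : Prop := Measurable ψ ∧ ∃ C, ∀ x, |ψ x| ≤ C * (1 + x ^ 2)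

lemma sq_le_two_exp (u : ℝ) (hu : 0 ≤ u) : u ^ 2 ≤ 2 * Real.exp u := by
  have := Real.quadratic_le_exp_of_nonneg hu
  nlinarith

lemma exp_le_quad (u : ℝ) : Real.exp u ≤ 1 + u + u ^ 2 * Real.exp |u| := by
  have h2 := Complex.norm_exp_sub_sum_le_norm_mul_exp (u : ℂ) 2
  have e : Complex.exp (u : ℂ) - ∑ m ∈ Finset.range 2, (u:ℂ) ^ m / (m.factorial : ℂ) = ((Real.exp u - (1 + u) : ℝ) : ℂ) := by
    simp [Finset.sum_range_succ]
  rw [e, Complex.norm_real, Complex.norm_real, Real.norm_eq_abs, Real.norm_eq_abs, sq_abs] at h2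
  have := (abs_le.1 h2).2
  linarith

lemma QG.integrable {ψ : ℝ → ℝ} (h : QG ψ) : Integrable ψ (gaussianReal 0 1) := by
  obtain ⟨hm, C, hC⟩ := h
  refine (int_exp_quad.const_mul (|C| * 4)).mono' hm.aestronglyMeasurable (Filter.Eventually.of_forall fun x => (hC x).trans ?_)
  have h1 := Real.add_one_le_exp ((1 + x ^ 2) / 4)
  have h2 : C * (1 + x ^ 2) ≤ |C| * (1 + x ^ 2) := by gcongr; exact le_abs_self C
  have h3 : |C| * (1 + x^2) ≤ |C| * (4 * Real.exp ((1 + x ^ 2) / 4)) := by gcongr; linarith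
  linarith

lemma mgf1 {ψ : ℝ → ℝ} (h : QG ψ) (η : ℝ) (hη : 0 < η) : ∃ θ₀ > 0, ∀ θ, 0 ≤ θ → θ ≤ θ₀ →
    Integrable (fun x => Real.exp (θ * ψ x)) (gaussianReal 0 1) ∧
    ∫ x, Real.exp (θ * ψ x) ∂(gaussianReal 0 1) ≤ Real.exp (θ * ((∫ x, ψ x ∂(gaussianReal 0 1)) + η)) := by
  have hi := h.integrable
  obtain ⟨hm, C, hC⟩ := h
  have hC0 : 0 ≤ C := by have := (abs_nonneg _).trans (hC 0); simpa using this
  set M := ∫ x : ℝ, C ^ 2 * 128 * Real.exp ((1 + x ^ 2) / 4) ∂(gaussianReal 0 1)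
  have hM : 0 ≤ M := integral_nonneg fun x => by positivity
  have hMi := int_exp_quad.const_mul (C ^ 2 * 128)
  refine ⟨min (1 / (8 * (C + 1))) (η / (M + 1)), by positivity, fun θ h0 h1 => ?_⟩
  have hθ1 : θ * C ≤ 1 / 8 := by
    have := h1.trans (min_le_left _ _)
    rw [le_div_iff₀ (by positivity)] at this
    nlinarith
  have hθ2 : θ * M ≤ η := by
    have := h1.trans (min_le_right _ _)
    rw [le_div_iff₀ (by positivity)] at this
    nlinarith
  have key : ∀ x, Real.exp (θ * ψ x) ≤ 1 + θ * ψ x + θ ^ 2 * (C ^ 2 * 128 * Real.exp ((1 + x ^ 2) / 4)) := by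
    intro x
    have e1 := exp_le_quad (θ * ψ x)
    have e2 : |θ * ψ x| ≤ (1 + x ^ 2) / 8 := by
      rw [abs_mul, abs_of_nonneg h0]
      have := mul_le_mul_of_nonneg_left (hC x) h0
      nlinarith [sq_nonneg x]
    have e3 : ψ x ^ 2 ≤ C ^ 2 * (1 + x ^ 2) ^ 2 := by
      rw [← mul_pow, ← sq_abs]; gcongr; exact hC x
    have e4 := sq_le_two_exp ((1 + x ^ 2) / 8) (by positivity)
    have e5 : Real.exp ((1 + x ^ 2) / 4) = Real.exp ((1 + x ^ 2) / 8) * Real.exp ((1 + x ^ 2) / 8) := by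
      rw [← Real.exp_add]; congr 1; ring
    have e6 : ψ x ^ 2 * Real.exp |θ * ψ x| ≤ C ^ 2 * 128 * Real.exp ((1 + x ^ 2) / 4) := by
      calc _ ≤ (C ^ 2 * (1 + x ^ 2) ^ 2) * Real.exp ((1 + x ^ 2) / 8) := by gcongr
        _ ≤ (C ^ 2 * (128 * Real.exp ((1 + x ^ 2) / 8))) * Real.exp ((1 + x ^ 2) / 8) := by
            gcongr; nlinarith
        _ = _ := by rw [e5]; ring
    have := mul_le_mul_of_nonneg_left e6 (sq_nonneg θ)
    have : (θ * ψ x) ^ 2 * Real.exp |θ * ψ x| = θ ^ 2 * (ψ x ^ 2 * Real.exp |θ * ψ x|) := by ring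
    linarith
  have hbi : Integrable (fun x => 1 + θ * ψ x + θ ^ 2 * (C ^ 2 * 128 * Real.exp ((1 + x ^ 2) / 4))) (gaussianReal 0 1) :=
    ((integrable_const 1).add (hi.const_mul θ)).add (hMi.const_mul _)
  have hint : Integrable (fun x => Real.exp (θ * ψ x)) (gaussianReal 0 1) :=
    hbi.mono' (by fun_prop) (Filter.Eventually.of_forall fun x => by
      rw [Real.norm_eq_abs, Real.abs_exp]; exact key x)
  refine ⟨hint, ?_⟩
  calc _ ≤ ∫ x, (1 + θ * ψ x + θ ^ 2 * (C ^ 2 * 128 * Real.exp ((1 + x ^ 2) / 4))) ∂(gaussianReal 0 1) :=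
        integral_mono hint hbi key
    _ = 1 + θ * (∫ x, ψ x ∂(gaussianReal 0 1)) + θ ^ 2 * M := by
        rw [integral_add (f := fun x => 1 + θ * ψ x) ((integrable_const 1).add (hi.const_mul θ)) (hMi.const_mul _),
          integral_add (integrable_const 1) (hi.const_mul θ), integral_const_mul, integral_const_mul]
        simp [M]
    _ ≤ 1 + θ * ((∫ x, ψ x ∂(gaussianReal 0 1)) + η) := by nlinarith
    _ ≤ _ := by linarith [Real.add_one_le_exp (θ * ((∫ x, ψ x ∂(gaussianReal 0 1)) + η))]

lemma int_exp_sum {n : ℕ} (f : Fin n → ℝ → ℝ) :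
    ∫ h, Real.exp (∑ i, f i (h i)) ∂(stdG (Fin n)) = ∏ i, ∫ x, Real.exp (f i x) ∂(gaussianReal 0 1) := by
  simp_rw [Real.exp_sum]
  exact integral_fintype_prod_eq_prod (μ := fun _ : Fin n => gaussianReal 0 1) (fun i x => Real.exp (f i x))

lemma integrable_exp_sum' {n : ℕ} (f : Fin n → ℝ → ℝ) (hf : ∀ i, Integrable (fun x => Real.exp (f i x)) (gaussianReal 0 1)) :
    Integrable (fun h : Fin n → ℝ => Real.exp (∑ i, f i (h i))) (stdG (Fin n)) := by
  simp_rw [Real.exp_sum]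
  exact Integrable.fintype_prod (μ := fun _ : Fin n => gaussianReal 0 1) (f := fun i x => Real.exp (f i x)) hf

/-- two-class sum -/
noncomputable def Psi (n k : ℕ) (ψ₁ ψ₂ : ℝ → ℝ) (h : Fin n → ℝ) : ℝ :=
  ∑ i : Fin n, (if n - k ≤ (i : ℕ) then ψ₁ else ψ₂) (h i)

noncomputable def EG1 (ψ : ℝ → ℝ) : ℝ := ∫ x, ψ x ∂(gaussianReal 0 1)

lemma measurable_Psi {n k : ℕ} {ψ₁ ψ₂ : ℝ → ℝ} (h1 : Measurable ψ₁) (h2 : Measurable ψ₂) : Measurable (Psi n k ψ₁ ψ₂) := by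
  unfold Psi
  refine Finset.measurable_sum _ fun i _ => ?_
  split_ifs <;> fun_prop

lemma card_S (n k : ℕ) (hk : k ≤ n) : (Finset.univ.filter fun i : Fin n => n - k ≤ (i : ℕ)).card = k := by
  have h := Finset.card_filter_add_card_filter_not (s := (Finset.univ : Finset (Fin n))) (fun i : Fin n => (i : ℕ) < n - k)
  rw [Fin.card_filter_val_lt] at h
  simp only [not_lt, Finset.card_univ, Fintype.card_fin] at h
  omega

lemma kDim_le (β : ℝ) (hβ : β < 1) (n : ℕ) : kDim β n ≤ n := by
  unfold kDim
  refine Nat.ceil_le.2 ?_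
  nlinarith [Nat.cast_nonneg (α := ℝ) n]

lemma mgf_Psi0 (n k : ℕ) (hk : k ≤ n) {ψ₁ ψ₂ : ℝ → ℝ} (θ c₁ c₂ : ℝ)
    (A1 : Integrable (fun x => Real.exp (θ * ψ₁ x)) (gaussianReal 0 1) ∧ ∫ x, Real.exp (θ * ψ₁ x) ∂(gaussianReal 0 1) ≤ Real.exp (θ * c₁))
    (A2 : Integrable (fun x => Real.exp (θ * ψ₂ x)) (gaussianReal 0 1) ∧ ∫ x, Real.exp (θ * ψ₂ x) ∂(gaussianReal 0 1) ≤ Real.exp (θ * c₂)) :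
    Integrable (fun h => Real.exp (θ * Psi n k ψ₁ ψ₂ h)) (stdG (Fin n)) ∧
    ∫ h, Real.exp (θ * Psi n k ψ₁ ψ₂ h) ∂(stdG (Fin n)) ≤ Real.exp (k * (θ * c₁) + (n - k) * (θ * c₂)) := by
  have e : (fun h : Fin n → ℝ => Real.exp (θ * Psi n k ψ₁ ψ₂ h)) = fun h =>
      Real.exp (∑ i, (fun (i : Fin n) x => θ * (if n - k ≤ (i : ℕ) then ψ₁ else ψ₂) x) i (h i)) := by
    funext h; rw [Psi, Finset.mul_sum]
  rw [e]
  refine ⟨integrable_exp_sum' (fun (i : Fin n) x => θ * (if n - k ≤ (i : ℕ) then ψ₁ else ψ₂) x) fun i => ?_, ?_⟩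
  · by_cases hc : n - k ≤ (i:ℕ)
    · simp only [if_pos hc]; exact A1.1
    · simp only [if_neg hc]; exact A2.1
  rw [int_exp_sum (fun (i : Fin n) x => θ * (if n - k ≤ (i : ℕ) then ψ₁ else ψ₂) x)]
  calc _ ≤ ∏ i : Fin n, Real.exp (if n - k ≤ (i : ℕ) then θ * c₁ else θ * c₂) := by
        refine Finset.prod_le_prod (fun i _ => integral_nonneg fun x => (Real.exp_pos _).le) fun i _ => ?_
        by_cases hc : n - k ≤ (i:ℕ)
        · simp only [if_pos hc]; exact A1.2
        · simp only [if_neg hc]; exact A2.2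
    _ = _ := by
        rw [← Real.exp_sum, Finset.sum_ite]
        congr 1
        have c1 := card_S n k hk
        have c2 : ((Finset.univ.filter fun i : Fin n => ¬ n - k ≤ (i : ℕ)).card : ℝ) = n - k := by
          have h := Finset.card_filter_add_card_filter_not (s := (Finset.univ : Finset (Fin n))) (fun i : Fin n => n - k ≤ (i : ℕ))
          rw [c1] at h
          simp only [Finset.card_univ, Fintype.card_fin] at h
          rw [eq_sub_iff_add_eq, add_comm]; exact_mod_cast h
        simp only [Finset.sum_const, nsmul_eq_mul, c1, c2]

lemma class_arith (e₁ e₂ β η n k θ : ℝ) (h0 : 0 ≤ θ) (hk1 : β * n ≤ k) (hk2 : k ≤ β * n + 1)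
    (hn' : 2 * (|e₁| + |e₂|) ≤ η * n) :
    k * (θ * (e₁ + η / 2)) + (n - k) * (θ * (e₂ + η / 2)) ≤ θ * (n * (β * e₁ + (1 - β) * e₂ + η)) := by
  have q : k * (θ * (e₁ + η / 2)) + (n - k) * (θ * (e₂ + η / 2)) =
    θ * (n * (β * e₁ + (1 - β) * e₂ + η / 2) + (k - β * n) * (e₁ - e₂)) := by ring
  rw [q]
  refine mul_le_mul_of_nonneg_left ?_ h0
  have : (k - β * n) * (e₁ - e₂) ≤ |e₁| + |e₂| := by
    calc _ ≤ |(k - β * n) * (e₁ - e₂)| := le_abs_self _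
      _ = (k - β * n) * |e₁ - e₂| := by rw [abs_mul, abs_of_nonneg (by linarith)]
      _ ≤ 1 * |e₁ - e₂| := by gcongr; linarith
      _ ≤ _ := by rw [one_mul]; exact abs_sub _ _
  nlinarith

lemma mgf_Psi {ψ₁ ψ₂ : ℝ → ℝ} (h₁ : QG ψ₁) (h₂ : QG ψ₂) (β : ℝ) (hβ0 : 0 < β) (hβ : β < 1) (η : ℝ) (hη : 0 < η) :
    ∃ θ₀ > (0:ℝ), ∃ N : ℕ, ∀ n ≥ N, ∀ θ : ℝ, 0 ≤ θ → θ ≤ θ₀ →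
      Integrable (fun h => Real.exp (θ * Psi n (kDim β n) ψ₁ ψ₂ h)) (stdG (Fin n)) ∧
      ∫ h, Real.exp (θ * Psi n (kDim β n) ψ₁ ψ₂ h) ∂(stdG (Fin n)) ≤
        Real.exp (θ * (n * (β * EG1 ψ₁ + (1 - β) * EG1 ψ₂ + η))) := by
  obtain ⟨θ₁, ht1, H1⟩ := mgf1 h₁ (η / 2) (by linarith)
  obtain ⟨θ₂, ht2, H2⟩ := mgf1 h₂ (η / 2) (by linarith)
  obtain ⟨N, hN⟩ := exists_nat_ge (2 * (|EG1 ψ₁| + |EG1 ψ₂|) / η)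
  refine ⟨min θ₁ θ₂, lt_min ht1 ht2, N, fun n hn θ h0 hθ => ?_⟩
  have A1 := H1 θ h0 (hθ.trans (min_le_left _ _))
  have A2 := H2 θ h0 (hθ.trans (min_le_right _ _))
  have B := mgf_Psi0 n (kDim β n) (kDim_le β hβ n) θ (EG1 ψ₁ + η / 2) (EG1 ψ₂ + η / 2) A1 A2
  refine ⟨B.1, B.2.trans (Real.exp_le_exp.2 ?_)⟩
  refine class_arith _ _ _ _ _ _ _ h0 (Nat.le_ceil _) (Nat.ceil_lt_add_one (by positivity)).le ?_
  rw [div_le_iff₀ hη] at hN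
  have : (N:ℝ) ≤ n := by exact_mod_cast hn
  nlinarith

lemma tail_Psi {ψ₁ ψ₂ : ℝ → ℝ} (h₁ : QG ψ₁) (h₂ : QG ψ₂) (β : ℝ) (hβ0 : 0 < β) (hβ : β < 1) (M : ℝ)
    (hM : β * EG1 ψ₁ + (1 - β) * EG1 ψ₂ < M) :
    ∃ c > 0, ∃ N : ℕ, ∀ n ≥ N,
      (stdG (Fin n)).real {h | n * M ≤ Psi n (kDim β n) ψ₁ ψ₂ h} ≤ Real.exp (-(c * n)) := by
  set η := (M - (β * EG1 ψ₁ + (1 - β) * EG1 ψ₂)) / 2 with hηd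
  have hη : 0 < η := by linarith
  obtain ⟨θ, hθ, N, H⟩ := mgf_Psi h₁ h₂ β hβ0 hβ η hη
  refine ⟨θ * η, by positivity, N, fun n hn => ?_⟩
  obtain ⟨hi, hb⟩ := H n hn θ hθ.le le_rfl
  have hm := mul_meas_ge_le_integral_of_nonneg (Filter.Eventually.of_forall fun ξ => (Real.exp_pos _).le) hi (Real.exp (θ * (n * M)))
  have hsub : {h | n * M ≤ Psi n (kDim β n) ψ₁ ψ₂ h} ⊆ {h | Real.exp (θ * (n * M)) ≤ Real.exp (θ * Psi n (kDim β n) ψ₁ ψ₂ h)} := by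
    intro h hh
    exact Real.exp_le_exp.2 (mul_le_mul_of_nonneg_left hh hθ.le)
  have h2 := measureReal_mono hsub (μ := stdG (Fin n)) (by finiteness)
  have h3 := (mul_le_mul_of_nonneg_left h2 (Real.exp_pos (θ * (n * M))).le).trans (hm.trans hb)
  rw [← le_div_iff₀' (Real.exp_pos _), ← Real.exp_sub] at h3
  refine h3.trans (Real.exp_le_exp.2 (le_of_eq ?_))
  rw [hηd]; ring

noncomputable def Qg (l : ℝ) : ℝ := ∫ x in Set.Ioi l, gaussianPDFReal 0 1 x

lemma int_pdf_quad (a b c : ℝ) : Integrable (fun x : ℝ => gaussianPDFReal 0 1 x * (a * x ^ 2 + b * x + c)) := by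
  apply integrable_pdf_mul
  refine QG.integrable ⟨by fun_prop, |a| + |b| + |c|, fun x => ?_⟩
  have h1 : |a * x ^ 2 + b * x + c| ≤ |a| * x ^ 2 + |b| * |x| + |c| := by
    refine (abs_add_le _ _).trans (add_le_add ((abs_add_le _ _).trans (le_of_eq ?_)) le_rfl)
    rw [abs_mul, abs_mul, abs_of_nonneg (sq_nonneg x)]
  have h2 : |x| ≤ 1 + x ^ 2 := by nlinarith [sq_abs x, sq_nonneg (|x| - 1)]
  have h3 := mul_le_mul_of_nonneg_left h2 (abs_nonneg b)
  nlinarith [abs_nonneg a, abs_nonneg c, sq_nonneg x, mul_nonneg (abs_nonneg c) (sq_nonneg x)]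

lemma Ioi_quad (l a b c : ℝ) : ∫ x in Set.Ioi l, gaussianPDFReal 0 1 x * (a * x ^ 2 + b * x + c) =
    (a * l + b) * gaussianPDFReal 0 1 l + (a + c) * Qg l := by
  have hd : ∀ x, HasDerivAt (fun x => -(a * x + b) * gaussianPDFReal 0 1 x)
      (gaussianPDFReal 0 1 x * (a * x ^ 2 + b * x + (-a))) x := by
    intro x
    have h1 : HasDerivAt (fun x : ℝ => -(a * x + b)) (-a) x := by
      have := (((hasDerivAt_id x).const_mul a).add_const b).neg
      exact this.congr_deriv (by simp)
    refine (h1.mul (hasDerivAt_pdf x)).congr_deriv ?_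
    ring
  have i1 := (int_pdf_quad a b (-a)).integrableOn (s := Set.Ioi l)
  have i0 : IntegrableOn (fun x => -(a * x + b) * gaussianPDFReal 0 1 x) (Set.Ioi l) := by
    refine ((int_pdf_quad 0 (-a) (-b)).congr (Filter.Eventually.of_forall fun x => ?_)).integrableOn
    simp only; ring
  have hz := tendsto_zero_of_hasDerivAt_of_integrableOn_Ioi (fun x _ => hd x) i1 i0
  have h := integral_Ioi_of_hasDerivAt_of_tendsto' (fun x _ => hd x) i1 hz
  have e : ∀ x : ℝ, gaussianPDFReal 0 1 x * (a * x ^ 2 + b * x + c) =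
      gaussianPDFReal 0 1 x * (a * x ^ 2 + b * x + (-a)) + (a + c) * gaussianPDFReal 0 1 x := fun x => by ring
  simp_rw [e]
  rw [integral_add i1 (((integrable_gaussianPDFReal 0 1).const_mul (a + c)).integrableOn), h, integral_const_mul]
  unfold Qg; ring

lemma EG1_plus (l a b c : ℝ) (ψ : ℝ → ℝ) (h1 : ∀ x, l < x → ψ x = a * x ^ 2 + b * x + c) (h2 : ∀ x, x ≤ l → ψ x = 0) :
    EG1 ψ = (a * l + b) * gaussianPDFReal 0 1 l + (a + c) * Qg l := by
  rw [← Ioi_quad, EG1, integral_gaussianReal_eq_integral_smul (by simp), ← integral_indicator measurableSet_Ioi]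
  congr 1
  funext x
  by_cases hx : l < x
  · rw [Set.indicator_of_mem (Set.mem_Ioi.2 hx), h1 x hx, smul_eq_mul]
  · rw [Set.indicator_of_notMem (fun h => hx (Set.mem_Ioi.1 h)), h2 x (not_lt.1 hx), smul_zero]

lemma EG1_quad (a b c : ℝ) : EG1 (fun x => a * x ^ 2 + b * x + c) = a + c := by
  have i2 : Integrable (fun x : ℝ => x ^ 2) (gaussianReal 0 1) :=
    QG.integrable ⟨by fun_prop, 1, fun x => by rw [abs_of_nonneg (sq_nonneg x)]; linarith⟩
  have i1 : Integrable (fun x : ℝ => x) (gaussianReal 0 1) :=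
    QG.integrable ⟨by fun_prop, 1, fun x => by nlinarith [sq_abs x, sq_nonneg (|x| - 1)]⟩
  have e1 : ∫ x : ℝ, x ∂(gaussianReal 0 1) = 0 := by simpa using integral_id_gaussianReal (μ := 0) (v := 1)
  have e2 : ∫ x : ℝ, x ^ 2 ∂(gaussianReal 0 1) = 1 := by
    have h := stein1 (f := fun x => x) (f' := fun _ => 1) (C := 1) (c := 1) (fun x => hasDerivAt_id x) (by fun_prop)
      (fun x => by simpa using abs_le_exp_abs x) (fun x => by simp)
    simp only [integral_const, smul_eq_mul, mul_one, probReal_univ] at h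
    rw [← h]; congr 1; funext x; ring
  rw [EG1]
  rw [integral_add (f := fun x => a * x ^ 2 + b * x) ((i2.const_mul a).add (i1.const_mul b)) (integrable_const c),
    integral_add (i2.const_mul a) (i1.const_mul b), integral_const_mul, integral_const_mul, e1, e2]
  simp

lemma Qg_erf (t : ℝ) : Qg (Real.sqrt 2 * t) = (1 - (2 / Real.sqrt Real.pi) * ∫ s in (0 : ℝ)..t, Real.exp (-s ^ 2)) / 2 := by
  have hi := (integrable_gaussianPDFReal 0 1)
  have h0 := intervalIntegral.integral_Ioi_sub_Ioi' (a := 0) (b := Real.sqrt 2 * t) hi.integrableOn hi.integrableOn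
  have h1 : ∫ x in Set.Ioi (0:ℝ), gaussianPDFReal 0 1 x = 1 / 2 := by
    have := integral_gaussian_Ioi (1/2)
    simp_rw [pdf_std]
    rw [integral_const_mul]
    have e : ∀ x : ℝ, -x ^ 2 / 2 = -(1/2) * x ^ 2 := fun x => by ring
    simp_rw [e, this]
    have : Real.sqrt (Real.pi / (1/2)) = Real.sqrt (2 * Real.pi) := by congr 1; ring
    rw [this]
    have : 0 < Real.sqrt (2 * Real.pi) := by positivity
    field_simp
  have h2 : ∫ x in (0:ℝ)..(Real.sqrt 2 * t), gaussianPDFReal 0 1 x = (Real.sqrt Real.pi)⁻¹ * ∫ s in (0 : ℝ)..t, Real.exp (-s ^ 2) := by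
    have hs : Real.sqrt 2 ≠ 0 := by positivity
    have := intervalIntegral.integral_comp_mul_left (a := 0) (b := t) (gaussianPDFReal 0 1) hs
    rw [mul_zero] at this
    have e : ∀ x : ℝ, gaussianPDFReal 0 1 (Real.sqrt 2 * x) = (Real.sqrt (2 * Real.pi))⁻¹ * Real.exp (-x ^ 2) := by
      intro x
      rw [pdf_std, mul_pow, Real.sq_sqrt (by norm_num)]; congr 2; ring
    simp_rw [e] at this
    rw [intervalIntegral.integral_const_mul, smul_eq_mul, Real.sqrt_mul (by norm_num)] at this
    have hp : Real.sqrt Real.pi ≠ 0 := by positivity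
    field_simp at this ⊢
    linarith
  rw [h1, h2] at h0
  unfold Qg
  field_simp at h0 ⊢
  linarith

noncomputable def pp (l x : ℝ) : ℝ := max (x - l) 0
lemma pp_nonneg (l x : ℝ) : 0 ≤ pp l x := le_max_right _ _
lemma pp_meas (l : ℝ) : Measurable (pp l) := by unfold pp; fun_prop
lemma pp_abs (l x : ℝ) : pp l x ≤ |x| + |l| := by
  unfold pp
  refine max_le ?_ (by positivity)
  have := le_abs_self x; have := neg_abs_le l; linarith

noncomputable def T0 (n k : ℕ) (l : ℝ) (h : Fin n → ℝ) : ℝ := Psi n k (fun x => (x - l) ^ 2) (fun x => (pp l x) ^ 2) h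

lemma QG_quad (a b c : ℝ) : QG (fun x => a * x ^ 2 + b * x + c) := by
  refine ⟨by fun_prop, |a| + |b| + |c|, fun x => ?_⟩
  have h1 : |a * x ^ 2 + b * x + c| ≤ |a| * x ^ 2 + |b| * |x| + |c| := by
    refine (abs_add_le _ _).trans (add_le_add ((abs_add_le _ _).trans (le_of_eq ?_)) le_rfl)
    rw [abs_mul, abs_mul, abs_of_nonneg (sq_nonneg x)]
  have h2 : |x| ≤ 1 + x ^ 2 := by nlinarith [sq_abs x, sq_nonneg (|x| - 1)]
  have h3 := mul_le_mul_of_nonneg_left h2 (abs_nonneg b)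
  nlinarith [abs_nonneg a, abs_nonneg c, sq_nonneg x, mul_nonneg (abs_nonneg c) (sq_nonneg x)]

lemma QG_of_le {ψ : ℝ → ℝ} (hm : Measurable ψ) (l : ℝ) (h : ∀ x, |ψ x| ≤ (|x| + |l|) ^ 2 + (|x| + |l|)) : QG ψ := by
  refine ⟨hm, 3 * (1 + |l|) ^ 2, fun x => (h x).trans ?_⟩
  nlinarith [sq_abs x, sq_nonneg (|x| - 1), abs_nonneg x, abs_nonneg l, sq_nonneg (|x| - |l|), mul_nonneg (abs_nonneg l) (sq_nonneg (|x| - 1)), mul_nonneg (sq_nonneg |l|) (sq_nonneg (|x|)), mul_nonneg (abs_nonneg l) (sq_nonneg (|x|)), sq_nonneg (|l|), mul_nonneg (sq_nonneg |l|) (sq_nonneg (|x| - 1))]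

lemma QG_pp2 (l : ℝ) : QG (fun x => pp l x ^ 2) := by
  have := pp_meas l
  refine QG_of_le (by fun_prop) l fun x => ?_
  rw [abs_of_nonneg (by positivity)]
  have h1 := pp_abs l x; have h2 := pp_nonneg l x
  have : pp l x ^ 2 ≤ (|x| + |l|) ^ 2 := by gcongr
  have : 0 ≤ |x| + |l| := by positivity
  linarith
lemma QG_pp (l : ℝ) : QG (fun x => pp l x) := by
  have := pp_meas l
  refine QG_of_le (by fun_prop) l fun x => ?_
  rw [abs_of_nonneg (pp_nonneg l x)]
  have h1 := pp_abs l x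
  have : 0 ≤ (|x| + |l|)^2 := by positivity
  linarith
lemma QG_xpp (l : ℝ) : QG (fun x => -(x * pp l x)) := by
  have := pp_meas l
  refine QG_of_le (by fun_prop) l fun x => ?_
  rw [abs_neg, abs_mul, abs_of_nonneg (pp_nonneg l x)]
  have h1 := pp_abs l x
  have : |x| * pp l x ≤ |x| * (|x| + |l|) := by gcongr
  have : 0 ≤ |x| + |l| := by positivity
  nlinarith [abs_nonneg x, abs_nonneg l]

lemma E_pp2 (l : ℝ) : EG1 (fun x => pp l x ^ 2) = (1 + l ^ 2) * Qg l - l * gaussianPDFReal 0 1 l := by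
  rw [EG1_plus l 1 (-2 * l) (l ^ 2)]
  · ring
  · intro x hx; rw [pp, max_eq_left (by linarith)]; ring
  · intro x hx; rw [pp, max_eq_right (by linarith)]; ring
lemma E_pp (l : ℝ) : EG1 (fun x => pp l x) = gaussianPDFReal 0 1 l - l * Qg l := by
  rw [EG1_plus l 0 1 (-l)]
  · ring
  · intro x hx; rw [pp, max_eq_left (by linarith)]; ring
  · intro x hx; rw [pp, max_eq_right (by linarith)]
lemma E_xpp (l : ℝ) : EG1 (fun x => -(x * pp l x)) = - Qg l := by
  rw [EG1_plus l (-1) l 0]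
  · ring
  · intro x hx; rw [pp, max_eq_left (by linarith)]; ring
  · intro x hx; rw [pp, max_eq_right (by linarith)]; ring

lemma T0_nonneg (n k : ℕ) (l : ℝ) (h : Fin n → ℝ) : 0 ≤ T0 n k l h := by
  unfold T0 Psi
  refine Finset.sum_nonneg fun i _ => ?_
  split_ifs <;> positivity

lemma T0_meas (n k : ℕ) (l : ℝ) : Measurable (T0 n k l) := by
  have := pp_meas l
  exact measurable_Psi (by fun_prop) (by fun_prop)

lemma sqrt_lin (x a : ℝ) (ha : 0 < a) (hx : 0 ≤ x) : Real.sqrt x ≤ x / (2 * a) + a / 2 := by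
  have h := Real.sq_sqrt hx
  have : x / (2 * a) + a / 2 - Real.sqrt x = (Real.sqrt x - a) ^ 2 / (2 * a) := by
    field_simp; rw [sub_sq, h]; ring
  have : 0 ≤ (Real.sqrt x - a) ^ 2 / (2 * a) := by positivity
  linarith

lemma mean_T0 (l β αw : ℝ) (hQ : (1 - β) * Qg l = αw - β) (hφ : (1 - β) * gaussianPDFReal 0 1 l = αw * l) :
    β * EG1 (fun x => (x - l) ^ 2) + (1 - β) * EG1 (fun x => pp l x ^ 2) = αw := by
  have e : (fun x : ℝ => (x - l) ^ 2) = fun x => 1 * x ^ 2 + (-2 * l) * x + l ^ 2 := by funext x; ring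
  rw [e, EG1_quad, E_pp2]
  linear_combination (1 + l ^ 2) * hQ - l * hφ

/-- (a) -/
lemma T0_mgf (l β αw : ℝ) (hβ0 : 0 < β) (hβ1 : β < 1) (hαw : 0 < αw)
    (hQ : (1 - β) * Qg l = αw - β) (hφ : (1 - β) * gaussianPDFReal 0 1 l = αw * l) (η : ℝ) (hη : 0 < η) :
    ∃ τ₀ > (0:ℝ), ∃ N : ℕ, ∀ n ≥ N, ∀ τ : ℝ, 0 ≤ τ → τ ≤ τ₀ →
      Integrable (fun h => Real.exp (τ * Real.sqrt n * Real.sqrt (T0 n (kDim β n) l h))) (stdG (Fin n)) ∧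
      ∫ h, Real.exp (τ * Real.sqrt n * Real.sqrt (T0 n (kDim β n) l h)) ∂(stdG (Fin n)) ≤
        Real.exp (τ * n * (Real.sqrt αw + η)) := by
  have q1 : QG (fun x : ℝ => (x - l) ^ 2) := by
    have e : (fun x : ℝ => (x - l) ^ 2) = fun x => 1 * x ^ 2 + (-2 * l) * x + l ^ 2 := by funext x; ring
    rw [e]; exact QG_quad _ _ _
  set s := Real.sqrt αw with hs
  have hs0 : 0 < s := Real.sqrt_pos.2 hαw
  have hss : s ^ 2 = αw := Real.sq_sqrt hαw.le
  obtain ⟨θ₀, hθ, N, H⟩ := mgf_Psi q1 (QG_pp2 l) β hβ0 hβ1 (2 * s * η) (by positivity)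
  rw [mean_T0 l β αw hQ hφ] at H
  refine ⟨2 * s * θ₀, by positivity, max N 1, fun n hn τ h0 h1 => ?_⟩
  have hn1 : 1 ≤ n := le_trans (le_max_right _ _) hn
  have hn0 : (0:ℝ) < n := by exact_mod_cast hn1
  obtain ⟨hi, hb⟩ := H n (le_trans (le_max_left _ _) hn) (τ / (2 * s)) (by positivity) (by rw [div_le_iff₀ (by positivity)]; linarith)
  have key : ∀ h : Fin n → ℝ, Real.exp (τ * Real.sqrt n * Real.sqrt (T0 n (kDim β n) l h)) ≤
      Real.exp (τ * n * s / 2) * Real.exp (τ / (2 * s) * Psi n (kDim β n) (fun x => (x - l) ^ 2) (fun x => (pp l x) ^ 2) h) := by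
    intro h
    rw [← Real.exp_add]
    apply Real.exp_le_exp.2
    have hsn : 0 < Real.sqrt n := Real.sqrt_pos.2 hn0
    have hnn : Real.sqrt n ^ 2 = n := Real.sq_sqrt hn0.le
    have a1 := sqrt_lin (T0 n (kDim β n) l h) (s * Real.sqrt n) (by positivity) (T0_nonneg _ _ _ _)
    have a2 := mul_le_mul_of_nonneg_left a1 (by positivity : 0 ≤ τ * Real.sqrt n)
    refine a2.trans (le_of_eq ?_)
    show _ = τ * n * s / 2 + τ / (2 * s) * T0 n (kDim β n) l h
    rw [mul_add]
    have : τ * Real.sqrt n * (s * Real.sqrt n / 2) = τ * (Real.sqrt n ^ 2) * s / 2 := by ring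
    rw [this, hnn, add_comm]
    congr 1
    field_simp
  have hi2 := hi.const_mul (Real.exp (τ * n * s / 2))
  have m1 := T0_meas n (kDim β n) l
  have hi3 : Integrable (fun h => Real.exp (τ * Real.sqrt n * Real.sqrt (T0 n (kDim β n) l h))) (stdG (Fin n)) := by
    refine hi2.mono' (Measurable.aestronglyMeasurable (by fun_prop)) (Filter.Eventually.of_forall fun h => ?_)
    rw [Real.norm_eq_abs, Real.abs_exp]; exact key h
  refine ⟨hi3, ?_⟩
  calc _ ≤ _ := integral_mono hi3 hi2 key
    _ = _ := integral_const_mul _ _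
    _ ≤ _ := mul_le_mul_of_nonneg_left hb (Real.exp_pos _).le
    _ = _ := by
      rw [← Real.exp_add]; congr 1
      rw [← hss]; field_simp; ring

lemma integrable_exp_vn {κ : Type} [Fintype κ] (c : ℝ) : Integrable (fun g : κ → ℝ => Real.exp (c * vn g)) (stdG κ) := by
  have := meas_vn (I := κ)
  refine integrable_of_exp_bound (C := 1) (c := |c|) (by fun_prop) fun g => ?_
  rw [Real.abs_exp, one_mul]
  apply Real.exp_le_exp.2
  calc c * vn g ≤ |c| * vn g := mul_le_mul_of_nonneg_right (le_abs_self c) (vn_nonneg g)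
    _ ≤ _ := mul_le_mul_of_nonneg_left (vn_le_sum_abs g) (abs_nonneg c)

lemma Psi_all (m : ℕ) (ψ : ℝ → ℝ) (g : Fin m → ℝ) : Psi m m ψ ψ g = ∑ i, ψ (g i) := by
  simp [Psi]

/-- (b) -/
lemma g_up (α : ℝ) (hα : 0 < α) (η : ℝ) (hη : 0 < η) :
    ∃ τ₀ > (0:ℝ), ∃ N : ℕ, ∀ n ≥ N, ∀ τ : ℝ, 0 ≤ τ → τ ≤ τ₀ →
      ∫ g, Real.exp (τ * Real.sqrt n * vn g) ∂(stdG (Fin (mDim α n))) ≤ Real.exp (τ * n * (Real.sqrt α + η)) := by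
  have q1 : QG (fun x : ℝ => x ^ 2) := by simpa using QG_quad 1 0 0
  have e1 : EG1 (fun x : ℝ => x ^ 2) = 1 := by simpa using EG1_quad 1 0 0
  set s := Real.sqrt α with hs
  have hs0 : 0 < s := Real.sqrt_pos.2 hα
  have hss : s ^ 2 = α := Real.sq_sqrt hα.le
  obtain ⟨θ₀, hθ, H⟩ := mgf1 q1 (η / s) (by positivity)
  obtain ⟨N, hN⟩ := exists_nat_ge ((1 + η / s) / (s * η))
  refine ⟨2 * s * θ₀, by positivity, max N 1, fun n hn τ h0 h1 => ?_⟩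
  have hn1 : 1 ≤ n := le_trans (le_max_right _ _) hn
  have hn0 : (0:ℝ) < n := by exact_mod_cast hn1
  have hnN : (N:ℝ) ≤ n := by exact_mod_cast (le_trans (le_max_left _ _) hn)
  have A := H (τ / (2 * s)) (by positivity) (by rw [div_le_iff₀ (by positivity)]; linarith)
  set m := mDim α n
  have B := mgf_Psi0 m m le_rfl (τ / (2 * s)) _ _ A A
  have hm2 : (m : ℝ) ≤ α * n + 1 := (Nat.ceil_lt_add_one (by positivity)).le
  have key : ∀ g : Fin m → ℝ, Real.exp (τ * Real.sqrt n * vn g) ≤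
      Real.exp (τ * n * s / 2) * Real.exp (τ / (2 * s) * Psi m m (fun x => x ^ 2) (fun x => x ^ 2) g) := by
    intro g
    rw [← Real.exp_add, Psi_all]
    apply Real.exp_le_exp.2
    have hsn : 0 < Real.sqrt n := Real.sqrt_pos.2 hn0
    have hnn : Real.sqrt n ^ 2 = n := Real.sq_sqrt hn0.le
    have a1 := sqrt_lin (∑ i, g i ^ 2) (s * Real.sqrt n) (by positivity) (Finset.sum_nonneg fun _ _ => sq_nonneg _)
    have a2 := mul_le_mul_of_nonneg_left a1 (by positivity : 0 ≤ τ * Real.sqrt n)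
    refine a2.trans (le_of_eq ?_)
    rw [mul_add]
    have : τ * Real.sqrt n * (s * Real.sqrt n / 2) = τ * (Real.sqrt n ^ 2) * s / 2 := by ring
    rw [this, hnn, add_comm]
    congr 1
    field_simp
  calc _ ≤ _ := integral_mono (integrable_exp_vn _) (B.1.const_mul _) key
    _ = _ := integral_const_mul _ _
    _ ≤ _ := mul_le_mul_of_nonneg_left B.2 (Real.exp_pos _).le
    _ ≤ _ := by
      rw [← Real.exp_add]; apply Real.exp_le_exp.2
      rw [sub_self, zero_mul, add_zero]
      change _ + (m:ℝ) * (τ / (2 * s) * (EG1 (fun x : ℝ => x ^ 2) + η / s)) ≤ _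
      rw [e1]
      have h5 : (1 + η / s) ≤ s * η * n := by
        rw [div_le_iff₀ (by positivity)] at hN
        nlinarith [mul_pos hs0 hη]
      have h6 : (m:ℝ) * (1 + η / s) ≤ (α * n) * (1 + η / s) + s * η * n := by
        have : (m:ℝ) * (1 + η / s) ≤ (α * n + 1) * (1 + η / s) := by gcongr
        linarith
      have h7 : (α * n) * (1 + η / s) = α * n + s * n * η := by
        rw [← hss]; field_simp
      calc τ * n * s / 2 + (m:ℝ) * (τ / (2 * s) * (1 + η / s)) = τ * n * s / 2 + τ / (2 * s) * (m * (1 + η / s)) := by ring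
        _ ≤ τ * n * s / 2 + τ / (2 * s) * (α * n + s * n * η + s * η * n) := by rw [← h7]; gcongr
        _ = _ := by rw [← hss]; field_simp; ring

/-- (c) -/
lemma g_low (α : ℝ) (hα : 0 < α) (hα1 : α < 1) (η : ℝ) (hη : 0 < η) :
    ∃ τ₀ > (0:ℝ), ∀ n : ℕ, ∀ τ : ℝ, 0 ≤ τ → τ ≤ τ₀ →
      ∫ g, Real.exp (-(τ * Real.sqrt n) * vn g) ∂(stdG (Fin (mDim α n))) ≤ 2 * Real.exp (-(τ * n * (Real.sqrt α - η))) := by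
  have q1 : QG (fun x : ℝ => -x ^ 2) := by simpa using QG_quad (-1) 0 0
  have e1 : EG1 (fun x : ℝ => -x ^ 2) = -1 := by simpa using EG1_quad (-1) 0 0
  set s := Real.sqrt α with hs
  have hs0 : 0 < s := Real.sqrt_pos.2 hα
  have hss : s ^ 2 = α := Real.sq_sqrt hα.le
  set q := s - min η (s / 2) with hq
  have hq0 : 0 < q := by have := min_le_right η (s/2); linarith
  have hq1 : s - η ≤ q := by have := min_le_left η (s/2); linarith
  have hqs : q < s := by have : 0 < min η (s / 2) := by positivity
                         linarith
  have hqa : q ^ 2 < α := by rw [← hss]; gcongr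
  set ζ := (α - q ^ 2) / 2 with hζ
  have hζ0 : 0 < ζ := by linarith
  obtain ⟨θ, hθ, H⟩ := mgf1 q1 ζ hζ0
  have A := H θ hθ.le le_rfl
  refine ⟨θ * ζ / q, by positivity, fun n τ h0 h1 => ?_⟩
  set m := mDim α n
  have B := mgf_Psi0 m m le_rfl θ _ _ A A
  have hm1 : α * n ≤ (m : ℝ) := Nat.le_ceil _
  have hn0 : (0:ℝ) ≤ n := Nat.cast_nonneg n
  have hnn : Real.sqrt n ^ 2 = n := Real.sq_sqrt hn0
  have key : ∀ g : Fin m → ℝ, Real.exp (-(τ * Real.sqrt n) * vn g) ≤ Real.exp (-(τ * n * q)) +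
      Real.exp (θ * (n * q ^ 2)) * Real.exp (θ * Psi m m (fun x => -x ^ 2) (fun x => -x ^ 2) g) := by
    intro g
    rw [← Real.exp_add, Psi_all, Finset.sum_neg_distrib, ← vn_sq]
    have hv := vn_nonneg g
    by_cases hc : Real.sqrt n * q ≤ vn g
    · have : Real.exp (-(τ * Real.sqrt n) * vn g) ≤ Real.exp (-(τ * n * q)) := by
        apply Real.exp_le_exp.2
        have := mul_le_mul_of_nonneg_left hc (by positivity : 0 ≤ τ * Real.sqrt n)
        have e : τ * Real.sqrt n * (Real.sqrt n * q) = τ * (Real.sqrt n ^ 2) * q := by ring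
        rw [e, hnn] at this
        linarith
      have := Real.exp_pos (θ * (n * q ^ 2) + θ * -vn g ^ 2)
      linarith
    · push Not at hc
      have h2 : vn g ^ 2 ≤ n * q ^ 2 := by
        calc vn g ^ 2 ≤ (Real.sqrt n * q) ^ 2 := by gcongr
          _ = _ := by rw [mul_pow, hnn]
      have h3 : Real.exp (-(τ * Real.sqrt n) * vn g) ≤ 1 := by
        apply Real.exp_le_one_iff.2
        have : 0 ≤ τ * Real.sqrt n * vn g := by positivity
        linarith
      have h4 : 1 ≤ Real.exp (θ * (n * q ^ 2) + θ * -vn g ^ 2) := by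
        apply Real.one_le_exp
        nlinarith
      have := Real.exp_pos (-(τ * n * q))
      linarith
  have i1 : Integrable (fun _ : Fin m → ℝ => Real.exp (-(τ * n * q))) (stdG (Fin m)) := integrable_const _
  have i2 := B.1.const_mul (Real.exp (θ * (n * q ^ 2)))
  calc _ ≤ _ := integral_mono (integrable_exp_vn _) (i1.add i2) key
    _ = Real.exp (-(τ * n * q)) + Real.exp (θ * (n * q ^ 2)) * ∫ g, Real.exp (θ * Psi m m (fun x => -x ^ 2) (fun x => -x ^ 2) g) ∂(stdG (Fin m)) := by
      refine (integral_add' i1 i2).trans ?_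
      rw [integral_const_mul]; simp
    _ ≤ Real.exp (-(τ * n * q)) + Real.exp (-(τ * n * q)) := by
      gcongr
      refine (mul_le_mul_of_nonneg_left B.2 (Real.exp_pos _).le).trans ?_
      rw [← Real.exp_add]; apply Real.exp_le_exp.2
      rw [sub_self, zero_mul, add_zero]
      change _ + (m:ℝ) * (θ * (EG1 (fun x : ℝ => -x ^ 2) + ζ)) ≤ _
      rw [e1]
      rw [le_div_iff₀ hq0] at h1
      have a1 : ζ < 1 := by nlinarith
      have a2 : (m:ℝ) * (-1 + ζ) ≤ (α * n) * (-1 + ζ) := mul_le_mul_of_nonpos_right hm1 (by linarith)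
      have a3 : θ * (m * (-1 + ζ)) ≤ θ * ((α * n) * (-1 + ζ)) := by gcongr
      have a4 : τ * q * n ≤ θ * ζ * n := by gcongr
      have a5 : 0 ≤ θ * n * ζ * (1 - α) := by
        have : 0 ≤ 1 - α := by linarith
        positivity
      have a6 : q ^ 2 = α - 2 * ζ := by rw [hζ]; ring
      rw [a6]
      nlinarith
    _ ≤ _ := by
      rw [two_mul]
      have : Real.exp (-(τ * n * q)) ≤ Real.exp (-(τ * n * (s - η))) := by
        apply Real.exp_le_exp.2
        have : τ * n * (s - η) ≤ τ * n * q := by gcongr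
        linarith
      linarith

def Dset (n : ℕ) (xt : Fin n → ℝ) : Set (Fin n → ℝ) := {w | (∀ i, 0 ≤ xt i + w i) ∧ ∑ i, w i ≤ 0}

lemma good_h (l β αw : ℝ) (hl : 0 ≤ l) (hβ0 : 0 < β) (hβ1 : β < 1)
    (hQ : (1 - β) * Qg l = αw - β) (hφ : (1 - β) * gaussianPDFReal 0 1 l = αw * l) (η1 : ℝ) (hη : 0 < η1) :
    ∃ d > (0:ℝ), ∃ c > (0:ℝ), ∃ N : ℕ, ∀ n ≥ N, ∃ bad : Set (Fin n → ℝ), MeasurableSet bad ∧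
      (stdG (Fin n)).real bad ≤ 4 * Real.exp (-(c * n)) ∧ ∀ h ∉ bad,
        Psi n (kDim β n) (fun x => x - l - d) (fun x => pp l x) h < 0 ∧
        Psi n (kDim β n) (fun x => (x - l - d) ^ 2) (fun x => (pp l x) ^ 2) h < n * (αw + η1) ∧
        Psi n (kDim β n) (fun x => -(x * (x - l - d))) (fun x => -(x * pp l x)) h < n * (-αw + η1) ∧
        Psi n (kDim β n) (fun x => x ^ 2) (fun x => x ^ 2) h < n * 4 := by
  set d := min 1 (η1 / (2 * (2 * l + 1))) with hd
  have hd0 : 0 < d := lt_min one_pos (by positivity)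
  have hd1 : d ≤ 1 := min_le_left _ _
  have hd2 : d * (2 * l + 1) ≤ η1 / 2 := by
    have : d ≤ η1 / (2 * (2 * l + 1)) := min_le_right _ _
    rw [le_div_iff₀ (by positivity)] at this
    linarith
  have m1 : (fun x : ℝ => x - l - d) = fun x => 0 * x ^ 2 + 1 * x + (-l - d) := by funext x; ring
  have m2 : (fun x : ℝ => (x - l - d) ^ 2) = fun x => 1 * x ^ 2 + (-2 * (l + d)) * x + (l + d) ^ 2 := by funext x; ring
  have m3 : (fun x : ℝ => -(x * (x - l - d))) = fun x => (-1) * x ^ 2 + (l + d) * x + 0 := by funext x; ring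
  have m4 : (fun x : ℝ => x ^ 2) = fun x => 1 * x ^ 2 + 0 * x + 0 := by funext x; ring
  obtain ⟨c1, hc1, N1, H1⟩ := tail_Psi (ψ₁ := fun x => x - l - d) (ψ₂ := fun x => pp l x) (by rw [m1]; exact QG_quad _ _ _) (QG_pp l) β hβ0 hβ1 0 (by
    rw [m1, EG1_quad, E_pp]
    have : β * (0 + (-l - d)) + (1 - β) * (gaussianPDFReal 0 1 l - l * Qg l) = - (β * d) := by
      linear_combination hφ - l * hQ
    rw [this]; nlinarith [mul_pos hβ0 hd0])
  obtain ⟨c2, hc2, N2, H2⟩ := tail_Psi (ψ₁ := fun x => (x - l - d) ^ 2) (ψ₂ := fun x => (pp l x) ^ 2) (by rw [m2]; exact QG_quad _ _ _) (QG_pp2 l) β hβ0 hβ1 (αw + η1) (by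
    rw [m2, EG1_quad, E_pp2]
    have : β * (1 + (l + d) ^ 2) + (1 - β) * ((1 + l ^ 2) * Qg l - l * gaussianPDFReal 0 1 l) = αw + β * (d * (2 * l + d)) := by
      linear_combination (1 + l ^ 2) * hQ - l * hφ
    rw [this]
    have a1 : d * (2 * l + d) ≤ η1 / 2 := le_trans (by gcongr) hd2
    have a2 : 0 ≤ d * (2 * l + d) := by positivity
    nlinarith)
  obtain ⟨c3, hc3, N3, H3⟩ := tail_Psi (ψ₁ := fun x => -(x * (x - l - d))) (ψ₂ := fun x => -(x * pp l x)) (by rw [m3]; exact QG_quad _ _ _) (QG_xpp l) β hβ0 hβ1 (-αw + η1) (by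
    rw [m3, EG1_quad, E_xpp]
    linarith)
  obtain ⟨c4, hc4, N4, H4⟩ := tail_Psi (ψ₁ := fun x => x ^ 2) (ψ₂ := fun x => x ^ 2) (by rw [m4]; exact QG_quad _ _ _) (by rw [m4]; exact QG_quad _ _ _) β hβ0 hβ1 4 (by
    rw [m4, EG1_quad]
    linarith)
  refine ⟨d, hd0, min (min c1 c2) (min c3 c4), by positivity, max (max N1 N2) (max N3 N4), fun n hn => ?_⟩
  set c := min (min c1 c2) (min c3 c4) with hc
  have k1 : c ≤ c1 := (min_le_left _ _).trans (min_le_left _ _)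
  have k2 : c ≤ c2 := (min_le_left _ _).trans (min_le_right _ _)
  have k3 : c ≤ c3 := (min_le_right _ _).trans (min_le_left _ _)
  have k4 : c ≤ c4 := (min_le_right _ _).trans (min_le_right _ _)
  have mk : ∀ c', c ≤ c' → Real.exp (-(c' * n)) ≤ Real.exp (-(c * n)) := fun c' h => by
    apply Real.exp_le_exp.2; have : (0:ℝ) ≤ n := Nat.cast_nonneg n; nlinarith
  have hp := pp_meas l
  refine ⟨({h | n * (0:ℝ) ≤ Psi n (kDim β n) (fun x => x - l - d) (fun x => pp l x) h} ∪
     {h | n * (αw + η1) ≤ Psi n (kDim β n) (fun x => (x - l - d) ^ 2) (fun x => (pp l x) ^ 2) h}) ∪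
     ({h | n * (-αw + η1) ≤ Psi n (kDim β n) (fun x => -(x * (x - l - d))) (fun x => -(x * pp l x)) h} ∪
     {h | n * 4 ≤ Psi n (kDim β n) (fun x => x ^ 2) (fun x => x ^ 2) h}), ?_, ?_, ?_⟩
  · refine MeasurableSet.union (MeasurableSet.union ?_ ?_) (MeasurableSet.union ?_ ?_) <;>
    exact measurableSet_le measurable_const (measurable_Psi (by fun_prop) (by fun_prop))
  · refine (measureReal_union_le _ _).trans ?_
    have u1 := measureReal_union_le (μ := stdG (Fin n)) {h | n * (0:ℝ) ≤ Psi n (kDim β n) (fun x => x - l - d) (fun x => pp l x) h} {h | n * (αw + η1) ≤ Psi n (kDim β n) (fun x => (x - l - d) ^ 2) (fun x => (pp l x) ^ 2) h}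
    have u2 := measureReal_union_le (μ := stdG (Fin n)) {h | n * (-αw + η1) ≤ Psi n (kDim β n) (fun x => -(x * (x - l - d))) (fun x => -(x * pp l x)) h} {h | n * 4 ≤ Psi n (kDim β n) (fun x => x ^ 2) (fun x => x ^ 2) h}
    have v1 := (H1 n (by omega)).trans (mk _ k1)
    have v2 := (H2 n (by omega)).trans (mk _ k2)
    have v3 := (H3 n (by omega)).trans (mk _ k3)
    have v4 := (H4 n (by omega)).trans (mk _ k4)
    linarith
  · intro h hh
    simp only [Set.mem_union, Set.mem_setOf_eq, not_or, not_le, mul_zero] at hh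
    exact ⟨hh.1.1, hh.1.2, hh.2.1, hh.2.2⟩

set_option maxHeartbeats 1000000 in
lemma B_low (l β αw r : ℝ) (σ : ℝ) (hl : 0 ≤ l) (hβ0 : 0 < β) (hβ1 : β < 1) (hαw : 0 < αw) (hr : 0 < r)
    (hQ : (1 - β) * Qg l = αw - β) (hφ : (1 - β) * gaussianPDFReal 0 1 l = αw * l)
    (η : ℝ) (hη : 0 < η) (hηq : η ≤ Real.sqrt αw) :
    ∃ τ₀ > (0:ℝ), ∃ N : ℕ, ∀ n ≥ N, ∀ τ : ℝ, 0 ≤ τ → τ ≤ τ₀ → ∀ xt : Fin n → ℝ,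
      (∀ i, xt i = if n - kDim β n ≤ (i:ℕ) then r else 0) →
      ∃ Y : Finset (Fin n → ℝ), Y.Nonempty ∧ ↑Y ⊆ Dset n xt ∧ ∃ b : (Fin n → ℝ) → ℝ,
        Measurable b ∧ Integrable b (stdG (Fin n)) ∧ (∀ h, 0 ≤ b h) ∧
        (∀ V : ℝ, 0 ≤ V → ∀ h, ∃ w ∈ Y, Real.exp (τ * Real.sqrt n * (Real.sqrt (σ ^ 2 + vn w ^ 2) * V - ∑ j, w j * h j)) ≤
          Real.exp (τ * Real.sqrt n * Real.sqrt (σ ^ 2 + r ^ 2) * V) * b h) ∧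
        ∫ h, b h ∂(stdG (Fin n)) ≤ 5 * Real.exp (-(τ * n * (r * (Real.sqrt αw - η)))) := by
  set q := Real.sqrt αw with hq
  have hq0 : 0 < q := Real.sqrt_pos.2 hαw
  have hqq : q ^ 2 = αw := Real.sq_sqrt hαw.le
  obtain ⟨d, hd, c, hc, N, H⟩ := good_h l β αw hl hβ0 hβ1 hQ hφ (η * q / 4) (by positivity)
  refine ⟨c / (r * q), by positivity, max N 1, fun n hn τ hτ0 hτ xt hxt => ?_⟩
  obtain ⟨bad, mbad, hbad, good⟩ := H n (le_of_max_le_left hn)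
  set k := kDim β n
  have hn1 : 1 ≤ n := le_of_max_le_right hn
  have hnp : (0:ℝ) < n := by exact_mod_cast hn1
  set sn := Real.sqrt n with hsn
  have hsn0 : 0 < sn := Real.sqrt_pos.2 hnp
  have hsn2 : sn ^ 2 = n := Real.sq_sqrt hnp.le
  have hxt0 : ∀ i, 0 ≤ xt i := fun i => by rw [hxt]; split_ifs <;> linarith
  obtain ⟨Y0, hY0, hnet⟩ := net_exists (Dset n xt ∩ {w | vn w ≤ r}) r (fun w hw => hw.2) (r * η / 4) (by positivity)
  classical
  set s := Real.sqrt (σ ^ 2 + r ^ 2)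
  have zD : (0 : Fin n → ℝ) ∈ Dset n xt := ⟨fun i => by simpa using hxt0 i, by simp⟩
  refine ⟨insert 0 Y0, Finset.insert_nonempty _ _, ?_, fun h => Real.exp (-(τ * n * (r * (q - η)))) + bad.indicator (fun _ => 1) h, ?_, ?_, ?_, ?_, ?_⟩
  · intro w hw
    rcases Finset.mem_insert.1 (Finset.mem_coe.1 hw) with rfl | hw
    · exact zD
    · exact (hY0 hw).1
  · exact measurable_const.add (measurable_const.indicator mbad)
  · exact (integrable_const _).add ((integrable_const _).indicator mbad)
  · intro h
    have : 0 ≤ bad.indicator (fun _ => (1:ℝ)) h := Set.indicator_nonneg (fun _ _ => zero_le_one) h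
    positivity
  · intro V hV h
    have sle : ∀ w : Fin n → ℝ, vn w ≤ r → Real.sqrt (σ ^ 2 + vn w ^ 2) ≤ s := fun w hw =>
      Real.sqrt_le_sqrt (by have := vn_nonneg w; nlinarith)
    by_cases hb : h ∈ bad
    · refine ⟨0, Finset.mem_insert_self _ _, ?_⟩
      beta_reduce
      rw [Set.indicator_of_mem hb]
      have e1 : Real.exp (τ * sn * (Real.sqrt (σ ^ 2 + vn (0 : Fin n → ℝ) ^ 2) * V - ∑ j, (0 : Fin n → ℝ) j * h j)) ≤ Real.exp (τ * sn * s * V) := by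
        apply Real.exp_le_exp.2
        have := sle 0 (by rw [vn_zero]; exact hr.le)
        simp only [Pi.zero_apply, zero_mul, Finset.sum_const_zero, sub_zero]
        rw [mul_assoc (τ * sn)]
        gcongr
      refine e1.trans ?_
      have := Real.exp_pos (τ * sn * s * V)
      have := Real.exp_pos (-(τ * n * (r * (q - η))))
      nlinarith
    · obtain ⟨g1, g2, g3, g4⟩ := good h hb
      set z : Fin n → ℝ := fun i => if n - k ≤ (i:ℕ) then h i - l - d else pp l (h i) with hz
      have z1 : ∑ i, z i < 0 := by
        refine lt_of_eq_of_lt ?_ g1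
        unfold Psi; refine Finset.sum_congr rfl fun i _ => ?_
        simp only [hz]; split_ifs <;> rfl
      have z2 : vn z ^ 2 < n * (αw + η * q / 4) := by
        refine lt_of_eq_of_lt ?_ g2
        rw [vn_sq]
        unfold Psi; refine Finset.sum_congr rfl fun i _ => ?_
        simp only [hz]; split_ifs <;> rfl
      have z3 : -∑ i, z i * h i < n * (-αw + η * q / 4) := by
        refine lt_of_eq_of_lt ?_ g3
        rw [← Finset.sum_neg_distrib]
        unfold Psi; refine Finset.sum_congr rfl fun i _ => ?_
        simp only [hz]; split_ifs <;> ring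
      have z4 : vn h ^ 2 < n * 4 := by
        refine lt_of_eq_of_lt ?_ g4
        rw [vn_sq]
        unfold Psi; refine Finset.sum_congr rfl fun i _ => ?_
        split_ifs <;> rfl
      have z4' : vn h ≤ 2 * sn := by
        apply le_of_sq_le_sq _ (by positivity)
        rw [mul_pow, hsn2]; linarith
      set B := Real.sqrt (αw + η * q / 4) with hB
      have hB0 : 0 < B := Real.sqrt_pos.2 (by positivity)
      have hBB : B ^ 2 = αw + η * q / 4 := Real.sq_sqrt (by positivity)
      have z2' : vn z ≤ sn * B := by
        apply le_of_sq_le_sq _ (by positivity)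
        rw [mul_pow, hsn2, hBB]; linarith
      set w0 : Fin n → ℝ := (r / (sn * B)) • z with hw0
      have hw0n : vn w0 ≤ r := by
        rw [hw0, vn_smul, abs_of_pos (by positivity), div_mul_eq_mul_div, div_le_iff₀ (by positivity)]
        gcongr
      have hw0D : w0 ∈ Dset n xt := by
        constructor
        · intro i
          rw [hxt]
          split_ifs with hi
          · have := (abs_le.1 ((abs_le_vn w0 i).trans hw0n)).1
            linarith
          · have : 0 ≤ w0 i := by
              simp only [hw0, hz, Pi.smul_apply, smul_eq_mul, if_neg hi]
              exact mul_nonneg (by positivity) (pp_nonneg _ _)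
            linarith
        · have : ∑ i, w0 i = (r / (sn * B)) * ∑ i, z i := by
            rw [Finset.mul_sum]; rfl
          rw [this]
          exact mul_nonpos_of_nonneg_of_nonpos (by positivity) z1.le
      obtain ⟨w, hw, hww⟩ := hnet w0 ⟨hw0D, hw0n⟩
      refine ⟨w, Finset.mem_insert_of_mem hw, ?_⟩
      beta_reduce
      rw [Set.indicator_of_notMem hb, add_zero, ← Real.exp_add]
      apply Real.exp_le_exp.2
      have a1 := mul_le_mul_of_nonneg_right (sle w (hY0 hw).2) hV
      have a2 : ∑ j, w0 j * h j - ∑ j, w j * h j ≤ (r * η / 4) * (2 * sn) := by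
        have e : ∑ j, w0 j * h j - ∑ j, w j * h j = ∑ j, (w0 - w) j * h j := by
          rw [← Finset.sum_sub_distrib]; refine Finset.sum_congr rfl fun j _ => ?_
          simp only [Pi.sub_apply]; ring
        rw [e]
        refine (dot_le_vn _ _).trans ?_
        exact mul_le_mul hww z4' (vn_nonneg _) (by positivity)
      have a3 : sn * (r * (q - η / 2)) ≤ ∑ j, w0 j * h j := by
        have e : ∑ j, w0 j * h j = (r / (sn * B)) * ∑ i, z i * h i := by
          rw [Finset.mul_sum]; refine Finset.sum_congr rfl fun j _ => ?_
          simp only [hw0, Pi.smul_apply, smul_eq_mul]; ring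
        rw [e, div_mul_eq_mul_div, le_div_iff₀ (by positivity)]
        have b1 : B ≤ q + η / 8 := by
          apply le_of_sq_le_sq _ (by positivity)
          rw [hBB, ← hqq]; nlinarith [sq_nonneg η]
        have b2 : (q - η / 2) * B ≤ αw - η * q / 4 := by
          have : (q - η / 2) * B ≤ (q - η / 2) * (q + η / 8) := by
            apply mul_le_mul_of_nonneg_left b1; linarith
          nlinarith [sq_nonneg η]
        have b3 : n * ((q - η / 2) * B) ≤ ∑ i, z i * h i := by
          have := mul_le_mul_of_nonneg_left b2 hnp.le
          linarith
        calc sn * (r * (q - η / 2)) * (sn * B) = r * (sn ^ 2 * ((q - η / 2) * B)) := by ring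
          _ ≤ _ := by rw [hsn2]; gcongr
      have a4 : sn * (r * (q - η)) ≤ ∑ j, w j * h j := by nlinarith
      have a5 : τ * sn * (sn * (r * (q - η))) ≤ τ * sn * ∑ j, w j * h j := by gcongr
      have a6 : τ * sn * (sn * (r * (q - η))) = τ * n * (r * (q - η)) := by rw [← hsn2]; ring
      have a7 := mul_le_mul_of_nonneg_left a1 (by positivity : 0 ≤ τ * sn)
      rw [a6] at a5
      nlinarith
  · rw [integral_add (integrable_const _) ((integrable_const _).indicator mbad), integral_indicator mbad]
    simp only [integral_const, probReal_univ, smul_eq_mul, mul_one, one_mul, Measure.restrict_apply MeasurableSet.univ, measureReal_restrict_apply MeasurableSet.univ, Set.univ_inter]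
    have : Real.exp (-(c * n)) ≤ Real.exp (-(τ * n * (r * (q - η)))) := by
      apply Real.exp_le_exp.2
      rw [le_div_iff₀ (by positivity)] at hτ
      have : τ * (r * (q - η)) ≤ c := by
        have : 0 ≤ τ * (r * η) := by positivity
        nlinarith
      nlinarith
    linarith

lemma cone_ineq (n k : ℕ) (l : ℝ) (hl : 0 ≤ l) (xt w h : Fin n → ℝ) (hxt : ∀ i : Fin n, (i:ℕ) < n - k → xt i = 0)
    (hw : w ∈ Dset n xt) : ∑ j, w j * h j ≤ vn w * Real.sqrt (T0 n k l h) := by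
  set z : Fin n → ℝ := fun i => if n - k ≤ (i:ℕ) then h i - l else pp l (h i) with hz
  have e : Real.sqrt (T0 n k l h) = vn z := by
    unfold vn T0 Psi; congr 1
    refine Finset.sum_congr rfl fun i _ => ?_
    simp only [hz]; split_ifs <;> rfl
  rw [e]
  refine le_trans ?_ (dot_le_vn w z)
  have h1 : ∀ j, w j * h j ≤ w j * z j + l * w j := by
    intro j
    simp only [hz]
    split_ifs with hj
    · linarith
    · have := hw.1 j
      rw [hxt j (by omega), zero_add] at this
      have h2 : h j - l ≤ pp l (h j) := le_max_left _ _
      nlinarith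
  calc _ ≤ ∑ j, (w j * z j + l * w j) := Finset.sum_le_sum fun j _ => h1 j
    _ = ∑ j, w j * z j + l * ∑ j, w j := by rw [Finset.sum_add_distrib, Finset.mul_sum]
    _ ≤ _ := by have := mul_nonpos_of_nonneg_of_nonpos hl hw.2; linarith

section det
variable {m n : ℕ}

lemma e2_eq {d : ℕ} (x : Fin d → ℝ) : e2norm x = vn x := rfl

lemma lasso_eq (xt : Fin n → ℝ) (ω) (x : Fin n → ℝ) : lassoVal m n xt ω x = vn (res m n ω (x - xt)) := by
  unfold lassoVal
  rw [e2_eq]; congr 1; funext i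
  simp only [res, Pi.sub_apply, mul_sub, Finset.sum_sub_distrib]; ring

lemma feas_iff (xt x : Fin n → ℝ) (hxt : ∀ i, 0 ≤ xt i) :
    (l1norm x ≤ l1norm xt ∧ ∀ i, 0 ≤ x i) ↔ x - xt ∈ Dset n xt := by
  have e : l1norm xt = ∑ i, xt i := Finset.sum_congr rfl fun i _ => abs_of_nonneg (hxt i)
  constructor
  · rintro ⟨h1, h2⟩
    have e2 : l1norm x = ∑ i, x i := Finset.sum_congr rfl fun i _ => abs_of_nonneg (h2 i)
    refine ⟨fun i => by simpa using h2 i, ?_⟩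
    simp only [Pi.sub_apply, Finset.sum_sub_distrib]; linarith
  · rintro ⟨h1, h2⟩
    have h3 : ∀ i, 0 ≤ x i := fun i => by simpa using h1 i
    have e2 : l1norm x = ∑ i, x i := Finset.sum_congr rfl fun i _ => abs_of_nonneg (h3 i)
    simp only [Pi.sub_apply, Finset.sum_sub_distrib] at h2
    exact ⟨by linarith, h3⟩

def LMin (m n : ℕ) (xt : Fin n → ℝ) (ω : (Fin m → Fin n → ℝ) × (Fin m → ℝ)) (w : Fin n → ℝ) : Prop :=
  w ∈ Dset n xt ∧ ∀ w' ∈ Dset n xt, vn (res m n ω w) ≤ vn (res m n ω w')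

lemma zeta_min (xt x : Fin n → ℝ) (hxt : ∀ i, 0 ≤ xt i) (ω) (h1 : l1norm x ≤ l1norm xt) (h2 : ∀ i, 0 ≤ x i)
    (h3 : lassoVal m n xt ω x = zetaObjP m n xt ω) : LMin m n xt ω (x - xt) := by
  refine ⟨(feas_iff xt x hxt).1 ⟨h1, h2⟩, fun w' hw' => ?_⟩
  rw [← lasso_eq, h3]
  refine csInf_le ⟨0, ?_⟩ ⟨w' + xt, ?_⟩
  · rintro r ⟨x, _, _, rfl⟩; exact Real.sqrt_nonneg _
  · have := (feas_iff xt (w' + xt) hxt).2 (by simpa using hw')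
    exact ⟨this.1, this.2, by rw [lasso_eq]; simp⟩

lemma min_zeta (xt w : Fin n → ℝ) (hxt : ∀ i, 0 ≤ xt i) (ω) (h : LMin m n xt ω w) :
    l1norm (w + xt) ≤ l1norm xt ∧ (∀ i, 0 ≤ (w + xt) i) ∧ lassoVal m n xt ω (w + xt) = zetaObjP m n xt ω := by
  have f := (feas_iff xt (w + xt) hxt).2 (by simpa using h.1)
  refine ⟨f.1, f.2, ?_⟩
  refine le_antisymm ?_ ?_
  · refine le_csInf ⟨_, w + xt, f.1, f.2, rfl⟩ ?_
    rintro r ⟨x, h1, h2, rfl⟩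
    rw [lasso_eq, lasso_eq]
    simpa using h.2 _ ((feas_iff xt x hxt).1 ⟨h1, h2⟩)
  · refine csInf_le ⟨0, ?_⟩ ⟨w + xt, f.1, f.2, rfl⟩
    rintro r ⟨x, _, _, rfl⟩; exact Real.sqrt_nonneg _

lemma closed_D (xt : Fin n → ℝ) : IsClosed (Dset n xt) := by
  have : Dset n xt = (⋂ i, {w : Fin n → ℝ | 0 ≤ xt i + w i}) ∩ {w | ∑ i, w i ≤ 0} := by
    ext w; simp [Dset]
  rw [this]
  refine (isClosed_iInter fun i => isClosed_le (by fun_prop) (by fun_prop)).inter (isClosed_le (by fun_prop) (by fun_prop))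

lemma convex_D (xt : Fin n → ℝ) : Convex ℝ (Dset n xt) := by
  intro x hx y hy a b ha hb hab
  refine ⟨fun i => ?_, ?_⟩
  · have h1 := mul_nonneg ha (hx.1 i); have h2 := mul_nonneg hb (hy.1 i)
    simp only [Pi.add_apply, Pi.smul_apply, smul_eq_mul]
    have : xt i = a * xt i + b * xt i := by rw [← add_mul, hab, one_mul]
    linarith
  · have h1 := mul_nonpos_of_nonneg_of_nonpos ha hx.2; have h2 := mul_nonpos_of_nonneg_of_nonpos hb hy.2
    simp only [Pi.add_apply, Pi.smul_apply, smul_eq_mul, Finset.sum_add_distrib, ← Finset.mul_sum]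
    linarith

lemma zero_D (xt : Fin n → ℝ) (hxt : ∀ i, 0 ≤ xt i) : (0 : Fin n → ℝ) ∈ Dset n xt :=
  ⟨fun i => by simpa using hxt i, by simp⟩

lemma convex_vn (ρ : ℝ) : Convex ℝ {w : Fin n → ℝ | vn w ≤ ρ} := by
  intro x hx y hy a b ha hb hab
  simp only [Set.mem_setOf_eq] at *
  calc _ ≤ vn (a • x) + vn (b • y) := vn_add_le _ _
    _ = a * vn x + b * vn y := by rw [vn_smul, vn_smul, abs_of_nonneg ha, abs_of_nonneg hb]
    _ ≤ a * ρ + b * ρ := by gcongr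
    _ = ρ := by rw [← add_mul, hab, one_mul]

lemma cpt_ball (xt : Fin n → ℝ) (ρ : ℝ) : IsCompact (Dset n xt ∩ {w | vn w ≤ ρ}) := by
  refine Metric.isCompact_of_isClosed_isBounded ((closed_D xt).inter (isClosed_le cont_vn continuous_const)) ?_
  exact isBounded_iff_forall_norm_le.2 ⟨ρ, fun w hw => (norm_le_vn w).trans hw.2⟩

lemma D_bdd (xt : Fin n → ℝ) : ∃ R, ∀ w ∈ Dset n xt, vn w ≤ R := by
  refine ⟨∑ i, 2 * |xt i|, fun w hw => (vn_le_sum_abs w).trans ?_⟩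
  have : ∀ i, |w i| ≤ w i + 2 * |xt i| := fun i => by
    have := hw.1 i; have := le_abs_self (xt i); have := abs_nonneg (xt i)
    exact abs_le.2 ⟨by linarith, by linarith⟩
  calc _ ≤ ∑ i, (w i + 2 * |xt i|) := Finset.sum_le_sum fun i _ => this i
    _ = ∑ i, w i + ∑ i, 2 * |xt i| := Finset.sum_add_distrib
    _ ≤ _ := by have := hw.2; linarith

lemma cont_res (ω) : Continuous (fun w => vn (res m n ω w)) := by
  refine cont_vn.comp (continuous_pi fun i => ?_)
  unfold res; fun_prop

lemma min_exists (xt : Fin n → ℝ) (hxt : ∀ i, 0 ≤ xt i) (ω) : ∃ w, LMin m n xt ω w := by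
  obtain ⟨R, hR⟩ := D_bdd xt
  have e : Dset n xt ∩ {w | vn w ≤ R} = Dset n xt := Set.inter_eq_left.2 fun w hw => hR w hw
  have hc := cpt_ball xt R
  rw [e] at hc
  obtain ⟨w, hw, h⟩ := hc.exists_isMinOn ⟨0, zero_D xt hxt⟩ (cont_res (m := m) ω).continuousOn
  exact ⟨w, hw, fun w' hw' => h hw'⟩

lemma res_comb (ω) (w w' : Fin n → ℝ) (a b : ℝ) (hab : a + b = 1) :
    res m n ω (a • w + b • w') = a • res m n ω w + b • res m n ω w' := by
  funext i
  simp only [res, Pi.add_apply, Pi.smul_apply, smul_eq_mul, mul_sub]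
  have : ∑ j, ω.1 i j * (a * w j + b * w' j) = a * ∑ j, ω.1 i j * w j + b * ∑ j, ω.1 i j * w' j := by
    rw [Finset.mul_sum, Finset.mul_sum, ← Finset.sum_add_distrib]
    exact Finset.sum_congr rfl fun j _ => by ring
  rw [this]
  have : ω.2 i = a * ω.2 i + b * ω.2 i := by rw [← add_mul, hab, one_mul]
  linarith

lemma first_order (C : Set (Fin n → ℝ)) (hC : Convex ℝ C) (ω) (w2 : Fin n → ℝ) (hw2 : w2 ∈ C)
    (hmin : ∀ w ∈ C, vn (res m n ω w2) ≤ vn (res m n ω w)) (c : ℝ) (hc0 : 0 < c) (hc : c < vn (res m n ω w2)) :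
    ∃ u, vn u = 1 ∧ ∀ w ∈ C, c ≤ ∑ i, u i * res m n ω w i := by
  set a := res m n ω w2 with ha
  have hv : 0 < vn a := hc0.trans hc
  refine ⟨(vn a)⁻¹ • a, by rw [vn_smul, abs_of_pos (by positivity)]; field_simp, fun w hw => ?_⟩
  set b := res m n ω w with hb
  set D := ∑ i, a i * (b i - a i) with hD
  have key : ∀ t : ℝ, 0 < t → t ≤ 1 → 0 ≤ 2 * D + t * vn (b - a) ^ 2 := by
    intro t ht ht1
    have h1 := hmin _ (hC hw2 hw (by linarith : 0 ≤ 1 - t) ht.le (by ring))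
    rw [res_comb _ _ _ _ _ (by ring)] at h1
    have h2 : vn a ^ 2 ≤ vn ((1 - t) • a + t • b) ^ 2 := by gcongr
    have h3 : vn ((1 - t) • a + t • b) ^ 2 = vn a ^ 2 + t * (2 * D + t * vn (b - a) ^ 2) := by
      rw [vn_sq, vn_sq, vn_sq, hD, Finset.mul_sum, Finset.mul_sum, ← Finset.sum_add_distrib, Finset.mul_sum, ← Finset.sum_add_distrib]
      refine Finset.sum_congr rfl fun i _ => ?_
      simp only [Pi.add_apply, Pi.smul_apply, smul_eq_mul, Pi.sub_apply]; ring
    rw [h3] at h2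
    by_contra hcon
    push Not at hcon
    nlinarith
  have hD0 : 0 ≤ D := by
    by_contra hcon
    push Not at hcon
    set V := vn (b - a) ^ 2
    have hV : 0 ≤ V := sq_nonneg _
    have h1 := key (min 1 (-D / (V + 1))) (lt_min one_pos (by apply div_pos <;> linarith)) (min_le_left _ _)
    have h2 : min 1 (-D / (V + 1)) * V ≤ -D := by
      calc _ ≤ (-D / (V + 1)) * V := by gcongr; exact min_le_right _ _
        _ ≤ _ := by
          rw [div_mul_eq_mul_div, div_le_iff₀ (by linarith)]; nlinarith
    linarith
  have e : ∑ i, ((vn a)⁻¹ • a) i * b i = (vn a)⁻¹ * (D + vn a ^ 2) := by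
    rw [vn_sq, hD, ← Finset.sum_add_distrib, Finset.mul_sum]
    refine Finset.sum_congr rfl fun i _ => ?_
    simp only [Pi.smul_apply, smul_eq_mul]; ring
  rw [e, inv_mul_eq_div, le_div_iff₀ hv]
  nlinarith

lemma ivt_seg (w w' : Fin n → ℝ) (ρ : ℝ) (h1 : vn w ≤ ρ) (h2 : ρ ≤ vn w') :
    ∃ t ∈ Set.Icc (0:ℝ) 1, vn ((1 - t) • w + t • w') = ρ := by
  have hc : ContinuousOn (fun t : ℝ => vn ((1 - t) • w + t • w')) (Set.Icc 0 1) :=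
    (cont_vn.comp (by fun_prop : Continuous fun t : ℝ => (1 - t) • w + t • w')).continuousOn
  have := intermediate_value_Icc zero_le_one hc
  obtain ⟨t, ht, e⟩ := this (show ρ ∈ _ by simp [h1, h2])
  exact ⟨t, ht, e⟩

lemma det_up (xt : Fin n → ℝ) (hxt : ∀ i, 0 ≤ xt i) (ω) (r ρ c : ℝ) (hr : 0 ≤ r) (hrρ : r ≤ ρ) (hc : 0 < c) (w : Fin n → ℝ)
    (hw : LMin m n xt ω w) (hwρ : ρ < vn w) :
    (∃ w' ∈ Dset n xt ∩ {w | vn w = ρ}, vn (res m n ω w') ≤ c) ∨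
    ∃ u, vn u = 1 ∧ ∀ w ∈ Dset n xt ∩ {w | vn w ≤ r}, c ≤ ∑ i, u i * res m n ω w i := by
  obtain ⟨w2, hw2, h2⟩ := (cpt_ball xt r).exists_isMinOn ⟨0, zero_D xt hxt, by simpa [vn_zero] using hr⟩ (cont_res (m := m) ω).continuousOn
  by_cases hcc : vn (res m n ω w2) ≤ c
  · left
    obtain ⟨t, ht, e⟩ := ivt_seg w2 w ρ (hw2.2.trans hrρ) hwρ.le
    refine ⟨_, ⟨convex_D xt hw2.1 hw.1 (by linarith [ht.2]) ht.1 (by ring), e⟩, ?_⟩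
    rw [res_comb _ _ _ _ _ (by ring)]
    have h3 := hw.2 w2 hw2.1
    have h4 : 0 ≤ 1 - t := by linarith [ht.2]
    calc _ ≤ _ := vn_add_le _ _
      _ = (1 - t) * vn (res m n ω w2) + t * vn (res m n ω w) := by rw [vn_smul, vn_smul, abs_of_nonneg h4, abs_of_nonneg ht.1]
      _ ≤ (1 - t) * c + t * c := by
        have := ht.1
        have := h3.trans hcc
        gcongr
      _ = c := by ring
  · right
    push Not at hcc
    exact first_order _ ((convex_D xt).inter (convex_vn r)) ω w2 hw2 (fun w hw => h2 hw) c hc hcc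

lemma det_low (xt : Fin n → ℝ) (ω) (ρ c : ℝ) (hc : 0 < c) (w : Fin n → ℝ)
    (hw : LMin m n xt ω w) (hwρ : vn w ≤ ρ) :
    (∃ w' ∈ Dset n xt ∩ {w | vn w ≤ ρ}, vn (res m n ω w') ≤ c) ∨
    ∃ u, vn u = 1 ∧ ∀ w ∈ Dset n xt, c ≤ ∑ i, u i * res m n ω w i := by
  by_cases hcc : vn (res m n ω w) ≤ c
  · exact Or.inl ⟨w, ⟨hw.1, hwρ⟩, hcc⟩
  · push Not at hcc
    exact Or.inr (first_order _ (convex_D xt) ω w hw.1 hw.2 c hc hcc)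
end det

lemma exp_kappa (κ u : ℝ) (h0 : 0 ≤ κ) (h1 : κ ≤ 1) : Real.exp (κ * u) ≤ 1 + κ * (Real.exp u - 1) := by
  have := convexOn_exp.2 (Set.mem_univ u) (Set.mem_univ 0) h0 (by linarith : 0 ≤ 1 - κ) (by ring)
  simp only [smul_eq_mul, mul_zero, add_zero, Real.exp_zero, mul_one] at this
  linarith

lemma conc_kappa {T K : Type} [Fintype T] [Nonempty T] [DecidableEq T] [Fintype K] [DecidableEq K] (v : T → K → ℝ) (ρ : ℝ) (hv : ∀ y, vn (v y) ≤ ρ)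
    (lam : ℝ) (hl : 0 < lam) (κ : ℝ) (h0 : 0 ≤ κ) (h1 : κ ≤ 1) :
    ∫ h, Real.exp (-(κ * lam) * Phi v h) ∂(stdG K) ≤
      Real.exp (κ * (lam ^ 2 * ρ ^ 2 - Real.log (∫ h, Real.exp (lam * Phi v h) ∂(stdG K)))) := by
  set B := ∫ h, Real.exp (lam * Phi v h) ∂(stdG K) with hB
  set M := ∫ h, Real.exp (-lam * Phi v h) ∂(stdG K) with hM
  have B0 : 0 < B := integral_exp_pos (integrable_exp_Phi v lam)
  have iM := integrable_exp_Phi v (-lam)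
  have M0 : 0 < M := integral_exp_pos iM
  have hc := conc v ρ hv lam hl
  have L : Real.log M ≤ lam ^ 2 * ρ ^ 2 - Real.log B := by
    have := Real.log_le_log (mul_pos B0 M0) hc
    rw [Real.log_mul B0.ne' M0.ne', Real.log_exp] at this
    linarith
  have key : ∀ h, Real.exp (-(κ * lam) * Phi v h) ≤ Real.exp (κ * Real.log M) * (1 - κ) + Real.exp (κ * Real.log M) * κ / M * Real.exp (-lam * Phi v h) := by
    intro h
    have := exp_kappa κ (-lam * Phi v h - Real.log M) h0 h1
    rw [Real.exp_sub, Real.exp_log M0] at this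
    have e : -(κ * lam) * Phi v h = κ * Real.log M + κ * (-lam * Phi v h - Real.log M) := by ring
    rw [e, Real.exp_add]
    refine (mul_le_mul_of_nonneg_left this (Real.exp_pos _).le).trans (le_of_eq ?_)
    ring
  have i2 := iM.const_mul (Real.exp (κ * Real.log M) * κ / M)
  have i1 := integrable_const (μ := stdG K) (Real.exp (κ * Real.log M) * (1 - κ))
  calc _ ≤ _ := integral_mono (integrable_exp_Phi v _) (i1.add i2) key
    _ = Real.exp (κ * Real.log M) * (1 - κ) + Real.exp (κ * Real.log M) * κ / M * M := by
      refine (integral_add' i1 i2).trans ?_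
      rw [integral_const_mul (Real.exp (κ * Real.log M) * κ / M), ← hM]; simp
    _ = Real.exp (κ * Real.log M) := by rw [div_mul_cancel₀ _ M0.ne']; ring
    _ ≤ _ := by apply Real.exp_le_exp.2; gcongr

set_option maxHeartbeats 1000000 in
lemma up_core (m n k : ℕ) (hm : 0 < m) (hn : 1 ≤ n) (σ : ℝ) (hσ : 0 < σ) (xt : Fin n → ℝ) (hxt : kSparseNonneg n k xt)
    (l : ℝ) (hl : 0 ≤ l) (r ρ : ℝ) (hr : 0 < r) (hrρ : r < ρ) (τ : ℝ) (hτ : 0 < τ) (δ : ℝ) (hδ : 0 < δ) 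
    (P Pm q s sr ζ : ℝ) (hs : s = Real.sqrt (σ ^ 2 + ρ ^ 2)) (hsr : sr = Real.sqrt (σ ^ 2 + r ^ 2))
    (hA1 : ∫ g, Real.exp (-((τ * ((1 - δ) * s)) * Real.sqrt n) * vn g) ∂(stdG (Fin m)) ≤ 2 * Real.exp (-((τ * ((1 - δ) * s)) * n * Pm)))
    (hA2 : ∫ g, Real.exp ((τ * sr) * Real.sqrt n * vn g) ∂(stdG (Fin m)) ≤ Real.exp ((τ * sr) * n * P))
    (hB : Integrable (fun h => Real.exp ((τ * ρ) * Real.sqrt n * Real.sqrt (T0 n k l h))) (stdG (Fin n)) ∧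
      ∫ h, Real.exp ((τ * ρ) * Real.sqrt n * Real.sqrt (T0 n k l h)) ∂(stdG (Fin n)) ≤ Real.exp ((τ * ρ) * n * q))
    (hpos : ρ * q + ζ < (1 - δ) * s * Pm) :
    (muAv m n σ).real {ω | ∃ w, LMin m n xt ω w ∧ ρ < vn w} ≤
      2 * Real.exp (-n) + 8 * Real.exp (-(τ * n * ζ) + τ * Real.sqrt n + τ ^ 2 * n * σ ^ 2 / 2) +
      4 * Real.exp (τ * n * (ζ - (1 - δ) * s * Pm + (ρ - r) * q + sr * P + τ * (r * ρ)) + τ * Real.sqrt n + τ ^ 2 * n * σ ^ 2 / 2) := by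
  classical
  have hnp : (0:ℝ) < n := by exact_mod_cast hn
  set sn := Real.sqrt n with hsn
  have hsn0 : 0 < sn := Real.sqrt_pos.2 hnp
  have hsn2 : sn ^ 2 = n := Real.sq_sqrt hnp.le
  have hρ : 0 < ρ := hr.trans hrρ
  by_cases hK : (Dset n xt ∩ {w | vn w = ρ}).Nonempty
  swap
  · have : {ω | ∃ w, LMin m n xt ω w ∧ ρ < vn w} = ∅ := by
      ext ω
      simp only [Set.mem_setOf_eq, Set.mem_empty_iff_false, iff_false]
      rintro ⟨w, hw, hwρ⟩
      obtain ⟨t, ht, e⟩ := ivt_seg 0 w ρ (by rw [vn_zero]; exact hρ.le) hwρ.le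
      exact hK ⟨_, convex_D xt (zero_D xt hxt.2) hw.1 (by linarith [ht.2]) ht.1 (by ring), e⟩
    rw [this, measureReal_empty]; positivity
  set lam := τ * sn with hlam
  have hlam0 : 0 < lam := by positivity
  obtain ⟨T, hTne, hTS, HPL⟩ := PL m n hm σ hσ _ hK ρ (fun w hw => le_of_eq hw.2) δ hδ lam hlam0 (Real.exp (-n)) (Real.exp_pos _)
  haveI : Nonempty T := hTne.to_subtype
  set v : T → Fin n → ℝ := fun y => y.1 with hv
  have hvρ : ∀ y, vn (v y) = ρ := fun y => (hTS y.2).2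
  set Ph := Phi v with hPh
  have mPh : Measurable Ph := measurable_Phi v
  set B1 := ∫ h, Real.exp (lam * Ph h) ∂(stdG (Fin n)) with hB1
  have B0 : 0 < B1 := integral_exp_pos (integrable_exp_Phi v lam)
  set L1 := Real.log B1 with hL1
  have eB1 : B1 = Real.exp L1 := (Real.exp_log B0).symm
  have hL1q : L1 ≤ τ * ρ * n * q := by
    rw [hL1, ← Real.log_exp (τ * ρ * n * q)]
    refine Real.log_le_log B0 (le_trans (integral_mono (integrable_exp_Phi v lam) hB.1 fun h => ?_) hB.2)
    apply Real.exp_le_exp.2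
    obtain ⟨y, hy⟩ := exists_Phi v h
    have := cone_ineq n k l hl xt (v y) h hxt.1 (hTS y.2).1
    rw [hvρ, hy] at this
    calc lam * Phi v h ≤ lam * (ρ * Real.sqrt (T0 n k l h)) := by gcongr
      _ = _ := by rw [hlam]; ring
  set κ := r / ρ with hκ
  have hκ0 : 0 < κ := by positivity
  have hκ1 : κ ≤ 1 := (div_le_one hρ).2 hrρ.le
  have hκρ : κ * ρ = r := by rw [hκ]; field_simp
  have hBm := conc_kappa v ρ (fun y => (hvρ y).le) lam hlam0 κ hκ0.le hκ1
  rw [← hPh, ← hB1, ← hL1] at hBm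
  set c := ((1 - δ) * s * Pm - ζ) * sn - L1 / (τ * sn) with hc
  have hlc : lam * c = τ * n * ((1 - δ) * s * Pm - ζ) - L1 := by
    rw [hc, hlam, mul_sub, mul_div_cancel₀ _ hlam0.ne', ← hsn2]; ring
  have hc0 : 0 < c := by
    have : 0 < lam * c := by
      rw [hlc]
      have : τ * n * (ρ * q) < τ * n * ((1 - δ) * s * Pm - ζ) := by
        apply mul_lt_mul_of_pos_left _ (by positivity); linarith
      nlinarith
    exact (mul_pos_iff_of_pos_left hlam0).1 this
  have mvm : Measurable (vn : (Fin m → ℝ) → ℝ) := meas_vn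
  have P1 := HPL c (fun g => Real.exp (-((τ * ((1 - δ) * s)) * sn) * vn g)) (fun _ => 0) (fun h => Real.exp (lam * Ph h)) (fun _ => 0)
    (by fun_prop) measurable_const (by fun_prop) measurable_const (integrable_exp_vn _) (integrable_const _)
    (integrable_exp_Phi v lam) (integrable_const _) (fun _ => (Real.exp_pos _).le) (fun _ => le_rfl) (fun _ => (Real.exp_pos _).le) (fun _ => le_rfl)
    (by
      intro g h w hw
      have e : vn w = ρ := (hTS hw).2
      have e2 := le_Phi v h ⟨w, hw⟩
      rw [e, ← hs, mul_zero, add_zero, ← Real.exp_add]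
      apply Real.exp_le_exp.2
      have := mul_le_mul_of_nonneg_left e2 hlam0.le
      rw [hlam] at *
      simp only [hv] at this
      simp only [hPh]
      linarith)
  simp only [integral_const, smul_eq_mul, mul_zero, add_zero] at P1
  rw [← hB1] at P1
  set Y : Finset (Fin n → ℝ) := T.image (fun w => κ • w) with hY
  have hYD : ∀ w ∈ Y, w ∈ Dset n xt ∩ {w | vn w ≤ r} := by
    intro w hw
    obtain ⟨y, hy, rfl⟩ := Finset.mem_image.1 hw
    have hyT := hTS hy
    refine ⟨?_, ?_⟩
    · have := convex_D xt (zero_D xt hxt.2) hyT.1 (by linarith : 0 ≤ 1 - κ) hκ0.le (by ring)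
      simpa using this
    · change vn (κ • y) ≤ r
      have : vn y = ρ := hyT.2
      rw [vn_smul, abs_of_pos hκ0, this, hκρ]
  have P2 := PU m n hm σ hσ Y (hTne.image _) lam hlam0 (Real.exp (-n)) (Real.exp_pos _) c
    (fun g => Real.exp ((τ * sr) * sn * vn g)) (fun h => Real.exp (-(κ * lam) * Ph h))
    (by fun_prop) (by fun_prop) (integrable_exp_vn _) (integrable_exp_Phi v _) (fun _ => (Real.exp_pos _).le) (fun _ => (Real.exp_pos _).le)
    (by
      intro g h
      obtain ⟨y, hy⟩ := exists_Phi v h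
      refine ⟨κ • y.1, Finset.mem_image_of_mem _ y.2, ?_⟩
      have e : vn (κ • y.1) = r := by
        have := hvρ y
        rw [vn_smul, abs_of_pos hκ0, show vn y.1 = ρ from this, hκρ]
      have e2 : ∑ j, (κ • y.1) j * h j = κ * Ph h := by
        rw [hPh, ← hy, Finset.mul_sum]
        exact Finset.sum_congr rfl fun j _ => by simp only [Pi.smul_apply, smul_eq_mul, hv]; ring
      rw [e, e2, ← hsr, ← Real.exp_add]
      apply Real.exp_le_exp.2
      rw [hlam]; apply le_of_eq; ring)
  have incl : {ω | ∃ w, LMin m n xt ω w ∧ ρ < vn w} ⊆ {ω | ∃ w ∈ Dset n xt ∩ {w | vn w = ρ}, vn (res m n ω w) ≤ c} ∪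
      {ω | ∃ u, vn u = 1 ∧ ∀ w ∈ Y, c ≤ ∑ i, u i * res m n ω w i} := by
    rintro ω ⟨w, hw, hwρ⟩
    rcases det_up xt hxt.2 ω r ρ c hr.le hrρ.le hc0 w hw hwρ with h | ⟨u, hu, h⟩
    · exact Or.inl h
    · exact Or.inr ⟨u, hu, fun w hw => h w (hYD w hw)⟩
  have tot := (measureReal_mono incl (by finiteness)).trans (measureReal_union_le (μ := muAv m n σ) _ _)
  have Q1 : 4 * Real.exp (lam * (c + 1) + lam ^ 2 * σ ^ 2 / 2) * ((∫ g, Real.exp (-((τ * ((1 - δ) * s)) * sn) * vn g) ∂(stdG (Fin m))) * B1)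
      ≤ 8 * Real.exp (-(τ * n * ζ) + τ * sn + τ ^ 2 * n * σ ^ 2 / 2) := by
    calc _ ≤ 4 * Real.exp (lam * (c + 1) + lam ^ 2 * σ ^ 2 / 2) * ((2 * Real.exp (-((τ * ((1 - δ) * s)) * n * Pm))) * Real.exp L1) := by
          rw [← eB1]; gcongr
      _ = 8 * (Real.exp (lam * (c + 1) + lam ^ 2 * σ ^ 2 / 2) * (Real.exp (-((τ * ((1 - δ) * s)) * n * Pm)) * Real.exp L1)) := by ring
      _ = _ := by
        rw [← Real.exp_add, ← Real.exp_add]; congr 2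
        rw [mul_add, hlc, hlam, ← hsn2]; ring
  have Q2 : 4 * Real.exp (-lam * (c - 1) + lam ^ 2 * σ ^ 2 / 2) * ((∫ g, Real.exp ((τ * sr) * sn * vn g) ∂(stdG (Fin m))) * ∫ h, Real.exp (-(κ * lam) * Ph h) ∂(stdG (Fin n)))
      ≤ 4 * Real.exp (τ * n * (ζ - (1 - δ) * s * Pm + (ρ - r) * q + sr * P + τ * (r * ρ)) + τ * sn + τ ^ 2 * n * σ ^ 2 / 2) := by
    calc _ ≤ 4 * Real.exp (-lam * (c - 1) + lam ^ 2 * σ ^ 2 / 2) * (Real.exp ((τ * sr) * n * P) * Real.exp (κ * (lam ^ 2 * ρ ^ 2 - L1))) := by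
          gcongr
      _ = 4 * Real.exp ((-lam * (c - 1) + lam ^ 2 * σ ^ 2 / 2) + ((τ * sr) * n * P + κ * (lam ^ 2 * ρ ^ 2 - L1))) := by
          rw [mul_assoc, ← Real.exp_add, ← Real.exp_add]
      _ ≤ _ := by
        refine mul_le_mul_of_nonneg_left (Real.exp_le_exp.2 ?_) (by norm_num)
        have e1 : -lam * (c - 1) = -(lam * c) + lam := by ring
        have e2 : κ * (lam ^ 2 * ρ ^ 2 - L1) = lam ^ 2 * (r * ρ) - κ * L1 := by
          rw [← hκρ]; ring
        have e3 : lam ^ 2 = τ ^ 2 * n := by rw [hlam, mul_pow, hsn2]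
        rw [e1, e2, hlc, e3]
        have e4 : (1 - κ) * L1 ≤ (1 - κ) * (τ * ρ * n * q) := mul_le_mul_of_nonneg_left hL1q (by linarith)
        have e5 : (1 - κ) * (τ * ρ * n * q) = τ * n * ((ρ - r) * q) := by rw [← hκρ]; ring
        rw [e5] at e4
        nlinarith
  linarith

lemma exp_interp (a b x : ℝ) (hx0 : 0 ≤ x) (hx1 : x ≤ 1) : Real.exp ((1 - x) * a + x * b) ≤ Real.exp a + Real.exp b := by
  rcases le_total a b with h | h
  · have : (1 - x) * a + x * b ≤ b := by nlinarith
    have := Real.exp_le_exp.2 this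
    have := Real.exp_pos a
    linarith
  · have : (1 - x) * a + x * b ≤ a := by nlinarith
    have := Real.exp_le_exp.2 this
    have := Real.exp_pos b
    linarith

lemma s_tangent (σ x ρ s : ℝ) (hσ : 0 < σ) (hs : s = Real.sqrt (σ ^ 2 + ρ ^ 2)) : (σ ^ 2 + x * ρ) / s ≤ Real.sqrt (σ ^ 2 + x ^ 2) := by
  have hs0 : 0 < s := by rw [hs]; exact Real.sqrt_pos.2 (by positivity)
  rw [div_le_iff₀ hs0, hs, ← Real.sqrt_mul (by positivity)]
  apply Real.le_sqrt_of_sq_le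
  nlinarith [sq_nonneg (σ * x - σ * ρ)]

set_option maxHeartbeats 1000000 in
lemma low_core (m n k : ℕ) (hm : 0 < m) (hn : 1 ≤ n) (σ : ℝ) (hσ : 0 < σ) (xt : Fin n → ℝ) (hxt : kSparseNonneg n k xt)
    (l : ℝ) (hl : 0 ≤ l) (r ρ : ℝ) (hr : 0 < r) (hρ : 0 < ρ) (τ : ℝ) (hτ : 0 < τ) (δ : ℝ) (hδ : 0 < δ) (hδ1 : δ ≤ 1)
    (P Pm q q2 s sr C : ℝ) (hs : s = Real.sqrt (σ ^ 2 + ρ ^ 2)) (hsr : sr = Real.sqrt (σ ^ 2 + r ^ 2))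
    (hA1 : ∫ g, Real.exp (-((τ * ((1 - δ) * (σ ^ 2 / s))) * Real.sqrt n) * vn g) ∂(stdG (Fin m)) ≤ 2 * Real.exp (-((τ * ((1 - δ) * (σ ^ 2 / s))) * n * Pm)))
    (hA1' : ∫ g, Real.exp (-((τ * ((1 - δ) * s)) * Real.sqrt n) * vn g) ∂(stdG (Fin m)) ≤ 2 * Real.exp (-((τ * ((1 - δ) * s)) * n * Pm)))
    (hA2 : ∫ g, Real.exp ((τ * sr) * Real.sqrt n * vn g) ∂(stdG (Fin m)) ≤ Real.exp ((τ * sr) * n * P))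
    (hB : Integrable (fun h => Real.exp ((τ * ρ) * Real.sqrt n * Real.sqrt (T0 n k l h))) (stdG (Fin n)) ∧
      ∫ h, Real.exp ((τ * ρ) * Real.sqrt n * Real.sqrt (T0 n k l h)) ∂(stdG (Fin n)) ≤ Real.exp ((τ * ρ) * n * q))
    (hY : ∃ Y : Finset (Fin n → ℝ), Y.Nonempty ∧ ↑Y ⊆ Dset n xt ∧ ∃ b : (Fin n → ℝ) → ℝ,
        Measurable b ∧ Integrable b (stdG (Fin n)) ∧ (∀ h, 0 ≤ b h) ∧
        (∀ V : ℝ, 0 ≤ V → ∀ h, ∃ w ∈ Y, Real.exp (τ * Real.sqrt n * (Real.sqrt (σ ^ 2 + vn w ^ 2) * V - ∑ j, w j * h j)) ≤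
          Real.exp (τ * Real.sqrt n * Real.sqrt (σ ^ 2 + r ^ 2) * V) * b h) ∧
        ∫ h, b h ∂(stdG (Fin n)) ≤ 5 * Real.exp (-(τ * n * (r * q2))))
    (hC : 0 < C) :
    (muAv m n σ).real {ω | ∃ w, LMin m n xt ω w ∧ vn w ≤ ρ} ≤
      2 * Real.exp (-n) + 8 * Real.exp (τ * n * (C - (1 - δ) * (σ ^ 2 / s) * Pm) + τ * Real.sqrt n + τ ^ 2 * n * σ ^ 2 / 2) +
      8 * Real.exp (τ * n * (C - (1 - δ) * s * Pm + ρ * q) + τ * Real.sqrt n + τ ^ 2 * n * σ ^ 2 / 2) +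
      20 * Real.exp (τ * n * (-C + sr * P - r * q2) + τ * Real.sqrt n + τ ^ 2 * n * σ ^ 2 / 2) := by
  classical
  have hnp : (0:ℝ) < n := by exact_mod_cast hn
  set sn := Real.sqrt n with hsn
  have hsn0 : 0 < sn := Real.sqrt_pos.2 hnp
  have hsn2 : sn ^ 2 = n := Real.sq_sqrt hnp.le
  have hs0 : 0 < s := by rw [hs]; exact Real.sqrt_pos.2 (by positivity)
  have hss : s ^ 2 = σ ^ 2 + ρ ^ 2 := by rw [hs]; exact Real.sq_sqrt (by positivity)
  set lam := τ * sn with hlam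
  have hlam0 : 0 < lam := by positivity
  obtain ⟨T, hTne, hTS, HPL⟩ := PL m n hm σ hσ (Dset n xt ∩ {w | vn w ≤ ρ}) ⟨0, zero_D xt hxt.2, by simpa [vn_zero] using hρ.le⟩ ρ (fun w hw => hw.2) δ hδ lam hlam0 (Real.exp (-n)) (Real.exp_pos _)
  obtain ⟨Y, hYne, hYD, b, mb, ib, pb, hyp, hbI⟩ := hY
  set c := C * sn with hc
  have hc0 : 0 < c := by positivity
  have hlc : lam * c = τ * n * C := by rw [hc, hlam, ← hsn2]; ring
  have mvm : Measurable (vn : (Fin m → ℝ) → ℝ) := meas_vn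
  have mT : Measurable (fun h => T0 n k l h) := T0_meas n k l
  have P1 := HPL c (fun g => Real.exp (-((τ * ((1 - δ) * (σ ^ 2 / s))) * sn) * vn g)) (fun g => Real.exp (-((τ * ((1 - δ) * s)) * sn) * vn g)) (fun _ => 1) (fun h => Real.exp ((τ * ρ) * sn * Real.sqrt (T0 n k l h)))
    (by fun_prop) (by fun_prop) measurable_const (by fun_prop) (integrable_exp_vn _) (integrable_exp_vn _) 
    (integrable_const _) hB.1 (fun _ => (Real.exp_pos _).le) (fun _ => (Real.exp_pos _).le) (fun _ => zero_le_one) (fun _ => (Real.exp_pos _).le)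
    (by
      intro g h w hw
      have hwT := hTS hw
      have hwρ : vn w ≤ ρ := hwT.2
      have hw0 := vn_nonneg w
      have hg0 := vn_nonneg g
      have hcone := cone_ineq n k l hl xt w h hxt.1 hwT.1
      have htan := s_tangent σ (vn w) ρ s hσ hs
      have := exp_interp (-((τ * ((1 - δ) * (σ ^ 2 / s))) * sn) * vn g) (-((τ * ((1 - δ) * s)) * sn) * vn g + (τ * ρ) * sn * Real.sqrt (T0 n k l h)) (vn w / ρ) (by positivity) ((div_le_one hρ).2 hwρ)
      rw [mul_one, ← Real.exp_add]
      refine le_trans (Real.exp_le_exp.2 ?_) this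
      have e1 : (1 - vn w / ρ) * (-((τ * ((1 - δ) * (σ ^ 2 / s))) * sn) * vn g) + vn w / ρ * (-((τ * ((1 - δ) * s)) * sn) * vn g + (τ * ρ) * sn * Real.sqrt (T0 n k l h))
         = -lam * ((1 - δ) * ((σ ^ 2 + vn w * ρ) / s) * vn g - vn w * Real.sqrt (T0 n k l h)) := by
        have e2 : s = (σ ^ 2 + ρ ^ 2) / s := by rw [← hss]; field_simp
        have e3 : -((τ * ((1 - δ) * s)) * sn) * vn g = -((τ * ((1 - δ) * ((σ ^ 2 + ρ ^ 2) / s))) * sn) * vn g := by rw [← e2]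
        rw [e3, hlam]; field_simp; ring
      rw [e1, neg_mul, neg_mul, neg_le_neg_iff]
      apply mul_le_mul_of_nonneg_left _ hlam0.le
      have : (1 - δ) * ((σ ^ 2 + vn w * ρ) / s) * vn g ≤ (1 - δ) * Real.sqrt (σ ^ 2 + vn w ^ 2) * vn g := by
        have : 0 ≤ 1 - δ := by linarith
        gcongr
      linarith)
  have P2 := PU m n hm σ hσ Y hYne lam hlam0 (Real.exp (-n)) (Real.exp_pos _) c
    (fun g => Real.exp ((τ * sr) * sn * vn g)) b
    (by fun_prop) mb (integrable_exp_vn _) ib (fun _ => (Real.exp_pos _).le) pb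
    (by
      intro g h
      obtain ⟨w, hw, h1⟩ := hyp (vn g) (vn_nonneg g) h
      refine ⟨w, hw, h1.trans (le_of_eq ?_)⟩
      rw [← hsr, hlam]; ring_nf)
  have incl : {ω | ∃ w, LMin m n xt ω w ∧ vn w ≤ ρ} ⊆ {ω | ∃ w ∈ Dset n xt ∩ {w | vn w ≤ ρ}, vn (res m n ω w) ≤ c} ∪
      {ω | ∃ u, vn u = 1 ∧ ∀ w ∈ Y, c ≤ ∑ i, u i * res m n ω w i} := by
    rintro ω ⟨w, hw, hwρ⟩
    rcases det_low xt ω ρ c hc0 w hw hwρ with h | ⟨u, hu, h⟩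
    · exact Or.inl h
    · exact Or.inr ⟨u, hu, fun w hw => h w (hYD hw)⟩
  have tot := (measureReal_mono incl (by finiteness)).trans (measureReal_union_le (μ := muAv m n σ) _ _)
  simp only [integral_const, probReal_univ, smul_eq_mul, mul_one] at P1
  have Q1 : 4 * Real.exp (lam * (c + 1) + lam ^ 2 * σ ^ 2 / 2) * ((∫ g, Real.exp (-((τ * ((1 - δ) * (σ ^ 2 / s))) * sn) * vn g) ∂(stdG (Fin m))) + (∫ g, Real.exp (-((τ * ((1 - δ) * s)) * sn) * vn g) ∂(stdG (Fin m))) * ∫ h, Real.exp ((τ * ρ) * sn * Real.sqrt (T0 n k l h)) ∂(stdG (Fin n)))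
      ≤ 8 * Real.exp (τ * n * (C - (1 - δ) * (σ ^ 2 / s) * Pm) + τ * sn + τ ^ 2 * n * σ ^ 2 / 2) +
      8 * Real.exp (τ * n * (C - (1 - δ) * s * Pm + ρ * q) + τ * sn + τ ^ 2 * n * σ ^ 2 / 2) := by
    calc _ ≤ 4 * Real.exp (lam * (c + 1) + lam ^ 2 * σ ^ 2 / 2) * (2 * Real.exp (-((τ * ((1 - δ) * (σ ^ 2 / s))) * n * Pm)) + (2 * Real.exp (-((τ * ((1 - δ) * s)) * n * Pm))) * Real.exp ((τ * ρ) * n * q)) := by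
          have h1 := hB.2
          gcongr
      _ = 8 * (Real.exp (lam * (c + 1) + lam ^ 2 * σ ^ 2 / 2) * (Real.exp (-((τ * ((1 - δ) * (σ ^ 2 / s))) * n * Pm)))) + 8 * (Real.exp (lam * (c + 1) + lam ^ 2 * σ ^ 2 / 2) * (Real.exp (-((τ * ((1 - δ) * s)) * n * Pm)) * Real.exp ((τ * ρ) * n * q))) := by ring
      _ = _ := by
        rw [← Real.exp_add, ← Real.exp_add, ← Real.exp_add, mul_add, hlc]
        congr 3 <;> (rw [hlam, ← hsn2]; ring)
  have Q2 : 4 * Real.exp (-lam * (c - 1) + lam ^ 2 * σ ^ 2 / 2) * ((∫ g, Real.exp ((τ * sr) * sn * vn g) ∂(stdG (Fin m))) * ∫ h, b h ∂(stdG (Fin n)))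
      ≤ 20 * Real.exp (τ * n * (-C + sr * P - r * q2) + τ * sn + τ ^ 2 * n * σ ^ 2 / 2) := by
    calc _ ≤ 4 * Real.exp (-lam * (c - 1) + lam ^ 2 * σ ^ 2 / 2) * (Real.exp ((τ * sr) * n * P) * (5 * Real.exp (-(τ * n * (r * q2))))) := by
          have : 0 ≤ ∫ h, b h ∂(stdG (Fin n)) := integral_nonneg pb
          gcongr
      _ = 20 * (Real.exp (-lam * (c - 1) + lam ^ 2 * σ ^ 2 / 2) * (Real.exp ((τ * sr) * n * P) * (Real.exp (-(τ * n * (r * q2)))))) := by ring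
      _ = _ := by
        rw [← Real.exp_add, ← Real.exp_add]; congr 2
        have e1 : -lam * (c - 1) = -(lam * c) + lam := by ring
        rw [e1, hlc, hlam, ← hsn2]; ring
  linarith

lemma small (a b : ℝ) (hb : 0 < b) : ∀ᶠ τ in nhdsWithin (0:ℝ) (Set.Ioi 0), τ * a ≤ b := by
  have : Filter.Tendsto (fun τ : ℝ => τ * a) (nhdsWithin (0:ℝ) (Set.Ioi 0)) (nhds (0 * a)) :=
    ((continuous_id.mul continuous_const).tendsto 0).mono_left nhdsWithin_le_nhds
  rw [zero_mul] at this
  exact this.eventually (eventually_le_nhds hb)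

lemma absorb (K c : ℝ) (hc : 0 < c) : ∃ N : ℕ, ∀ n : ℕ, n ≥ N → K * Real.exp (-(c * n)) ≤ Real.exp (-(c / 2 * n)) := by
  obtain ⟨N, hN⟩ := exists_nat_ge (K / (c / 2))
  refine ⟨N, fun n hn => ?_⟩
  have h1 : K ≤ c / 2 * n := by
    have : (N:ℝ) ≤ n := by exact_mod_cast hn
    rw [div_le_iff₀ (by positivity)] at hN
    nlinarith
  have h2 : K ≤ Real.exp (c / 2 * n) := by
    have := Real.add_one_le_exp (c / 2 * n); linarith
  calc K * Real.exp (-(c * n)) ≤ Real.exp (c / 2 * n) * Real.exp (-(c * n)) := by gcongr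
    _ = _ := by rw [← Real.exp_add]; congr 1; ring

lemma expo (τ X a σ : ℝ) (n : ℕ) (hτ : 0 < τ) (ha : 0 < a) (hX : X ≤ -a) (h1 : τ * σ ^ 2 ≤ a / 2) (hn : 16 / a ^ 2 ≤ n) :
    Real.exp (τ * n * X + τ * Real.sqrt n + τ ^ 2 * n * σ ^ 2 / 2) ≤ Real.exp (-(τ * a / 2 * n)) := by
  apply Real.exp_le_exp.2
  have hn0 : (0:ℝ) ≤ n := Nat.cast_nonneg n
  have h2 : Real.sqrt n ≤ a / 4 * n := by
    apply Real.sqrt_le_iff.2 ⟨by positivity, ?_⟩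
    rw [div_le_iff₀ (by positivity)] at hn
    nlinarith
  have h3 : τ * n * X ≤ τ * n * (-a) := by gcongr
  have h4 : τ * Real.sqrt n ≤ τ * (a / 4 * n) := by gcongr
  have h5 : τ * n * (τ * σ ^ 2) ≤ τ * n * (a / 2) := by gcongr
  nlinarith

lemma exp_min1 (c1 : ℝ) (n : ℕ) : Real.exp (-(n:ℝ)) ≤ Real.exp (-(min 1 c1 * n)) := by
  apply Real.exp_le_exp.2
  have : min 1 c1 ≤ 1 := min_le_left _ _
  have : (0:ℝ) ≤ n := Nat.cast_nonneg n
  nlinarith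
lemma exp_min2 (c1 : ℝ) (n : ℕ) : Real.exp (-(c1 * n)) ≤ Real.exp (-(min 1 c1 * n)) := by
  apply Real.exp_le_exp.2
  have : min 1 c1 ≤ c1 := min_le_right _ _
  have : (0:ℝ) ≤ n := Nat.cast_nonneg n
  nlinarith

lemma mDim_pos (α : ℝ) (hα : 0 < α) (n : ℕ) (hn : 1 ≤ n) : 0 < mDim α n := by
  have : (0:ℝ) < n := by exact_mod_cast hn
  exact Nat.ceil_pos.2 (by positivity)

set_option maxHeartbeats 1000000 in
lemma prob_up (σ α β αw l r ρ : ℝ) (hσ : 0 < σ) (hα : 0 < α) (hα1 : α < 1) (hβ0 : 0 < β) (hβ1 : β < 1) (hαw : 0 < αw) (hl : 0 ≤ l)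
    (hQ : (1 - β) * Qg l = αw - β) (hφ : (1 - β) * gaussianPDFReal 0 1 l = αw * l) (hr : 0 < r) (hrρ : r < ρ)
    (p q s sr : ℝ) (hp : p = Real.sqrt α) (hq : q = Real.sqrt αw) (hs : s = Real.sqrt (σ ^ 2 + ρ ^ 2)) (hsr : sr = Real.sqrt (σ ^ 2 + r ^ 2))
    (hV : 0 < p * sr - r * q) (hΓ : 0 < p * s - p * sr - (ρ - r) * q) :
    ∃ e > (0:ℝ), ∃ N : ℕ, ∀ n ≥ N, ∀ xt, kSparseNonneg n (kDim β n) xt →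
      (muAv (mDim α n) n σ).real {ω | ∃ w, LMin (mDim α n) n xt ω w ∧ ρ < vn w} ≤ Real.exp (-(e * n)) := by
  have hp0 : 0 < p := by rw [hp]; exact Real.sqrt_pos.2 hα
  have hq0 : 0 < q := by rw [hq]; exact Real.sqrt_pos.2 hαw
  have hs0 : 0 < s := by rw [hs]; exact Real.sqrt_pos.2 (by positivity)
  have hsr0 : 0 < sr := by rw [hsr]; exact Real.sqrt_pos.2 (by positivity)
  have hρ : 0 < ρ := hr.trans hrρ
  set Γ := p * s - p * sr - (ρ - r) * q with hΓd
  obtain ⟨η, ⟨hη1, hη2⟩, hη0⟩ := (((small 1 1 one_pos).and (small (s * (p + 1) + ρ + sr) (Γ / 8) (by positivity))).and self_mem_nhdsWithin).exists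
  rw [mul_one] at hη1
  change 0 < η at hη0
  obtain ⟨τ₁, ht1, G1⟩ := g_low α hα hα1 η hη0
  obtain ⟨τ₂, ht2, N2, G2⟩ := g_up α hα η hη0
  obtain ⟨τ₃, ht3, N3, G3⟩ := T0_mgf l β αw hβ0 hβ1 hαw hQ hφ η hη0
  rw [← hp] at G1 G2
  rw [← hq] at G3
  obtain ⟨τ, ⟨⟨⟨⟨⟨k1, k2⟩, k3⟩, k4⟩, k5⟩, hτ⟩⟩ := ((((((small s τ₁ ht1).and (small sr τ₂ ht2)).and (small ρ τ₃ ht3)).and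
    (small (σ ^ 2) (Γ / 8 / 2) (by positivity))).and (small (r * ρ) (Γ / 8) (by positivity))).and self_mem_nhdsWithin).exists
  change 0 < τ at hτ
  set c1 := min 1 (τ * (Γ / 8) / 2) with hc1
  have hc10 : 0 < c1 := lt_min one_pos (by positivity)
  obtain ⟨N4, H4⟩ := absorb 14 c1 hc10
  obtain ⟨N5, H5⟩ := exists_nat_ge (16 / (Γ / 8) ^ 2)
  refine ⟨c1 / 2, by positivity, max (max (max N2 N3) (max N4 N5)) 1, fun n hn xt hxt => ?_⟩
  have n1 : 1 ≤ n := le_of_max_le_right hn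
  have nn := le_of_max_le_left hn
  have n2 : N2 ≤ n := by omega
  have n3 : N3 ≤ n := by omega
  have n4 : N4 ≤ n := by omega
  have n5 : N5 ≤ n := by omega
  have n5' : 16 / (Γ / 8) ^ 2 ≤ (n:ℝ) := H5.trans (by exact_mod_cast n5)
  have hη1' : 0 ≤ 1 - η := by linarith
  have hs1 : (1 - η) * s * (p - η) = p * s - η * (s * (p + 1)) + η ^ 2 * s := by ring
  have hs2 : 0 ≤ η ^ 2 * s := by positivity
  have core := up_core (mDim α n) n (kDim β n) (mDim_pos α hα n n1) n1 σ hσ xt hxt l hl r ρ hr hrρ τ hτ η hη0 (p + η) (p - η) (q + η) s sr (Γ / 2) hs hsr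
    (G1 n (τ * ((1 - η) * s)) (by positivity) (by
      have : (1 - η) * s ≤ s := mul_le_of_le_one_left hs0.le (by linarith)
      exact le_trans (by gcongr) k1))
    (G2 n n2 (τ * sr) (by positivity) k2) (G3 n n3 (τ * ρ) (by positivity) k3)
    (by
      rw [hs1]
      have : 0 < η * sr := by positivity
      linarith)
  have E1 : Real.exp (-(τ * n * (Γ / 2)) + τ * Real.sqrt n + τ ^ 2 * n * σ ^ 2 / 2) ≤ Real.exp (-(c1 * n)) := by
    have := expo τ (-(Γ / 2)) (Γ / 8) σ n hτ (by positivity) (by linarith) k4 n5'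
    rw [mul_neg] at this
    exact this.trans (exp_min2 _ _)
  have E2 : Real.exp (τ * n * (Γ / 2 - (1 - η) * s * (p - η) + (ρ - r) * (q + η) + sr * (p + η) + τ * (r * ρ)) + τ * Real.sqrt n + τ ^ 2 * n * σ ^ 2 / 2) ≤ Real.exp (-(c1 * n)) := by
    refine (expo τ _ (Γ / 8) σ n hτ (by positivity) ?_ k4 n5').trans (exp_min2 _ _)
    rw [hs1]
    have : 0 < η * r := by positivity
    linarith
  have E3 := exp_min1 (τ * (Γ / 8) / 2) n
  have := H4 n n4
  linarith

set_option maxHeartbeats 1000000 in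
lemma prob_low (σ α β αw l r ρ : ℝ) (hσ : 0 < σ) (hα : 0 < α) (hα1 : α < 1) (hβ0 : 0 < β) (hβ1 : β < 1) (hαw : 0 < αw) (hl : 0 ≤ l)
    (hQ : (1 - β) * Qg l = αw - β) (hφ : (1 - β) * gaussianPDFReal 0 1 l = αw * l) (hr : 0 < r) (hρ : 0 < ρ)
    (p q s sr : ℝ) (hp : p = Real.sqrt α) (hq : q = Real.sqrt αw) (hs : s = Real.sqrt (σ ^ 2 + ρ ^ 2)) (hsr : sr = Real.sqrt (σ ^ 2 + r ^ 2))
    (hV : 0 < p * sr - r * q) (hG1 : p * sr - r * q < σ ^ 2 / s * p) (hG2 : p * sr - r * q < p * s - ρ * q) :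
    ∃ e > (0:ℝ), ∃ N : ℕ, ∀ n ≥ N, ∀ xt : Fin n → ℝ, (∀ i, xt i = if n - kDim β n ≤ (i:ℕ) then r else 0) →
      (muAv (mDim α n) n σ).real {ω | ∃ w, LMin (mDim α n) n xt ω w ∧ vn w ≤ ρ} ≤ Real.exp (-(e * n)) := by
  have hp0 : 0 < p := by rw [hp]; exact Real.sqrt_pos.2 hα
  have hq0 : 0 < q := by rw [hq]; exact Real.sqrt_pos.2 hαw
  have hs0 : 0 < s := by rw [hs]; exact Real.sqrt_pos.2 (by positivity)
  have hsr0 : 0 < sr := by rw [hsr]; exact Real.sqrt_pos.2 (by positivity)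
  set V := p * sr - r * q with hVd
  set t := σ ^ 2 / s with htd
  have ht0 : 0 < t := by positivity
  obtain ⟨G, hG0, hG3, hG4⟩ : ∃ G > 0, V + 2 * G ≤ t * p ∧ V + 2 * G ≤ p * s - ρ * q := by
    refine ⟨min (t * p - V) (p * s - ρ * q - V) / 2, by have := lt_min (sub_pos.2 hG1) (sub_pos.2 hG2); linarith, ?_, ?_⟩
    · have := min_le_left (t * p - V) (p * s - ρ * q - V); linarith
    · have := min_le_right (t * p - V) (p * s - ρ * q - V); linarith
  obtain ⟨η, ⟨⟨hη1, hη2⟩, hη3⟩, hη0⟩ := ((((small 1 1 one_pos).and (small (t * (p + 1) + s * (p + 1) + ρ + sr + r) (G / 2) (by positivity))).and (small 1 q hq0)).and self_mem_nhdsWithin).exists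
  rw [mul_one] at hη1 hη3
  change 0 < η at hη0
  obtain ⟨τ₁, ht1, G1⟩ := g_low α hα hα1 η hη0
  obtain ⟨τ₂, ht2, N2, G2⟩ := g_up α hα η hη0
  obtain ⟨τ₃, ht3, N3, G3⟩ := T0_mgf l β αw hβ0 hβ1 hαw hQ hφ η hη0
  obtain ⟨τ₄, ht4, N6, G4⟩ := B_low l β αw r σ hl hβ0 hβ1 hαw hr hQ hφ η hη0 (by rw [← hq]; exact hη3)
  rw [← hp] at G1 G2
  rw [← hq] at G3 G4
  obtain ⟨τ, ⟨⟨⟨⟨⟨⟨k1, k2⟩, k3⟩, k4⟩, k5⟩, k6⟩, hτ⟩⟩ := (((((((small s τ₁ ht1).and (small sr τ₂ ht2)).and (small ρ τ₃ ht3)).and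
    (small (σ ^ 2) (G / 2 / 2) (by positivity))).and (small t τ₁ ht1)).and (small 1 τ₄ ht4)).and self_mem_nhdsWithin).exists
  change 0 < τ at hτ
  rw [mul_one] at k6
  set c1 := min 1 (τ * (G / 2) / 2) with hc1
  have hc10 : 0 < c1 := lt_min one_pos (by positivity)
  obtain ⟨N4, H4⟩ := absorb 38 c1 hc10
  obtain ⟨N5, H5⟩ := exists_nat_ge (16 / (G / 2) ^ 2)
  refine ⟨c1 / 2, by positivity, max (max (max (max N2 N6) N3) (max N4 N5)) 1, fun n hn xt hxt => ?_⟩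
  have n1 : 1 ≤ n := le_of_max_le_right hn
  have nn := le_of_max_le_left hn
  have n2 : N2 ≤ n := by omega
  have n3 : N3 ≤ n := by omega
  have n4 : N4 ≤ n := by omega
  have n5 : N5 ≤ n := by omega
  have n6 : N6 ≤ n := by omega
  have n5' : 16 / (G / 2) ^ 2 ≤ (n:ℝ) := H5.trans (by exact_mod_cast n5)
  have hη1' : 0 ≤ 1 - η := by linarith
  have hxts : kSparseNonneg n (kDim β n) xt := by
    refine ⟨fun i hi => ?_, fun i => ?_⟩
    · rw [hxt, if_neg (by omega)]
    · rw [hxt]; split_ifs <;> linarith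
  have hs1 : (1 - η) * s * (p - η) = p * s - η * (s * (p + 1)) + η ^ 2 * s := by ring
  have hs2 : 0 ≤ η ^ 2 * s := by positivity
  have ht1' : (1 - η) * t * (p - η) = t * p - η * (t * (p + 1)) + η ^ 2 * t := by ring
  have ht2' : 0 ≤ η ^ 2 * t := by positivity
  have core := low_core (mDim α n) n (kDim β n) (mDim_pos α hα n n1) n1 σ hσ xt hxts l hl r ρ hr hρ τ hτ η hη0 hη1 (p + η) (p - η) (q + η) (q - η) s sr (V + G) hs hsr
    (G1 n (τ * ((1 - η) * t)) (by positivity) (by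
      have : (1 - η) * t ≤ t := mul_le_of_le_one_left ht0.le (by linarith)
      exact le_trans (by gcongr) k5))
    (G1 n (τ * ((1 - η) * s)) (by positivity) (by
      have : (1 - η) * s ≤ s := mul_le_of_le_one_left hs0.le (by linarith)
      exact le_trans (by gcongr) k1))
    (G2 n n2 (τ * sr) (by positivity) k2) (G3 n n3 (τ * ρ) (by positivity) k3)
    (G4 n n6 τ hτ.le k6 xt hxt) (by linarith)
  have w1 : 0 < η * (t * (p + 1)) := by positivity
  have w2 : 0 < η * (s * (p + 1)) := by positivity
  have w3 : 0 < η * ρ := by positivity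
  have w4 : 0 < η * sr := by positivity
  have w5 : 0 < η * r := by positivity
  have hη2' : η * (t * (p + 1)) + η * (s * (p + 1)) + η * ρ + η * sr + η * r ≤ G / 2 := by linarith
  have E1 : Real.exp (τ * n * (V + G - (1 - η) * t * (p - η)) + τ * Real.sqrt n + τ ^ 2 * n * σ ^ 2 / 2) ≤ Real.exp (-(c1 * n)) := by
    refine (expo τ _ (G / 2) σ n hτ (by positivity) ?_ k4 n5').trans (exp_min2 _ _)
    rw [ht1']
    linarith
  have E2 : Real.exp (τ * n * (V + G - (1 - η) * s * (p - η) + ρ * (q + η)) + τ * Real.sqrt n + τ ^ 2 * n * σ ^ 2 / 2) ≤ Real.exp (-(c1 * n)) := by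
    refine (expo τ _ (G / 2) σ n hτ (by positivity) ?_ k4 n5').trans (exp_min2 _ _)
    rw [hs1]
    linarith
  have E4 : Real.exp (τ * n * (-(V + G) + sr * (p + η) - r * (q - η)) + τ * Real.sqrt n + τ ^ 2 * n * σ ^ 2 / 2) ≤ Real.exp (-(c1 * n)) := by
    refine (expo τ _ (G / 2) σ n hτ (by positivity) ?_ k4 n5').trans (exp_min2 _ _)
    linarith
  have E3 := exp_min1 (τ * (G / 2) / 2) n
  have := H4 n n4
  linarith

lemma prob_ge {Ω : Type} [MeasurableSpace Ω] (μ : Measure Ω) [IsProbabilityMeasure μ] (S B : Set Ω) (hSB : Sᶜ ⊆ B) (e : ℝ) (h : μ.real B ≤ e) :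
    μ S ≥ ENNReal.ofReal (1 - e) := by
  have e0 : 0 ≤ e := measureReal_nonneg.trans h
  rw [ENNReal.ofReal_sub _ e0, ENNReal.ofReal_one]
  refine tsub_le_iff_right.2 ?_
  calc (1 : ENNReal) = μ Set.univ := measure_univ.symm
    _ = μ (S ∪ Sᶜ) := by rw [Set.union_compl_self]
    _ ≤ μ S + μ Sᶜ := measure_union_le _ _
    _ ≤ μ S + ENNReal.ofReal e := by
      gcongr
      refine (measure_mono hSB).trans ?_
      rw [← ofReal_measureReal (μ := μ) (s := B)]
      exact ENNReal.ofReal_le_ofReal h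

lemma strict_gap (σ p q r sr s ρ : ℝ) (hσ : 0 < σ) (hp : 0 < p) (hs : s = Real.sqrt (σ ^ 2 + ρ ^ 2)) (hsr0 : 0 < sr)
    (hsr : sr ^ 2 = σ ^ 2 + r ^ 2) (hpr : p * r = q * sr) (hne : ρ ≠ r) : 0 < p * s - p * sr - (ρ - r) * q := by
  have hs0 : 0 < s := by rw [hs]; exact Real.sqrt_pos.2 (by positivity)
  have hss : s ^ 2 = σ ^ 2 + ρ ^ 2 := by rw [hs]; exact Real.sq_sqrt (by positivity)
  have h1 : σ ^ 2 + ρ * r < s * sr := by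
    apply lt_of_pow_lt_pow_left₀ 2 (by positivity)
    rw [mul_pow, hss, hsr]
    have : 0 < (ρ - r) ^ 2 := by have := sub_ne_zero.2 hne; positivity
    nlinarith [mul_pos (pow_pos hσ 2) this]
  have h2 : 0 < sr * (p * s - p * sr - (ρ - r) * q) := by
    have : sr * (p * s - p * sr - (ρ - r) * q) = p * (s * sr) - p * sr ^ 2 - (ρ - r) * (q * sr) := by ring
    rw [this, hsr, ← hpr]
    nlinarith
  exact (mul_pos_iff_of_pos_left hsr0).1 h2

set_option maxHeartbeats 1000000 in
theorem lasso_stmt19 (σ α βw αw t : ℝ) (hσ : 0 < σ)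
    (hα : α ∈ Set.Ioo (0 : ℝ) 1) (hβw : βw ∈ Set.Ioo (0 : ℝ) 1) (hβα : βw < α)
    (hαw : αw ∈ Set.Ioo (0 : ℝ) α) (ht : 0 ≤ t)
    (herf : (2 / Real.sqrt Real.pi) * ∫ s in (0 : ℝ)..t, Real.exp (-s ^ 2)
      = 2 * (1 - αw) / (1 - βw) - 1)
    (hchar : (1 - βw) * Real.sqrt (1 / (2 * Real.pi)) * Real.exp (-t ^ 2)
      = αw * (Real.sqrt 2 * t)) :
    ∀ ε₁ ∈ Set.Ioo (0 : ℝ) 1, ∃ ε₂ > (0 : ℝ), ∃ ε₃ > (0 : ℝ), ∃ N : ℕ, ∀ n ≥ N,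
      (∃ xts : Fin n → ℝ, kSparseNonneg n (kDim βw n) xts ∧
        muAv (mDim α n) n σ
          {ω | ∃ xh : Fin n → ℝ, l1norm xh ≤ l1norm xts ∧ (∀ i, 0 ≤ xh i) ∧
            lassoVal (mDim α n) n xts ω xh = zetaObjP (mDim α n) n xts ω ∧
            (1 - ε₁) * (σ * Real.sqrt (αw / (α - αw))) ≤ e2norm (xh - xts) ∧
            e2norm (xh - xts) ≤ (1 + ε₁) * (σ * Real.sqrt (αw / (α - αw)))}
        ≥ ENNReal.ofReal (1 - Real.exp (-(ε₂ * n)))) ∧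
      (∀ xts : Fin n → ℝ, kSparseNonneg n (kDim βw n) xts →
        muAv (mDim α n) n σ
          {ω | ∀ xh : Fin n → ℝ, l1norm xh ≤ l1norm xts → (∀ i, 0 ≤ xh i) →
            lassoVal (mDim α n) n xts ω xh = zetaObjP (mDim α n) n xts ω →
            e2norm (xh - xts) ≤ (1 + ε₁) * (σ * Real.sqrt (αw / (α - αw)))}
        ≥ ENNReal.ofReal (1 - Real.exp (-(ε₃ * n)))) := by
  intro ε₁ hε
  have hα0 := hα.1
  have hα1 := hα.2
  have hβ0 := hβw.1
  have hβ1 := hβw.2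
  have hw0 := hαw.1
  have hw1 := hαw.2
  have h1β : 0 < 1 - βw := by linarith
  have hd : 0 < α - αw := by linarith
  set l := Real.sqrt 2 * t with hl
  have hl0 : 0 ≤ l := by positivity
  have hQ : (1 - βw) * Qg l = αw - βw := by
    rw [hl, Qg_erf, herf]; field_simp; ring
  have hφ : (1 - βw) * gaussianPDFReal 0 1 l = αw * l := by
    rw [← hchar, pdf_std, mul_assoc]
    congr 2
    · rw [Real.sqrt_div zero_le_one, Real.sqrt_one, one_div]
    · congr 1
      rw [hl, mul_pow, Real.sq_sqrt (by norm_num)]; ring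
  set p := Real.sqrt α with hp
  set q := Real.sqrt αw with hq
  set D := Real.sqrt (α - αw) with hD
  have hp0 : 0 < p := Real.sqrt_pos.2 hα0
  have hq0 : 0 < q := Real.sqrt_pos.2 hw0
  have hD0 : 0 < D := Real.sqrt_pos.2 hd
  have hpp : p ^ 2 = α := Real.sq_sqrt hα0.le
  have hqq : q ^ 2 = αw := Real.sq_sqrt hw0.le
  have hDD : D ^ 2 = α - αw := Real.sq_sqrt hd.le
  set r := σ * Real.sqrt (αw / (α - αw)) with hr
  have hrD : r = σ * q / D := by rw [hr, Real.sqrt_div hw0.le]; ring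
  have hr0 : 0 < r := by rw [hrD]; positivity
  set sr := Real.sqrt (σ ^ 2 + r ^ 2) with hsr
  have hsrD : sr = σ * p / D := by
    rw [hsr, Real.sqrt_eq_iff_mul_self_eq (by positivity) (by positivity), hrD]
    have : D ^ 2 = p ^ 2 - q ^ 2 := by rw [hDD, hpp, hqq]
    field_simp
    linarith
  have hsr0 : 0 < sr := by rw [hsrD]; positivity
  have hsr2 : sr ^ 2 = σ ^ 2 + r ^ 2 := Real.sq_sqrt (by positivity)
  have hpr : p * r = q * sr := by rw [hrD, hsrD]; ring
  have hVD : p * sr - r * q = σ * D := by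
    rw [hrD, hsrD]
    have : D ^ 2 = p ^ 2 - q ^ 2 := by rw [hDD, hpp, hqq]
    field_simp
    linarith
  have hV : 0 < p * sr - r * q := by rw [hVD]; positivity
  have e0 := hε.1
  have e1 := hε.2
  have hrρ : r < (1 + ε₁) * r := by nlinarith
  obtain ⟨c1, hc1, N1, H1⟩ := prob_up σ α βw αw l r ((1 + ε₁) * r) hσ hα0 hα1 hβ0 hβ1 hw0 hl0 hQ hφ hr0 hrρ p q _ sr hp hq rfl hsr hV
    (strict_gap σ p q r sr _ _ hσ hp0 rfl hsr0 hsr2 hpr hrρ.ne')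
  have hρ' : 0 < (1 - ε₁) * r := mul_pos (by linarith) hr0
  have hρr : (1 - ε₁) * r < r := by nlinarith
  have hG1 : p * sr - r * q < σ ^ 2 / Real.sqrt (σ ^ 2 + ((1 - ε₁) * r) ^ 2) * p := by
    have e : p * sr - r * q = σ ^ 2 / sr * p := by rw [hVD, hsrD]; field_simp
    rw [e]
    have h0 : 0 < Real.sqrt (σ ^ 2 + ((1 - ε₁) * r) ^ 2) := Real.sqrt_pos.2 (by positivity)
    have h1 : Real.sqrt (σ ^ 2 + ((1 - ε₁) * r) ^ 2) < sr := by
      rw [hsr]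
      apply Real.sqrt_lt_sqrt (by positivity)
      gcongr
    gcongr
  have hG2 : p * sr - r * q < p * Real.sqrt (σ ^ 2 + ((1 - ε₁) * r) ^ 2) - (1 - ε₁) * r * q := by
    have := strict_gap σ p q r sr _ _ hσ hp0 rfl hsr0 hsr2 hpr hρr.ne
    linarith
  obtain ⟨c2, hc2, N2, H2⟩ := prob_low σ α βw αw l r ((1 - ε₁) * r) hσ hα0 hα1 hβ0 hβ1 hw0 hl0 hQ hφ hr0 hρ' p q _ sr hp hq rfl hsr hV hG1 hG2
  set c3 := min c1 c2 with hc3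
  have hc30 : 0 < c3 := lt_min hc1 hc2
  obtain ⟨N3, H3⟩ := absorb 2 c3 hc30
  refine ⟨c3 / 2, by positivity, c1, hc1, max (max N1 N2) N3, fun n hn => ⟨?_, ?_⟩⟩
  · set xt : Fin n → ℝ := fun i => if n - kDim βw n ≤ (i:ℕ) then r else 0 with hxt
    have hxts : kSparseNonneg n (kDim βw n) xt := by
      refine ⟨fun i hi => ?_, fun i => ?_⟩
      · simp only [hxt]; rw [if_neg (by omega)]
      · simp only [hxt]; split_ifs <;> linarith
    refine ⟨xt, hxts, ?_⟩
    have B1 := H1 n (by omega) xt hxts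
    have B2 := H2 n (by omega) xt (fun i => rfl)
    refine prob_ge _ _ ({ω | ∃ w, LMin (mDim α n) n xt ω w ∧ (1 + ε₁) * r < vn w} ∪ {ω | ∃ w, LMin (mDim α n) n xt ω w ∧ vn w ≤ (1 - ε₁) * r}) ?_ _ ?_
    · intro ω hω
      by_contra hcon
      apply hω
      simp only [Set.mem_union, Set.mem_setOf_eq, not_or, not_exists, not_and, not_lt, not_le] at hcon
      obtain ⟨w, hw⟩ := min_exists (m := mDim α n) xt hxts.2 ω
      obtain ⟨f1, f2, f3⟩ := min_zeta xt w hxts.2 ω hw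
      refine ⟨w + xt, f1, f2, f3, ?_, ?_⟩
      · rw [e2_eq, add_sub_cancel_right]; exact (hcon.2 w hw).le
      · rw [e2_eq, add_sub_cancel_right]; exact hcon.1 w hw
    · refine (measureReal_union_le _ _).trans ?_
      have hn0 : (0:ℝ) ≤ n := Nat.cast_nonneg n
      have t1 : Real.exp (-(c1 * n)) ≤ Real.exp (-(c3 * n)) := by
        apply Real.exp_le_exp.2
        have : c3 ≤ c1 := min_le_left _ _
        exact neg_le_neg (mul_le_mul_of_nonneg_right this hn0)
      have t2 : Real.exp (-(c2 * n)) ≤ Real.exp (-(c3 * n)) := by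
        apply Real.exp_le_exp.2
        have : c3 ≤ c2 := min_le_right _ _
        exact neg_le_neg (mul_le_mul_of_nonneg_right this hn0)
      have := H3 n (by omega)
      linarith
  · intro xt hxts
    refine prob_ge _ _ {ω | ∃ w, LMin (mDim α n) n xt ω w ∧ (1 + ε₁) * r < vn w} ?_ _ (H1 n (by omega) xt hxts)
    intro ω hω
    by_contra hcon
    apply hω
    simp only [Set.mem_setOf_eq, not_exists, not_and, not_lt] at hcon
    intro xh f1 f2 f3
    rw [e2_eq]
    exact hcon _ (zeta_min xt xh hxts.2 ω f1 f2 f3)
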